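/- Given integers 1 ≤ a ≤ r and s ≥ 1, there exists a finite connected simple graph G such that im(G) = a, reg(K[V(G)]/I(G)) = r, and the h-polynomial of K[V(G)]/I(G) has degree s. -/

import Mathlib

open MvPolynomial PowerSeries

/-- A matching of a simple graph: a set of pairwise disjoint edges. -/
def IsMatchingSet {V : Type*} (G : SimpleGraph V) (M : Finset (Sym2 V)) : Prop :=
  (↑M : Set (Sym2 V)) ⊆ G.edgeSet ∧
    ∀ e ∈ M, ∀ f ∈ M, e ≠ f → ∀ v, v ∈ e → v ∉ f

/-- An induced matching: a matching such that no edge of `G` meets two distinct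
edges of the matching. -/
def IsInducedMatchingSet {V : Type*} (G : SimpleGraph V) (M : Finset (Sym2 V)) : Prop :=
  IsMatchingSet G M ∧
    ∀ e ∈ G.edgeSet, ∀ f ∈ M, ∀ g ∈ M, f ≠ g →
      ¬((∃ v, v ∈ e ∧ v ∈ f) ∧ (∃ w, w ∈ e ∧ w ∈ g))

/-- The matching number `m(G)`. -/
noncomputable def matchNum {V : Type*} (G : SimpleGraph V) : ℕ :=
  sSup {k | ∃ M : Finset (Sym2 V), IsMatchingSet G M ∧ M.card = k}

/-- The induced matching number `im(G)`. -/
noncomputable def indMatchNum {V : Type*} (G : SimpleGraph V) : ℕ :=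
  sSup {k | ∃ M : Finset (Sym2 V), IsInducedMatchingSet G M ∧ M.card = k}

/-- The `S`-suspension `G^S`: add a new vertex (`none`) joined to every vertex not in `S`. -/
def sSusp {V : Type*} (G : SimpleGraph V) (S : Set V) : SimpleGraph (Option V) :=
  SimpleGraph.fromRel (fun a b =>
    (∃ x y, a = some x ∧ b = some y ∧ G.Adj x y) ∨
    (a = none ∧ ∃ y, b = some y ∧ y ∉ S))

/-- The `{x_i,x_j}, S`-suspension: add a new vertex (`none`) joined to every vertex
outside `S ∪ {i, j}`. -/
def eSusp {V : Type*} (G : SimpleGraph V) (i j : V) (S : Set V) : SimpleGraph (Option V) :=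
  SimpleGraph.fromRel (fun a b =>
    (∃ x y, a = some x ∧ b = some y ∧ G.Adj x y) ∨
    (a = none ∧ ∃ y, b = some y ∧ y ∉ S ∧ y ≠ i ∧ y ≠ j))

/-- The edge ideal of a graph. -/
noncomputable def edgeIdeal (K : Type*) [Field K] {σ : Type*} (G : SimpleGraph σ) :
    Ideal (MvPolynomial σ K) :=
  Ideal.span {p | ∃ i j, G.Adj i j ∧ p = X i * X j}

/-- The Hilbert function of `R/I` (standard grading). -/
noncomputable def hilbFun (K : Type*) [Field K] {σ : Type*}
    (I : Ideal (MvPolynomial σ K)) (n : ℕ) : ℕ :=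
  Module.finrank K ((homogeneousSubmodule σ K n).map
    (Ideal.Quotient.mkₐ K I).toLinearMap)

/-- The Hilbert series of `R/I`, as a power series over `ℚ`. -/
noncomputable def hilbSeries (K : Type*) [Field K] {σ : Type*}
    (I : Ideal (MvPolynomial σ K)) : PowerSeries ℚ :=
  PowerSeries.mk fun n => (hilbFun K I n : ℚ)

/-- `HilbEq K I d h` says that the Hilbert series of `R/I` equals `h(λ)/(1-λ)^d`
with `h(1) ≠ 0`, i.e. `h` is the `h`-polynomial and `d = dim R/I`. -/
def HilbEq (K : Type*) [Field K] {σ : Type*} (I : Ideal (MvPolynomial σ K))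
    (d : ℕ) (h : Polynomial ℤ) : Prop :=
  hilbSeries K I * (1 - PowerSeries.X) ^ d =
    ((h.map (Int.castRingHom ℚ) : Polynomial ℚ) : PowerSeries ℚ) ∧ h.eval 1 ≠ 0

/-- `regBound K I r` : there is a finite graded free resolution of `R/I` all of whose
generator degrees in homological degree `i` are at most `i + r`.  The minimal free
resolution realizes `r = reg(R/I)`, and the generator degrees of any graded free
resolution contain those of the minimal one, hence
`reg(R/I) = sInf {r | regBound K I r}`. -/
noncomputable def regBound (K : Type*) [Field K] {σ : Type*}
    (I : Ideal (MvPolynomial σ K)) (r : ℕ) : Prop :=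
  ∃ (L : ℕ) (k : ℕ → ℕ) (d : (i : ℕ) → Fin (k i) → ℕ)
    (φ : (i : ℕ) → ((Fin (k (i + 1)) →₀ MvPolynomial σ K) →ₗ[MvPolynomial σ K]
      (Fin (k i) →₀ MvPolynomial σ K)))
    (ε : (Fin (k 0) →₀ MvPolynomial σ K) →ₗ[MvPolynomial σ K] (MvPolynomial σ K ⧸ I)),
    (∀ i, L ≤ i → k i = 0) ∧
    (∀ (i : ℕ) (b : Fin (k (i + 1))) (a : Fin (k i)),
      (φ i (Finsupp.single b 1)) a ∈ homogeneousSubmodule σ K (d (i + 1) b - d i a) ∧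
      (d (i + 1) b < d i a → (φ i (Finsupp.single b 1)) a = 0)) ∧
    (∀ a : Fin (k 0), ε (Finsupp.single a 1) ∈
      (homogeneousSubmodule σ K (d 0 a)).map (Ideal.Quotient.mkₐ K I).toLinearMap) ∧
    Function.Surjective ε ∧
    LinearMap.range (φ 0) = LinearMap.ker ε ∧
    (∀ i : ℕ, LinearMap.range (φ (i + 1)) = LinearMap.ker (φ i)) ∧
    (∀ (i : ℕ) (a : Fin (k i)), d i a ≤ i + r)

/-- The Castelnuovo–Mumford regularity of `R/I`. -/
noncomputable def reg (K : Type*) [Field K] {σ : Type*}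
    (I : Ideal (MvPolynomial σ K)) : ℕ :=
  sInf {r | regBound K I r}



section PartOne
universe u
variable {K : Type u} [Field K] {σ : Type}

/-- graded pieces of a graded free module -/
noncomputable def Fgr (K : Type u) [Field K] (σ : Type) {ι : Type} (d : ι → ℕ) (n : ℕ) :
    AddSubgroup (ι →₀ MvPolynomial σ K) where
  carrier := {u | ∀ a, u a ∈ homogeneousSubmodule σ K (n - d a) ∧ (n < d a → u a = 0)}
  zero_mem' := by intro a; simp [Submodule.zero_mem]
  add_mem' := by
    intro x y hx hy a
    refine ⟨?_, fun h => ?_⟩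
    · rw [Finsupp.add_apply]; exact Submodule.add_mem _ (hx a).1 (hy a).1
    · rw [Finsupp.add_apply, (hx a).2 h, (hy a).2 h, add_zero]
  neg_mem' := by
    intro x hx a
    refine ⟨?_, fun h => ?_⟩
    · rw [Finsupp.neg_apply]; exact Submodule.neg_mem _ (hx a).1
    · rw [Finsupp.neg_apply, (hx a).2 h, neg_zero]

theorem mem_Fgr {ι : Type} {d : ι → ℕ} {n : ℕ} {u : ι →₀ MvPolynomial σ K} :
    u ∈ Fgr K σ d n ↔
      ∀ a, u a ∈ homogeneousSubmodule σ K (n - d a) ∧ (n < d a → u a = 0) := Iff.rfl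

/-- compatibility of a family of subgroups with the polynomial grading -/
def IsGr {M : Type u} [AddCommGroup M] [Module (MvPolynomial σ K) M]
    (gr : ℕ → AddSubgroup M) : Prop :=
  ∀ i j (p : MvPolynomial σ K) (m : M), p ∈ homogeneousSubmodule σ K i → m ∈ gr j →
    p • m ∈ gr (i + j)

/-- graded pieces of a submodule of a free module -/
noncomputable def Kgr {ι : Type} (d : ι → ℕ) (N : Submodule (MvPolynomial σ K) (ι →₀ MvPolynomial σ K))
    (n : ℕ) : AddSubgroup N :=
  (Fgr K σ d n).comap N.subtype.toAddMonoidHom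

theorem mem_Kgr {ι : Type} {d : ι → ℕ}
    {N : Submodule (MvPolynomial σ K) (ι →₀ MvPolynomial σ K)} {n : ℕ} {u : N} :
    u ∈ Kgr d N n ↔ (u : ι →₀ MvPolynomial σ K) ∈ Fgr K σ d n := Iff.rfl

theorem single_mem_Fgr {ι : Type} (d : ι → ℕ) (a : ι) :
    (Finsupp.single a 1 : ι →₀ MvPolynomial σ K) ∈ Fgr K σ d (d a) := by
  classical
  intro b
  by_cases h : a = b
  · subst h
    exact ⟨by rw [Finsupp.single_eq_same, Nat.sub_self]; exact isHomogeneous_one _ _, fun h => absurd h (lt_irrefl _)⟩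
  · rw [Finsupp.single_eq_of_ne (Ne.symm h)]
    simp [Submodule.zero_mem]

theorem smul_mem_Fgr {ι : Type} (d : ι → ℕ) (i j : ℕ) (p : MvPolynomial σ K)
    (m : ι →₀ MvPolynomial σ K) (hp : p ∈ homogeneousSubmodule σ K i)
    (hm : m ∈ Fgr K σ d j) : p • m ∈ Fgr K σ d (i + j) := by
  intro a
  rw [Finsupp.smul_apply, smul_eq_mul]
  by_cases h : j < d a
  · rw [(hm a).2 h]; simp [Submodule.zero_mem]
  · refine ⟨?_, fun h' => by omega⟩
    have := (hm a).1
    rw [show i + j - d a = i + (j - d a) by omega]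
    exact IsHomogeneous.mul hp this

theorem isGr_Kgr {ι : Type} (d : ι → ℕ)
    (N : Submodule (MvPolynomial σ K) (ι →₀ MvPolynomial σ K)) : IsGr (K := K) (σ := σ) (Kgr d N) :=
  fun i j p m hp hm => smul_mem_Fgr d i j p m hp hm

/-- bounded graded resolutions, recursively -/
def RB (K : Type u) [Field K] (σ : Type) : ℕ → ℕ → (M : Type u) → [AddCommGroup M] →
    [Module (MvPolynomial σ K) M] → (ℕ → AddSubgroup M) → Prop
  | 0, _, M, _, _, _ => Subsingleton M
  | (L + 1), r, M, _, _, gr =>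
    ∃ (ι : Type) (_ : Fintype ι) (d : ι → ℕ)
      (ψ : (ι →₀ MvPolynomial σ K) →ₗ[MvPolynomial σ K] M),
      (∀ a, d a ≤ r) ∧ (∀ n, ∀ u ∈ Fgr K σ d n, ψ u ∈ gr n) ∧ Function.Surjective ψ ∧
      (∀ n, ∀ m ∈ gr n, ∃ u ∈ Fgr K σ d n, ψ u = m) ∧
      RB K σ L (r + 1) (LinearMap.ker ψ) (Kgr d (LinearMap.ker ψ))

theorem RB_equiv (L : ℕ) : ∀ (r : ℕ) (M N : Type u) [AddCommGroup M] [AddCommGroup N]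
    [Module (MvPolynomial σ K) M] [Module (MvPolynomial σ K) N]
    (gr : ℕ → AddSubgroup M) (gr' : ℕ → AddSubgroup N)
    (e : M ≃ₗ[MvPolynomial σ K] N) (_ : ∀ n m, m ∈ gr n ↔ e m ∈ gr' n),
    RB K σ L r M gr → RB K σ L r N gr' := by
  induction L with
  | zero =>
    intro r M N _ _ _ _ gr gr' e he h
    have : Subsingleton M := h
    exact e.symm.toEquiv.subsingleton
  | succ L ih =>
    rintro r M N _ _ _ _ gr gr' e he ⟨ι, hι, d, ψ, h1, h2, h3, h4, h5⟩
    have hk : LinearMap.ker ψ = LinearMap.ker (e.toLinearMap ∘ₗ ψ) := by ext; simp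
    refine ⟨ι, hι, d, e.toLinearMap ∘ₗ ψ, h1, ?_, ?_, ?_, ?_⟩
    · intro n u hu; exact (he n _).1 (h2 n u hu)
    · exact e.surjective.comp h3
    · intro n m hm
      obtain ⟨u, hu, hum⟩ := h4 n (e.symm m) ((he n _).2 (by simpa using hm))
      exact ⟨u, hu, by simp [hum]⟩
    · exact ih (r + 1) _ _ _ _ (LinearEquiv.ofEq _ _ hk) (fun n m => Iff.rfl) h5

theorem RB_mono_r (L : ℕ) : ∀ (r r' : ℕ) (_ : r ≤ r') (M : Type u) [AddCommGroup M]
    [Module (MvPolynomial σ K) M] (gr : ℕ → AddSubgroup M),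
    RB K σ L r M gr → RB K σ L r' M gr := by
  induction L with
  | zero => intro r r' _ M _ _ gr h; exact h
  | succ L ih =>
    rintro r r' hr M _ _ gr ⟨ι, hι, d, ψ, h1, h2, h3, h4, h5⟩
    exact ⟨ι, hι, d, ψ, fun a => (h1 a).trans hr, h2, h3, h4, ih _ _ (by omega) _ _ h5⟩

theorem RB_mono_L (L : ℕ) : ∀ (r : ℕ) (M : Type u) [AddCommGroup M]
    [Module (MvPolynomial σ K) M] (gr : ℕ → AddSubgroup M),
    RB K σ L r M gr → RB K σ (L + 1) r M gr := by
  induction L with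
  | zero =>
    intro r M _ _ gr h
    have : Subsingleton M := h
    refine ⟨Empty, inferInstance, fun _ => 0, 0, fun a => a.elim, ?_, ?_, ?_, ?_⟩
    · intro n u _; rw [Subsingleton.elim ((0 : (Empty →₀ MvPolynomial σ K) →ₗ[_] M) u) 0]
      exact AddSubgroup.zero_mem _
    · intro m; exact ⟨0, Subsingleton.elim _ _⟩
    · intro n m _; exact ⟨0, AddSubgroup.zero_mem _, Subsingleton.elim _ _⟩
    · show Subsingleton _
      infer_instance
  | succ L ih =>
    rintro r M _ _ gr ⟨ι, hι, d, ψ, h1, h2, h3, h4, h5⟩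
    exact ⟨ι, hι, d, ψ, h1, h2, h3, h4, ih _ _ _ h5⟩

theorem RB_mono_L' {L L' : ℕ} (h : L ≤ L') {r : ℕ} {M : Type u} [AddCommGroup M]
    [Module (MvPolynomial σ K) M] {gr : ℕ → AddSubgroup M}
    (hM : RB K σ L r M gr) : RB K σ L' r M gr := by
  induction h with
  | refl => exact hM
  | step _ ih => exact RB_mono_L _ _ _ _ ih

theorem Fgr_shift {ι : Type} (d : ι → ℕ) (n : ℕ) (u : ι →₀ MvPolynomial σ K) :
    u ∈ Fgr K σ (fun a => d a + 1) (n + 1) ↔ u ∈ Fgr K σ d n := by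
  simp only [mem_Fgr, Nat.add_sub_add_right, Nat.add_lt_add_iff_right]

theorem Fgr_shift_zero {ι : Type} (d : ι → ℕ) (u : ι →₀ MvPolynomial σ K) :
    u ∈ Fgr K σ (fun a => d a + 1) 0 ↔ u = 0 := by
  constructor
  · intro h; ext1 a; exact (h a).2 (Nat.succ_pos _)
  · rintro rfl; exact AddSubgroup.zero_mem _

theorem RB_shift (L : ℕ) : ∀ (r : ℕ) (M : Type u) [AddCommGroup M]
    [Module (MvPolynomial σ K) M] (gr gr' : ℕ → AddSubgroup M)
    (_ : ∀ n m, m ∈ gr' (n + 1) ↔ m ∈ gr n) (_ : ∀ m, m ∈ gr' 0 ↔ m = 0),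
    RB K σ L r M gr → RB K σ L (r + 1) M gr' := by
  induction L with
  | zero => intro r M _ _ gr gr' _ _ h; exact h
  | succ L ih =>
    rintro r M _ _ gr gr' hs h0 ⟨ι, hι, d, ψ, h1, h2, h3, h4, h5⟩
    refine ⟨ι, hι, fun a => d a + 1, ψ, fun a => Nat.succ_le_succ (h1 a), ?_, h3, ?_, ?_⟩
    · intro n u hu
      cases n with
      | zero => rw [Fgr_shift_zero] at hu; subst hu; rw [h0]; simp
      | succ n => rw [hs]; exact h2 n u ((Fgr_shift _ _ _).1 hu)
    · intro n m hm
      cases n with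
      | zero => rw [h0] at hm; exact ⟨0, AddSubgroup.zero_mem _, by simp [hm]⟩
      | succ n =>
        obtain ⟨u, hu, h⟩ := h4 n m ((hs _ _).1 hm)
        exact ⟨u, (Fgr_shift _ _ _).2 hu, h⟩
    · refine ih _ _ (Kgr d _) _ ?_ ?_ h5
      · intro n m; rw [mem_Kgr, mem_Kgr]; exact Fgr_shift _ _ _
      · intro m; rw [mem_Kgr, Fgr_shift_zero]; simp

/-- short exact sequences of graded modules -/
structure GSES {A B C : Type u} [AddCommGroup A] [AddCommGroup B] [AddCommGroup C]
    [Module (MvPolynomial σ K) A] [Module (MvPolynomial σ K) B] [Module (MvPolynomial σ K) C]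
    (gA : ℕ → AddSubgroup A) (gB : ℕ → AddSubgroup B) (gC : ℕ → AddSubgroup C)
    (f : A →ₗ[MvPolynomial σ K] B) (g : B →ₗ[MvPolynomial σ K] C) : Prop where
  isgr : IsGr (K := K) (σ := σ) gB
  inj : Function.Injective f
  surj : Function.Surjective g
  gf : ∀ a, g (f a) = 0
  ex : ∀ b, g b = 0 → ∃ a, f a = b
  fgr : ∀ n a, a ∈ gA n ↔ f a ∈ gB n
  ggr : ∀ n, ∀ b ∈ gB n, g b ∈ gC n
  gl : ∀ n, ∀ c ∈ gC n, ∃ b ∈ gB n, g b = c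

theorem Fgr_sum {ι κ : Type} (d : ι → ℕ) (e : κ → ℕ) (n : ℕ)
    (u : ι ⊕ κ →₀ MvPolynomial σ K) :
    u ∈ Fgr K σ (Sum.elim d e) n ↔
      (Finsupp.sumFinsuppLEquivProdFinsupp (MvPolynomial σ K) u).1 ∈ Fgr K σ d n ∧
      (Finsupp.sumFinsuppLEquivProdFinsupp (MvPolynomial σ K) u).2 ∈ Fgr K σ e n := by
  simp only [mem_Fgr]
  constructor
  · intro h; exact ⟨fun a => by simpa using h (Sum.inl a), fun a => by simpa using h (Sum.inr a)⟩
  · rintro ⟨h1, h2⟩ (a | a)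
    · simpa using h1 a
    · simpa using h2 a

theorem linComb_mem {ι : Type} {B : Type u} [AddCommGroup B] [Module (MvPolynomial σ K) B]
    {gB : ℕ → AddSubgroup B} (hB : IsGr (K := K) (σ := σ) gB) (d : ι → ℕ) (v : ι → B)
    (hv : ∀ a, v a ∈ gB (d a)) (n : ℕ) (u : ι →₀ MvPolynomial σ K) (hu : u ∈ Fgr K σ d n) :
    Finsupp.linearCombination (MvPolynomial σ K) v u ∈ gB n := by
  rw [Finsupp.linearCombination_apply]
  refine AddSubgroup.sum_mem _ fun a _ => ?_
  by_cases h : n < d a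
  · simp only [(hu a).2 h, zero_smul]; exact AddSubgroup.zero_mem _
  · have := hB (n - d a) (d a) (u a) (v a) (hu a).1 (hv a)
    rwa [Nat.sub_add_cancel (by omega)] at this

theorem RB_horseshoe (L : ℕ) : ∀ (r : ℕ) (A B C : Type u) [AddCommGroup A] [AddCommGroup B]
    [AddCommGroup C]
    [Module (MvPolynomial σ K) A] [Module (MvPolynomial σ K) B] [Module (MvPolynomial σ K) C]
    (gA : ℕ → AddSubgroup A) (gB : ℕ → AddSubgroup B) (gC : ℕ → AddSubgroup C)
    (f : A →ₗ[MvPolynomial σ K] B) (g : B →ₗ[MvPolynomial σ K] C) (_ : GSES gA gB gC f g),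
    RB K σ L r A gA → RB K σ L r C gC → RB K σ L r B gB := by
  induction L with
  | zero =>
    intro r A B C _ _ _ _ _ _ gA gB gC f g h hA hC
    have : Subsingleton A := hA
    have : Subsingleton C := hC
    refine ⟨fun x y => ?_⟩
    have key : ∀ x : B, x = 0 := fun x => by
      obtain ⟨a, rfl⟩ := h.ex x (Subsingleton.elim _ _)
      rw [Subsingleton.elim a 0, map_zero]
    rw [key x, key y]
  | succ L ih =>
    rintro r A B C _ _ _ _ _ _ gA gB gC f g h ⟨ι, hι, d, ψ, h1, h2, h3, h4, h5⟩
      ⟨κ, _, e, χ, k1, k2, k3, k4, k5⟩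
    choose v hv hgv using fun a => h.gl (e a) (χ (Finsupp.single a 1))
      (k2 _ _ (single_mem_Fgr e a))
    set lam := Finsupp.linearCombination (MvPolynomial σ K) v with hlam
    have hgl : ∀ u, g (lam u) = χ u := by
      intro u
      have : g ∘ₗ lam = χ := by
        apply Finsupp.lhom_ext'
        intro a
        apply LinearMap.ext_ring
        simp [hlam, hgv]
      exact LinearMap.congr_fun this u
    have hlg : ∀ n u, u ∈ Fgr K σ e n → lam u ∈ gB n := fun n u hu =>
      linComb_mem h.isgr e v hv n u hu
    set E := Finsupp.sumFinsuppLEquivProdFinsupp (α := ι) (β := κ) (M := MvPolynomial σ K)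
      (MvPolynomial σ K) with hE
    set Ψ : (ι ⊕ κ →₀ MvPolynomial σ K) →ₗ[MvPolynomial σ K] B :=
      (LinearMap.coprod (f ∘ₗ ψ) lam) ∘ₗ E.toLinearMap with hΨ
    have hΨa : ∀ u, Ψ u = f (ψ (E u).1) + lam (E u).2 := fun u => by simp [hΨ]
    have hgΨ : ∀ u, g (Ψ u) = χ (E u).2 := fun u => by rw [hΨa, map_add, h.gf, zero_add, hgl]
    refine ⟨ι ⊕ κ, inferInstance, Sum.elim d e, Ψ, ?_, ?_, ?_, ?_, ?_⟩
    · rintro (a | a)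
      · exact h1 a
      · exact k1 a
    · intro n u hu
      rw [Fgr_sum] at hu
      rw [hΨa]
      exact AddSubgroup.add_mem _ ((h.fgr n _).1 (h2 n _ hu.1)) (hlg n _ hu.2)
    · intro b
      obtain ⟨w, hw⟩ := k3 (g b)
      obtain ⟨a, ha⟩ := h.ex (b - lam w) (by rw [map_sub, hgl, hw, sub_self])
      obtain ⟨u, rfl⟩ := h3 a
      exact ⟨E.symm (u, w), by rw [hΨa, LinearEquiv.apply_symm_apply, ha, sub_add_cancel]⟩
    · intro n b hb
      obtain ⟨w, hwn, hw⟩ := k4 n (g b) (h.ggr n b hb)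
      obtain ⟨a, ha⟩ := h.ex (b - lam w) (by rw [map_sub, hgl, hw, sub_self])
      obtain ⟨u, hun, rfl⟩ := h4 n a ((h.fgr n a).2
        (by rw [ha]; exact AddSubgroup.sub_mem _ hb (hlg n w hwn)))
      refine ⟨E.symm (u, w), ?_, by rw [hΨa, LinearEquiv.apply_symm_apply, ha, sub_add_cancel]⟩
      rw [Fgr_sum, ← hE, LinearEquiv.apply_symm_apply]
      exact ⟨hun, hwn⟩
    · have F1 : ∀ u : LinearMap.ker ψ, E.symm (u.1, 0) ∈ LinearMap.ker Ψ := by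
        rintro ⟨u, hu⟩
        rw [LinearMap.mem_ker] at hu ⊢
        rw [hΨa, LinearEquiv.apply_symm_apply]
        simp [hu]
      have F2 : ∀ u : LinearMap.ker Ψ, (E u.1).2 ∈ LinearMap.ker χ := by
        rintro ⟨u, hu⟩
        rw [LinearMap.mem_ker] at hu ⊢
        rw [← hgΨ, hu, map_zero]
      let f' : LinearMap.ker ψ →ₗ[MvPolynomial σ K] LinearMap.ker Ψ :=
        LinearMap.codRestrict _ (E.symm.toLinearMap ∘ₗ (LinearMap.inl _ _ _) ∘ₗ
          (LinearMap.ker ψ).subtype) F1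
      let g' : LinearMap.ker Ψ →ₗ[MvPolynomial σ K] LinearMap.ker χ :=
        LinearMap.codRestrict _ ((LinearMap.snd _ _ _) ∘ₗ E.toLinearMap ∘ₗ
          (LinearMap.ker Ψ).subtype) F2
      have Hf : ∀ u, E (f' u).1 = (u.1, 0) := fun u => by
        show E (E.symm (u.1, 0)) = _
        rw [LinearEquiv.apply_symm_apply]
      have Hg : ∀ u, (g' u).1 = (E u.1).2 := fun u => rfl
      refine ih (r + 1) _ _ _ _ _ _ f' g' ⟨isGr_Kgr _ _, ?_, ?_, ?_, ?_, ?_, ?_, ?_⟩ h5 k5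
      · intro u w huw
        have := congrArg (fun z => (E z.1).1) huw
        simp only [Hf] at this
        exact Subtype.ext this
      · rintro ⟨w, hw⟩
        rw [LinearMap.mem_ker] at hw
        obtain ⟨a, ha⟩ := h.ex (lam w) (by rw [hgl, hw])
        obtain ⟨u, rfl⟩ := h3 a
        refine ⟨⟨E.symm (-u, w), ?_⟩, ?_⟩
        · rw [LinearMap.mem_ker, hΨa, LinearEquiv.apply_symm_apply]; simp [ha]
        · apply Subtype.ext; rw [Hg, LinearEquiv.apply_symm_apply]
      · intro a; apply Subtype.ext; rw [Hg, Hf]; rfl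
      · intro b hb
        have hb2 : (E b.1).2 = 0 := by rw [← Hg, hb]; rfl
        have hb1 : (E b.1).1 ∈ LinearMap.ker ψ := by
          have := b.2
          rw [LinearMap.mem_ker, hΨa, hb2, map_zero, add_zero] at this
          rw [LinearMap.mem_ker]
          exact h.inj (by rw [this, map_zero])
        refine ⟨⟨_, hb1⟩, ?_⟩
        apply Subtype.ext
        apply E.injective
        rw [Hf]
        exact Prod.ext rfl hb2.symm
      · intro n a
        rw [mem_Kgr, mem_Kgr, Fgr_sum, ← hE, Hf]
        exact ⟨fun h => ⟨h, AddSubgroup.zero_mem _⟩, fun h => h.1⟩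
      · intro n b hb
        rw [mem_Kgr, Fgr_sum] at hb
        exact hb.2
      · rintro n ⟨w, hw⟩ hwn
        rw [mem_Kgr] at hwn
        rw [LinearMap.mem_ker] at hw
        obtain ⟨a, ha⟩ := h.ex (lam w) (by rw [hgl, hw])
        obtain ⟨u, hun, rfl⟩ := h4 n a ((h.fgr n a).2 (by rw [ha]; exact hlg n w hwn))
        refine ⟨⟨E.symm (-u, w), ?_⟩, ?_, ?_⟩
        · rw [LinearMap.mem_ker, hΨa, LinearEquiv.apply_symm_apply]; simp [ha]
        · rw [mem_Kgr, Fgr_sum, ← hE, LinearEquiv.apply_symm_apply]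
          exact ⟨AddSubgroup.neg_mem _ hun, hwn⟩
        · apply Subtype.ext; rw [Hg, LinearEquiv.apply_symm_apply]

theorem RB_cone {L r : ℕ} {A B C : Type u} [AddCommGroup A] [AddCommGroup B]
    [AddCommGroup C]
    [Module (MvPolynomial σ K) A] [Module (MvPolynomial σ K) B] [Module (MvPolynomial σ K) C]
    {gA : ℕ → AddSubgroup A} {gB : ℕ → AddSubgroup B} {gC : ℕ → AddSubgroup C}
    {f : A →ₗ[MvPolynomial σ K] B} {g : B →ₗ[MvPolynomial σ K] C} (h : GSES gA gB gC f g)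
    (hA : RB K σ L (r + 1) A gA) (hB : RB K σ (L + 1) r B gB) :
    RB K σ (L + 1) r C gC := by
  obtain ⟨ι, hι, d, ψ, h1, h2, h3, h4, h5⟩ := hB
  refine ⟨ι, hι, d, g ∘ₗ ψ, h1, ?_, h.surj.comp h3, ?_, ?_⟩
  · intro n u hu; exact h.ggr n _ (h2 n u hu)
  · intro n c hc
    obtain ⟨b, hb, rfl⟩ := h.gl n c hc
    obtain ⟨u, hu, rfl⟩ := h4 n b hb
    exact ⟨u, hu, rfl⟩
  · have F1 : ∀ u : LinearMap.ker ψ, u.1 ∈ LinearMap.ker (g ∘ₗ ψ) := by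
      rintro ⟨u, hu⟩
      rw [LinearMap.mem_ker] at hu
      simp [hu]
    let f' : LinearMap.ker ψ →ₗ[MvPolynomial σ K] LinearMap.ker (g ∘ₗ ψ) :=
      LinearMap.codRestrict _ (LinearMap.ker ψ).subtype F1
    have F2 : ∀ u : LinearMap.ker (g ∘ₗ ψ), ψ u.1 ∈ LinearMap.range f := by
      rintro ⟨u, hu⟩
      exact h.ex _ (LinearMap.mem_ker.1 hu)
    let g' : LinearMap.ker (g ∘ₗ ψ) →ₗ[MvPolynomial σ K] A :=
      (LinearEquiv.ofInjective f h.inj).symm.toLinearMap ∘ₗ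
      LinearMap.codRestrict (LinearMap.range f) (ψ ∘ₗ (LinearMap.ker (g ∘ₗ ψ)).subtype) F2
    have Hg : ∀ u, f (g' u) = ψ u.1 := by
      intro u
      have := (LinearEquiv.ofInjective f h.inj).apply_symm_apply
        (LinearMap.codRestrict (LinearMap.range f) (ψ ∘ₗ (LinearMap.ker (g ∘ₗ ψ)).subtype) F2 u)
      have := congrArg Subtype.val this
      exact this
    refine RB_horseshoe L (r + 1) _ _ _ _ _ _ f' g' ⟨isGr_Kgr _ _, ?_, ?_, ?_, ?_, ?_, ?_, ?_⟩
      h5 hA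
    · intro u w huw
      have h' := congrArg Subtype.val huw
      exact Subtype.ext h'
    · intro a
      obtain ⟨u, hu⟩ := h3 (f a)
      refine ⟨⟨u, ?_⟩, h.inj ?_⟩
      · rw [LinearMap.mem_ker, LinearMap.comp_apply, hu, h.gf]
      · rw [Hg, hu]
    · intro a; apply h.inj; rw [Hg, map_zero]; exact a.2
    · intro b hb
      refine ⟨⟨b.1, ?_⟩, rfl⟩
      rw [LinearMap.mem_ker, ← Hg, hb, map_zero]
    · intro n a; exact Iff.rfl
    · intro n b hb
      rw [h.fgr, Hg]; exact h2 n _ hb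
    · intro n a ha
      obtain ⟨u, hu, hua⟩ := h4 n (f a) ((h.fgr n a).1 ha)
      refine ⟨⟨u, ?_⟩, hu, h.inj ?_⟩
      · rw [LinearMap.mem_ker, LinearMap.comp_apply, hua, h.gf]
      · rw [Hg, hua]

end PartOne


section PartTwo
universe u
variable {K : Type u} [Field K] {σ : Type}

theorem RB_fin {L r : ℕ} {M : Type u} [AddCommGroup M] [Module (MvPolynomial σ K) M]
    {gr : ℕ → AddSubgroup M} (h : RB K σ (L + 1) r M gr) :
    ∃ (k : ℕ) (d : Fin k → ℕ) (ψ : (Fin k →₀ MvPolynomial σ K) →ₗ[MvPolynomial σ K] M),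
      (∀ a, d a ≤ r) ∧ (∀ n, ∀ u ∈ Fgr K σ d n, ψ u ∈ gr n) ∧ Function.Surjective ψ ∧
      RB K σ L (r + 1) (LinearMap.ker ψ) (Kgr d (LinearMap.ker ψ)) := by
  obtain ⟨ι, hι, d, ψ, h1, h2, h3, h4, h5⟩ := h
  let e := Fintype.equivFin ι
  let E : (ι →₀ MvPolynomial σ K) ≃ₗ[MvPolynomial σ K] (Fin (Fintype.card ι) →₀ MvPolynomial σ K) :=
    Finsupp.domLCongr e
  have hE : ∀ n u, u ∈ Fgr K σ d n ↔ E u ∈ Fgr K σ (d ∘ e.symm) n := by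
    intro n u
    simp only [mem_Fgr, E, Finsupp.domLCongr_apply, Finsupp.domCongr_apply,
      Finsupp.equivMapDomain_apply, Function.comp]
    exact ⟨fun h a => h _, fun h a => by simpa using h (e a)⟩
  refine ⟨Fintype.card ι, d ∘ e.symm, ψ ∘ₗ E.symm.toLinearMap, fun a => h1 _, ?_, ?_, ?_⟩
  · intro n u hu
    exact h2 n _ ((hE _ _).2 (by simpa using hu))
  · exact h3.comp E.symm.surjective
  · have hm : Submodule.map E.toLinearMap (LinearMap.ker ψ) =
        LinearMap.ker (ψ ∘ₗ E.symm.toLinearMap) := by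
      ext u
      constructor
      · rintro ⟨w, hw, rfl⟩
        simpa using hw
      · intro hu
        exact ⟨E.symm u, hu, by simp⟩
    refine RB_equiv _ _ _ _ _ _ (E.ofSubmodules _ _ hm) ?_ h5
    intro n m
    exact hE n _

theorem RB_extract (L : ℕ) : ∀ (r : ℕ) (M : Type u) [AddCommGroup M]
    [Module (MvPolynomial σ K) M] (gr : ℕ → AddSubgroup M) (_ : RB K σ L r M gr),
    ∃ (k : ℕ → ℕ) (d : (i : ℕ) → Fin (k i) → ℕ)
    (φ : (i : ℕ) → ((Fin (k (i + 1)) →₀ MvPolynomial σ K) →ₗ[MvPolynomial σ K]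
      (Fin (k i) →₀ MvPolynomial σ K)))
    (ε : (Fin (k 0) →₀ MvPolynomial σ K) →ₗ[MvPolynomial σ K] M),
    (∀ i, L ≤ i → k i = 0) ∧
    (∀ (i : ℕ) (b : Fin (k (i + 1))) (a : Fin (k i)),
      (φ i (Finsupp.single b 1)) a ∈ homogeneousSubmodule σ K (d (i + 1) b - d i a) ∧
      (d (i + 1) b < d i a → (φ i (Finsupp.single b 1)) a = 0)) ∧
    (∀ a : Fin (k 0), ε (Finsupp.single a 1) ∈ gr (d 0 a)) ∧
    Function.Surjective ε ∧
    LinearMap.range (φ 0) = LinearMap.ker ε ∧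
    (∀ i : ℕ, LinearMap.range (φ (i + 1)) = LinearMap.ker (φ i)) ∧
    (∀ (i : ℕ) (a : Fin (k i)), d i a ≤ i + r) := by
  induction L with
  | zero =>
    intro r M _ _ gr h
    have : Subsingleton M := h
    refine ⟨fun _ => 0, fun _ a => a.elim0, fun _ => 0, 0, fun _ _ => rfl, fun _ b => b.elim0,
      fun a => a.elim0, fun m => ⟨0, Subsingleton.elim _ _⟩, ?_, ?_, fun _ a => a.elim0⟩
    · exact Subsingleton.elim _ _
    · intro i; exact Subsingleton.elim _ _
  | succ L ih =>
    intro r M _ _ gr h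
    obtain ⟨k0, d0, ψ, h1, h2, h3, h5⟩ := RB_fin h
    obtain ⟨k, d, φ, ε, g1, g2, g3, g4, g5, g6, g7⟩ := ih _ _ _ h5
    let k' : ℕ → ℕ := fun i => Nat.casesOn i k0 k
    let d' : (i : ℕ) → Fin (k' i) → ℕ := fun i =>
      Nat.casesOn (motive := fun i => Fin (k' i) → ℕ) i d0 d
    let φ' : (i : ℕ) → ((Fin (k' (i + 1)) →₀ MvPolynomial σ K) →ₗ[MvPolynomial σ K]
      (Fin (k' i) →₀ MvPolynomial σ K)) := fun i =>
      Nat.casesOn (motive := fun i => (Fin (k' (i + 1)) →₀ MvPolynomial σ K)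
        →ₗ[MvPolynomial σ K] (Fin (k' i) →₀ MvPolynomial σ K)) i
        ((LinearMap.ker ψ).subtype ∘ₗ ε) φ
    refine ⟨k', d', φ', ψ, ?_, ?_, ?_, h3, ?_, ?_, ?_⟩
    · intro i hi
      cases i with
      | zero => omega
      | succ i => exact g1 i (by omega)
    · intro i
      cases i with
      | zero => intro b a; exact g3 b a
      | succ i => exact g2 i
    · intro a; exact h2 _ _ (single_mem_Fgr d0 a)
    · show LinearMap.range ((LinearMap.ker ψ).subtype ∘ₗ ε) = _
      rw [LinearMap.range_comp, LinearMap.range_eq_top.2 g4, Submodule.map_top,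
        Submodule.range_subtype]
    · intro i
      cases i with
      | zero =>
        show LinearMap.range (φ 0) = LinearMap.ker ((LinearMap.ker ψ).subtype ∘ₗ ε)
        rw [g5, LinearMap.ker_comp_of_ker_eq_bot _ (Submodule.ker_subtype _)]
      | succ i => exact g6 i
    · intro i
      cases i with
      | zero => intro a; have := h1 a; show d0 a ≤ _; omega
      | succ i => intro a; have := g7 i a; show d i a ≤ _; omega

/-- the graded pieces of a quotient ring -/
noncomputable def qgr (I : Ideal (MvPolynomial σ K)) (n : ℕ) :
    AddSubgroup (MvPolynomial σ K ⧸ I) :=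
  ((homogeneousSubmodule σ K n).map (Ideal.Quotient.mkₐ K I).toLinearMap).toAddSubgroup

theorem mem_qgr {I : Ideal (MvPolynomial σ K)} {n : ℕ} {m : MvPolynomial σ K ⧸ I} :
    m ∈ qgr I n ↔ ∃ p ∈ homogeneousSubmodule σ K n, Ideal.Quotient.mk I p = m := Iff.rfl

theorem regBound_of_RB {I : Ideal (MvPolynomial σ K)} {L r : ℕ}
    (h : RB K σ L r (MvPolynomial σ K ⧸ I) (qgr I)) : regBound K I r :=
  ⟨L, RB_extract L r _ _ h⟩

/-- monomial ideals -/
noncomputable def MI (K : Type u) [Field K] (P : (σ →₀ ℕ) → Prop)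
    (hP : ∀ α β, P α → P (α + β)) : Ideal (MvPolynomial σ K) where
  carrier := {p | ∀ α, MvPolynomial.coeff α p ≠ 0 → P α}
  zero_mem' := by intro α h; simp at h
  add_mem' := by
    intro p q hp hq α h
    rw [coeff_add] at h
    by_cases h1 : MvPolynomial.coeff α p = 0
    · rw [h1, zero_add] at h; exact hq α h
    · exact hp α h1
  smul_mem' := by
    classical
    intro c p hp α h
    rw [smul_eq_mul, MvPolynomial.coeff_mul] at h
    obtain ⟨⟨a, b⟩, hab, h⟩ := Finset.exists_ne_zero_of_sum_ne_zero h
    rw [Finset.HasAntidiagonal.mem_antidiagonal] at hab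
    simp only at hab h
    rw [← hab, add_comm]
    exact hP _ _ (hp b (right_ne_zero_of_mul h))

theorem mem_MI {P : (σ →₀ ℕ) → Prop} {hP : ∀ α β, P α → P (α + β)} {p : MvPolynomial σ K} :
    p ∈ MI K P hP ↔ ∀ α, MvPolynomial.coeff α p ≠ 0 → P α := Iff.rfl

/-- shifted grading -/
def sgr {M : Type u} [AddCommGroup M] (gr : ℕ → AddSubgroup M) : ℕ → AddSubgroup M
  | 0 => ⊥
  | n + 1 => gr n

theorem isGr_qgr (I : Ideal (MvPolynomial σ K)) : IsGr (K := K) (σ := σ) (qgr I) := by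
  rintro i j p m hp ⟨q, hq, rfl⟩
  exact ⟨p * q, IsHomogeneous.mul hp hq, rfl⟩

theorem coeff_X_mul_add (x : σ) (p : MvPolynomial σ K) (α : σ →₀ ℕ) :
    MvPolynomial.coeff (α + Finsupp.single x 1) (MvPolynomial.X x * p) = MvPolynomial.coeff α p := by
  rw [add_comm, coeff_X_mul]

section seq
variable (P Q T : (σ →₀ ℕ) → Prop) (hP : ∀ α β, P α → P (α + β))
  (hQ : ∀ α β, Q α → Q (α + β)) (hT : ∀ α β, T α → T (α + β)) (x : σ)

theorem monomial_seq (hPQ : ∀ α, Q α ↔ P (α + Finsupp.single x 1))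
    (hPT : ∀ α, T α ↔ (P α ∨ α x ≠ 0)) :
    ∃ (f : (MvPolynomial σ K ⧸ MI K Q hQ) →ₗ[MvPolynomial σ K] (MvPolynomial σ K ⧸ MI K P hP))
      (g : (MvPolynomial σ K ⧸ MI K P hP) →ₗ[MvPolynomial σ K] (MvPolynomial σ K ⧸ MI K T hT)),
      GSES (sgr (qgr (MI K Q hQ))) (qgr (MI K P hP)) (qgr (MI K T hT)) f g := by
  classical
  have hf : MI K Q hQ ≤ Submodule.comap (LinearMap.lsmul (MvPolynomial σ K) (MvPolynomial σ K)
      (MvPolynomial.X x)) (MI K P hP) := by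
    intro p hp α h
    rw [LinearMap.lsmul_apply, smul_eq_mul, coeff_X_mul'] at h
    split_ifs at h with hx
    · have := (hPQ _).1 (hp _ h)
      rwa [tsub_add_cancel_of_le] at this
      rw [Finsupp.single_le_iff]
      exact Nat.one_le_iff_ne_zero.2 (Finsupp.mem_support_iff.1 hx)
    · exact absurd rfl h
  have hg : MI K P hP ≤ Submodule.comap LinearMap.id (MI K T hT) := by
    intro p hp α h
    exact (hPT _).2 (Or.inl (hp α h))
  let f := Submodule.mapQ _ _ _ hf
  let g := Submodule.mapQ _ _ _ hg
  have Hf : ∀ p, f (Ideal.Quotient.mk _ p) = Ideal.Quotient.mk _ (MvPolynomial.X x * p) :=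
    fun p => rfl
  have Hg : ∀ p, g (Ideal.Quotient.mk _ p) = Ideal.Quotient.mk _ p := fun p => rfl
  have key : ∀ p c : MvPolynomial σ K, (∀ n, c ∈ homogeneousSubmodule σ K n →
      f (Ideal.Quotient.mk _ p) = Ideal.Quotient.mk _ c → ∀ α, (α.degree + 1 ≠ n) →
      MvPolynomial.coeff α p ≠ 0 → Q α) := by
    intro p c n hc h α hα hp
    rw [Hf, Ideal.Quotient.eq] at h
    rw [hPQ]
    apply h
    rw [coeff_sub, coeff_X_mul_add, IsHomogeneous.coeff_eq_zero hc, sub_zero]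
    · exact hp
    · rw [map_add, Finsupp.degree_single]; exact hα
  refine ⟨f, g, isGr_qgr _, ?_, ?_, ?_, ?_, ?_, ?_, ?_⟩
  · rw [← LinearMap.ker_eq_bot, LinearMap.ker_eq_bot']
    intro m hm
    obtain ⟨p, rfl⟩ := Ideal.Quotient.mk_surjective m
    rw [Ideal.Quotient.eq_zero_iff_mem]
    rw [Hf, Ideal.Quotient.eq_zero_iff_mem] at hm
    intro α hα
    rw [hPQ]
    exact hm _ (by rwa [coeff_X_mul_add])
  · intro m
    obtain ⟨p, rfl⟩ := Ideal.Quotient.mk_surjective m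
    exact ⟨Ideal.Quotient.mk _ p, rfl⟩
  · intro m
    obtain ⟨p, rfl⟩ := Ideal.Quotient.mk_surjective m
    rw [Hf, Hg, Ideal.Quotient.eq_zero_iff_mem]
    intro α h
    rw [coeff_X_mul'] at h
    split_ifs at h with hx
    · exact (hPT _).2 (Or.inr (Finsupp.mem_support_iff.1 hx))
    · exact absurd rfl h
  · intro m hm
    obtain ⟨p, rfl⟩ := Ideal.Quotient.mk_surjective m
    rw [Hg, Ideal.Quotient.eq_zero_iff_mem] at hm
    refine ⟨Ideal.Quotient.mk _ (MvPolynomial.divMonomial p (Finsupp.single x 1)), ?_⟩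
    rw [Hf, Ideal.Quotient.eq]
    intro α hα
    rw [coeff_sub, coeff_X_mul'] at hα
    split_ifs at hα with hx
    · rw [coeff_divMonomial, add_tsub_cancel_of_le, sub_self] at hα
      · exact absurd rfl hα
      · rw [Finsupp.single_le_iff]
        exact Nat.one_le_iff_ne_zero.2 (Finsupp.mem_support_iff.1 hx)
    · rw [zero_sub, neg_ne_zero] at hα
      rcases (hPT _).1 (hm α hα) with h | h
      · exact h
      · exact absurd (Finsupp.mem_support_iff.2 h) hx
  · intro n m
    obtain ⟨p, rfl⟩ := Ideal.Quotient.mk_surjective m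
    constructor
    · intro h
      cases n with
      | zero =>
        have h : Ideal.Quotient.mk (MI K Q hQ) p = 0 := h
        rw [h, map_zero]; exact AddSubgroup.zero_mem _
      | succ n =>
        obtain ⟨q, hq, h⟩ := h
        have h : Ideal.Quotient.mk (MI K Q hQ) q = Ideal.Quotient.mk _ p := h
        rw [← h, Hf]
        refine ⟨_, ?_, rfl⟩
        rw [add_comm]
        exact IsHomogeneous.mul (isHomogeneous_X K x) hq
    · rintro ⟨c, hc, h⟩
      have h : Ideal.Quotient.mk _ c = f (Ideal.Quotient.mk _ p) := h
      have := key p c n hc h.symm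
      cases n with
      | zero =>
        show Ideal.Quotient.mk (MI K Q hQ) p = 0
        rw [Ideal.Quotient.eq_zero_iff_mem]
        intro α hα
        exact this α (by omega) hα
      | succ n =>
        refine ⟨homogeneousComponent n p, homogeneousComponent_mem _ _, ?_⟩
        show Ideal.Quotient.mk _ _ = Ideal.Quotient.mk _ _
        rw [eq_comm, Ideal.Quotient.eq]
        intro α hα
        rw [coeff_sub, coeff_homogeneousComponent] at hα
        split_ifs at hα with hd
        · simp at hα
        · exact this α (by omega) (by simpa using hα)
  · rintro n b ⟨p, hp, rfl⟩
    exact ⟨p, hp, rfl⟩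
  · rintro n b ⟨p, hp, rfl⟩
    exact ⟨_, ⟨p, hp, rfl⟩, rfl⟩

end seq

theorem RB_sgr {L r : ℕ} {M : Type u} [AddCommGroup M] [Module (MvPolynomial σ K) M]
    {gr : ℕ → AddSubgroup M} (h : RB K σ L r M gr) : RB K σ L (r + 1) M (sgr gr) :=
  RB_shift L r M gr _ (fun _ _ => Iff.rfl) (fun _ => Iff.rfl) h

theorem RB_base (W : Set σ) (hW : W.Finite) (hP : ∀ α β : σ →₀ ℕ, (∃ w ∈ W, α w ≠ 0) → ∃ w ∈ W, (α + β) w ≠ 0) :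
    ∃ L, RB K σ L 0 _ (qgr (MI K (fun α => ∃ w ∈ W, α w ≠ 0) hP)) := by
  induction W, hW using Set.Finite.induction_on with
  | empty =>
    refine ⟨1, Unit, inferInstance, fun _ => 0, ?_⟩
    have hI : MI K (fun α : σ →₀ ℕ => ∃ w ∈ (∅ : Set σ), α w ≠ 0) hP = ⊥ := by
      ext p
      rw [mem_MI, Ideal.mem_bot]
      constructor
      · intro h; ext α
        by_contra hc
        obtain ⟨w, hw, _⟩ := h α hc
        exact hw
      · rintro rfl; simp
    generalize MI K (fun α : σ →₀ ℕ => ∃ w ∈ (∅ : Set σ), α w ≠ 0) hP = I at *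
    subst hI
    let E : (Unit →₀ MvPolynomial σ K) ≃ₗ[MvPolynomial σ K] MvPolynomial σ K :=
      Finsupp.uniqueLinearEquiv _ _ ()
    have hE : ∀ n u, u ∈ Fgr K σ (fun _ : Unit => 0) n ↔ E u ∈ homogeneousSubmodule σ K n := by
      intro n u
      rw [mem_Fgr]
      constructor
      · intro h; exact (h ()).1
      · intro h a; exact ⟨h, fun h => absurd h (Nat.not_lt_zero _)⟩
    refine ⟨Submodule.mkQ ⊥ ∘ₗ E.toLinearMap, fun _ => le_rfl, ?_, ?_, ?_, ?_⟩
    · intro n u hu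
      exact ⟨E u, (hE n u).1 hu, rfl⟩
    · exact (Submodule.mkQ_surjective _).comp E.surjective
    · rintro n m ⟨p, hp, rfl⟩
      refine ⟨E.symm p, (hE _ _).2 (by simpa using hp), ?_⟩
      show Submodule.mkQ ⊥ (E (E.symm p)) = _
      rw [LinearEquiv.apply_symm_apply]; rfl
    · show Subsingleton _
      rw [Submodule.subsingleton_iff_eq_bot, LinearMap.ker_eq_bot']
      intro m hm
      have : E m ∈ (⊥ : Ideal (MvPolynomial σ K)) := (Submodule.Quotient.mk_eq_zero _).1 hm
      simpa using this
  | @insert a W ha _ ih =>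
    have hP' : ∀ α β : σ →₀ ℕ, (∃ w ∈ W, α w ≠ 0) → ∃ w ∈ W, (α + β) w ≠ 0 := by
      rintro α β ⟨w, hw, h⟩; exact ⟨w, hw, by rw [Finsupp.add_apply]; omega⟩
    obtain ⟨L, hL⟩ := ih hP'
    obtain ⟨f, g, hfg⟩ := monomial_seq (K := K) _ _ _ hP' hP' hP a (by
      intro α
      constructor
      · exact hP' _ _
      · rintro ⟨w, hw, h⟩
        refine ⟨w, hw, ?_⟩
        rwa [Finsupp.add_apply, Finsupp.single_eq_of_ne (by rintro rfl; exact ha hw), add_zero] at h) (by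
      intro α
      constructor
      · rintro ⟨w, rfl | hw, h⟩
        · exact Or.inr h
        · exact Or.inl ⟨w, hw, h⟩
      · rintro (⟨w, hw, h⟩ | h)
        · exact ⟨w, Or.inr hw, h⟩
        · exact ⟨a, Or.inl rfl, h⟩)
    exact ⟨L + 1, RB_cone hfg (RB_sgr hL) (RB_mono_L _ _ _ _ hL)⟩

end PartTwo

/-- the recursive regularity certificate -/
inductive RR {V : Type*} (G : SimpleGraph V) : Set V → ℕ → Prop
  | base (U : Set V) (b : ℕ) (h : ∀ x ∈ U, ∀ y ∈ U, ¬ G.Adj x y) : RR G U b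
  | step (U : Set V) (b : ℕ) (x : V) (hx : x ∈ U) (h1 : RR G (U \ {x}) (b + 1))
      (h2 : RR G {y ∈ U | ¬ G.Adj x y} b) : RR G U (b + 1)

section PartTwoB
universe u
variable {K : Type u} [Field K] {σ : Type}

/-- the monomials of the ideal of a graph restricted to a vertex set -/
def PU (G : SimpleGraph σ) (U : Set σ) (α : σ →₀ ℕ) : Prop :=
  (∃ w, w ∉ U ∧ α w ≠ 0) ∨ (∃ i j, G.Adj i j ∧ α i ≠ 0 ∧ α j ≠ 0)

theorem PU_up (G : SimpleGraph σ) (U : Set σ) (α β : σ →₀ ℕ) (h : PU G U α) :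
    PU G U (α + β) := by
  rcases h with ⟨w, hw, h⟩ | ⟨i, j, hij, hi, hj⟩
  · exact Or.inl ⟨w, hw, by rw [Finsupp.add_apply]; omega⟩
  · exact Or.inr ⟨i, j, hij, by rw [Finsupp.add_apply]; omega, by rw [Finsupp.add_apply]; omega⟩

theorem edgeIdeal_eq (G : SimpleGraph σ) :
    edgeIdeal K G = MI K (PU G Set.univ) (PU_up G Set.univ) := by
  classical
  ext p
  have : edgeIdeal K G = Ideal.span ((fun s => MvPolynomial.monomial s (1 : K)) ''
      {α | ∃ i j, G.Adj i j ∧ α = Finsupp.single i 1 + Finsupp.single j 1}) := by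
    rw [edgeIdeal]
    congr 1
    ext q
    constructor
    · rintro ⟨i, j, h, rfl⟩
      exact ⟨_, ⟨i, j, h, rfl⟩, by simp [MvPolynomial.X, monomial_mul]⟩
    · rintro ⟨_, ⟨i, j, h, rfl⟩, rfl⟩
      exact ⟨i, j, h, by simp [MvPolynomial.X, monomial_mul]⟩
  rw [this, mem_ideal_span_monomial_image, mem_MI]
  refine forall_congr' fun α => ?_
  rw [mem_support_iff]
  refine imp_congr_right fun _ => ?_
  constructor
  · rintro ⟨_, ⟨i, j, h, rfl⟩, hle⟩
    refine Or.inr ⟨i, j, h, ?_, ?_⟩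
    · have := hle i
      simp only [Finsupp.add_apply, Finsupp.single_eq_same] at this
      omega
    · have := hle j
      simp only [Finsupp.add_apply, Finsupp.single_eq_same] at this
      omega
  · rintro (⟨w, hw, _⟩ | ⟨i, j, h, hi, hj⟩)
    · exact absurd (Set.mem_univ w) hw
    · refine ⟨_, ⟨i, j, h, rfl⟩, ?_⟩
      intro v
      simp only [Finsupp.add_apply, Finsupp.single_apply]
      have hne : i ≠ j := h.ne
      split_ifs with h1 h2 h2
      · exact absurd (h1.trans h2.symm) hne
      · subst h1; omega
      · subst h2; omega
      · omega

theorem RB_of_RR [Finite σ] {G : SimpleGraph σ} {U : Set σ} {b : ℕ} (h : RR G U b) :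
    ∃ L, RB K σ L b _ (qgr (MI K (PU G U) (PU_up G U))) := by
  induction h with
  | base U b h =>
    have hP : ∀ α β : σ →₀ ℕ, (∃ w ∈ Uᶜ, α w ≠ 0) → ∃ w ∈ Uᶜ, (α + β) w ≠ 0 := by
      rintro α β ⟨w, hw, h⟩; exact ⟨w, hw, by rw [Finsupp.add_apply]; omega⟩
    obtain ⟨L, hL⟩ := RB_base (K := K) Uᶜ (Set.toFinite _) hP
    refine ⟨L, RB_mono_r _ _ _ (Nat.zero_le _) _ _ ?_⟩
    have : (fun α : σ →₀ ℕ => ∃ w ∈ Uᶜ, α w ≠ 0) = PU G U := by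
      funext α
      apply propext
      constructor
      · rintro ⟨w, hw, h⟩; exact Or.inl ⟨w, hw, h⟩
      · rintro (h' | ⟨i, j, hij, hi, hj⟩)
        · exact h'
        · by_cases hiU : i ∈ U
          · exact ⟨j, fun hjU => h i hiU j hjU hij, hj⟩
          · exact ⟨i, hiU, hi⟩
    have e : MI K (fun α : σ →₀ ℕ => ∃ w ∈ Uᶜ, α w ≠ 0) hP = MI K (PU G U) (PU_up G U) := by
      ext p
      rw [mem_MI, mem_MI, ← this]
    exact e ▸ hL
  | step U b x hx h1 h2 ih1 ih2 =>
    obtain ⟨L1, hL1⟩ := ih1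
    obtain ⟨L2, hL2⟩ := ih2
    obtain ⟨f, g, hfg⟩ := monomial_seq (K := K) (PU G U) (PU G {y ∈ U | ¬ G.Adj x y})
      (PU G (U \ {x})) (PU_up G _) (PU_up G _) (PU_up G _) x (by
        intro α
        constructor
        · rintro (⟨w, hw, h⟩ | ⟨i, j, hij, hi, hj⟩)
          · by_cases hwU : w ∈ U
            · have hxw : G.Adj x w := by
                by_contra hc; exact hw ⟨hwU, hc⟩
              refine Or.inr ⟨x, w, hxw, ?_, ?_⟩
              · simp
              · rw [Finsupp.add_apply]; omega
            · exact Or.inl ⟨w, hwU, by rw [Finsupp.add_apply]; omega⟩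
          · exact Or.inr ⟨i, j, hij, by rw [Finsupp.add_apply]; omega,
              by rw [Finsupp.add_apply]; omega⟩
        · have aux : ∀ w, w ≠ x → (α + Finsupp.single x 1 : σ →₀ ℕ) w = α w := by
            intro w hw; rw [Finsupp.add_apply, Finsupp.single_eq_of_ne hw, add_zero]
          rintro (⟨w, hw, h⟩ | ⟨i, j, hij, hi, hj⟩)
          · have hwx : w ≠ x := by rintro rfl; exact hw hx
            exact Or.inl ⟨w, fun h => hw h.1, by rwa [aux w hwx] at h⟩
          · by_cases hix : i = x
            · subst hix
              rw [aux j hij.ne'] at hj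
              exact Or.inl ⟨j, fun h => h.2 hij, hj⟩
            · rw [aux i hix] at hi
              by_cases hjx : j = x
              · subst hjx
                exact Or.inl ⟨i, fun h => h.2 hij.symm, hi⟩
              · rw [aux j hjx] at hj
                exact Or.inr ⟨i, j, hij, hi, hj⟩) (by
        intro α
        constructor
        · rintro (⟨w, hw, h⟩ | h)
          · by_cases hwx : w = x
            · subst hwx; exact Or.inr h
            · exact Or.inl (Or.inl ⟨w, fun h => hw ⟨h, hwx⟩, h⟩)
          · exact Or.inl (Or.inr h)
        · rintro ((⟨w, hw, h⟩ | h) | h)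
          · exact Or.inl ⟨w, fun h => hw h.1, h⟩
          · exact Or.inr h
          · exact Or.inl ⟨x, fun h => h.2 rfl, h⟩)
    exact ⟨max L1 L2, RB_horseshoe _ _ _ _ _ _ _ _ f g hfg
      (RB_sgr (RB_mono_L' (le_max_right _ _) hL2)) (RB_mono_L' (le_max_left _ _) hL1)⟩

theorem regBound_of_RR [Finite σ] {G : SimpleGraph σ} {b : ℕ} (h : RR G Set.univ b) :
    regBound K (edgeIdeal K G) b := by
  rw [edgeIdeal_eq]
  obtain ⟨L, hL⟩ := RB_of_RR (K := K) h
  exact regBound_of_RB hL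

end PartTwoB


section PartThree
universe u
variable {K : Type u} [Field K] {σ : Type}

theorem homComp_mul (p q : MvPolynomial σ K) (e N : ℕ) (hq : q ∈ homogeneousSubmodule σ K e) :
    homogeneousComponent N (p * q) =
      if e ≤ N then homogeneousComponent (N - e) p * q else 0 := by
  classical
  have hmul : ∀ i, homogeneousComponent N (homogeneousComponent i p * q) =
      if N = i + e then homogeneousComponent i p * q else 0 := fun i =>
    homogeneousComponent_of_mem (IsHomogeneous.mul (homogeneousComponent_isHomogeneous i p) hq)
  conv_lhs => rw [← sum_homogeneousComponent p, Finset.sum_mul, map_sum]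
  simp_rw [hmul]
  split_ifs with h
  · rw [Finset.sum_eq_single (N - e)]
    · rw [if_pos (by omega)]
    · intro b _ hb; rw [if_neg (by omega)]
    · intro hb
      rw [Finset.mem_range, not_lt] at hb
      rw [homogeneousComponent_eq_zero _ _ (by omega)]; simp
  · exact Finset.sum_eq_zero fun i _ => by rw [if_neg (by omega)]

/-- existence of graded projections -/
def HasProj {M : Type u} [AddCommGroup M] [Module (MvPolynomial σ K) M]
    (gr : ℕ → AddSubgroup M) : Prop :=
  ∃ π : ℕ → M →+ M, (∀ n, ∀ m ∈ gr n, π n m = m) ∧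
    ∀ j, ∀ m ∈ gr j, ∀ (n : ℕ) (p : MvPolynomial σ K), π n (p • m) =
      if j ≤ n then homogeneousComponent (n - j) p • m else 0

/-- graded projection on a free module -/
noncomputable def Fproj {ι : Type} (d : ι → ℕ) (n : ℕ) :
    (ι →₀ MvPolynomial σ K) →+ (ι →₀ MvPolynomial σ K) where
  toFun u := Finsupp.onFinset u.support
    (fun a => if d a ≤ n then homogeneousComponent (n - d a) (u a) else 0) (by
      intro a h
      rw [Finsupp.mem_support_iff]
      intro h0
      rw [h0] at h
      simp at h)
  map_zero' := by ext1 a; simp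
  map_add' u w := by
    ext1 a
    simp only [Finsupp.onFinset_apply, Finsupp.add_apply, map_add]
    split_ifs <;> simp

theorem Fproj_apply {ι : Type} (d : ι → ℕ) (n : ℕ) (u : ι →₀ MvPolynomial σ K) (a : ι) :
    Fproj d n u a = if d a ≤ n then homogeneousComponent (n - d a) (u a) else 0 := rfl

theorem Fproj_mem {ι : Type} (d : ι → ℕ) (n : ℕ) (u : ι →₀ MvPolynomial σ K) :
    Fproj d n u ∈ Fgr K σ d n := by
  intro a
  rw [Fproj_apply]
  split_ifs with h
  · exact ⟨homogeneousComponent_mem _ _, fun h' => by omega⟩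
  · exact ⟨Submodule.zero_mem _, fun _ => rfl⟩

theorem Fproj_self {ι : Type} (d : ι → ℕ) (n : ℕ) (u : ι →₀ MvPolynomial σ K)
    (hu : u ∈ Fgr K σ d n) : Fproj d n u = u := by
  ext1 a
  rw [Fproj_apply]
  split_ifs with h
  · exact homogeneousComponent_eq_self (hu a).1
  · exact ((hu a).2 (by omega)).symm

theorem Fproj_smul {ι : Type} (d : ι → ℕ) (j : ℕ) (u : ι →₀ MvPolynomial σ K)
    (hu : u ∈ Fgr K σ d j) (n : ℕ) (p : MvPolynomial σ K) :
    Fproj d n (p • u) = if j ≤ n then homogeneousComponent (n - j) p • u else 0 := by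
  ext1 a
  have : (if j ≤ n then homogeneousComponent (n - j) p • u else 0) a =
      if j ≤ n then homogeneousComponent (n - j) p * u a else 0 := by
    split_ifs <;> simp
  rw [this, Fproj_apply, Finsupp.smul_apply, smul_eq_mul]
  by_cases hj : j < d a
  · rw [(hu a).2 hj]; simp
  · rw [homComp_mul p (u a) (j - d a) (n - d a) (hu a).1]
    split_ifs with h1 h2 h3 h3
    · congr 3; omega
    · omega
    · omega
    · rfl
    · omega
    · rfl

theorem proj_map {ι : Type} {M : Type u} [AddCommGroup M] [Module (MvPolynomial σ K) M]
    {gr : ℕ → AddSubgroup M} {π : ℕ → M →+ M}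
    (hπ : ∀ j, ∀ m ∈ gr j, ∀ (n : ℕ) (p : MvPolynomial σ K), π n (p • m) =
      if j ≤ n then homogeneousComponent (n - j) p • m else 0)
    (d : ι → ℕ) (ψ : (ι →₀ MvPolynomial σ K) →ₗ[MvPolynomial σ K] M)
    (hψ : ∀ a, ψ (Finsupp.single a 1) ∈ gr (d a)) (n : ℕ) (u : ι →₀ MvPolynomial σ K) :
    π n (ψ u) = ψ (Fproj d n u) := by
  induction u using Finsupp.induction_linear with
  | zero => simp
  | add f g hf hg => rw [map_add, map_add, map_add, map_add, hf, hg]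
  | single a p =>
    have hs : ∀ p : MvPolynomial σ K, (Finsupp.single a p : ι →₀ MvPolynomial σ K) =
      p • Finsupp.single a 1 := fun p => by simp
    rw [hs, Fproj_smul d (d a) _ (single_mem_Fgr d a), map_smul, hπ _ _ (hψ a)]
    split_ifs
    · rw [map_smul]
    · rw [map_zero]

theorem hasProj_ker {ι : Type} {M : Type u} [AddCommGroup M] [Module (MvPolynomial σ K) M]
    {gr : ℕ → AddSubgroup M} (h : HasProj (K := K) (σ := σ) gr)
    (d : ι → ℕ) (ψ : (ι →₀ MvPolynomial σ K) →ₗ[MvPolynomial σ K] M)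
    (hψ : ∀ a, ψ (Finsupp.single a 1) ∈ gr (d a)) :
    HasProj (K := K) (σ := σ) (Kgr d (LinearMap.ker ψ)) := by
  obtain ⟨π, _, h2⟩ := h
  have hk : ∀ n (u : LinearMap.ker ψ), Fproj d n u.1 ∈ LinearMap.ker ψ := by
    rintro n ⟨u, hu⟩
    rw [LinearMap.mem_ker] at hu ⊢
    rw [← proj_map h2 d ψ hψ, hu, map_zero]
  refine ⟨fun n => ((Fproj d n).comp (LinearMap.ker ψ).subtype.toAddMonoidHom).codRestrict
    (LinearMap.ker ψ).toAddSubgroup (hk n), ?_, ?_⟩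
  · intro n m hm
    exact Subtype.ext (Fproj_self d n _ hm)
  · intro j m hm n p
    apply Subtype.ext
    refine (Fproj_smul d j m.1 hm n p).trans ?_
    split_ifs <;> rfl

theorem RB_of_seq (L : ℕ) : ∀ (r : ℕ) (M : Type u) [AddCommGroup M]
    [Module (MvPolynomial σ K) M] (gr : ℕ → AddSubgroup M) (_ : IsGr (K := K) (σ := σ) gr)
    (_ : HasProj (K := K) (σ := σ) gr)
    (k : ℕ → ℕ) (d : (i : ℕ) → Fin (k i) → ℕ)
    (φ : (i : ℕ) → ((Fin (k (i + 1)) →₀ MvPolynomial σ K) →ₗ[MvPolynomial σ K]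
      (Fin (k i) →₀ MvPolynomial σ K)))
    (ε : (Fin (k 0) →₀ MvPolynomial σ K) →ₗ[MvPolynomial σ K] M)
    (_ : ∀ i, L ≤ i → k i = 0)
    (_ : ∀ (i : ℕ) (b : Fin (k (i + 1))) (a : Fin (k i)),
      (φ i (Finsupp.single b 1)) a ∈ homogeneousSubmodule σ K (d (i + 1) b - d i a) ∧
      (d (i + 1) b < d i a → (φ i (Finsupp.single b 1)) a = 0))
    (_ : ∀ a : Fin (k 0), ε (Finsupp.single a 1) ∈ gr (d 0 a))
    (_ : Function.Surjective ε)
    (_ : LinearMap.range (φ 0) = LinearMap.ker ε)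
    (_ : ∀ i : ℕ, LinearMap.range (φ (i + 1)) = LinearMap.ker (φ i))
    (_ : ∀ (i : ℕ) (a : Fin (k i)), d i a ≤ i + r), RB K σ L r M gr := by
  induction L with
  | zero =>
    intro r M _ _ gr _ _ k d φ ε h1 _ _ h4 _ _ _
    have h0 := h1 0 le_rfl
    refine ⟨fun x y => ?_⟩
    obtain ⟨u, rfl⟩ := h4 x
    obtain ⟨w, rfl⟩ := h4 y
    have : IsEmpty (Fin (k 0)) := by rw [h0]; infer_instance
    rw [Subsingleton.elim u w]
  | succ L ih =>
    intro r M _ _ gr hgr hp k d φ ε h1 h2 h3 h4 h5 h6 h7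
    refine ⟨Fin (k 0), inferInstance, d 0, ε, fun a => by simpa using h7 0 a, ?_, h4, ?_, ?_⟩
    · intro n u hu
      have : ε = Finsupp.linearCombination (MvPolynomial σ K)
          (fun a => ε (Finsupp.single a 1)) := by
        apply Finsupp.lhom_ext'
        intro a
        apply LinearMap.ext_ring
        simp
      rw [this]
      exact linComb_mem hgr (d 0) _ h3 n u hu
    · obtain ⟨π, g1, g2⟩ := hp
      intro n m hm
      obtain ⟨u, rfl⟩ := h4 m
      exact ⟨_, Fproj_mem (d 0) n u, by rw [← proj_map g2 (d 0) ε h3, g1 n _ hm]⟩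
    · have hc : ∀ u, φ 0 u ∈ LinearMap.ker ε := fun u => h5 ▸ LinearMap.mem_range_self _ u
      refine ih (r + 1) _ _ (isGr_Kgr _ _) (hasProj_ker hp (d 0) ε h3) (fun i => k (i + 1))
        (fun i => d (i + 1)) (fun i => φ (i + 1)) (LinearMap.codRestrict _ (φ 0) hc)
        (fun i hi => h1 (i + 1) (by omega)) (fun i => h2 (i + 1)) (fun a => h2 0 a) ?_ ?_
        (fun i => h6 (i + 1)) (fun i a => by have := h7 (i + 1) a; omega)
      · rintro ⟨w, hw⟩
        rw [← h5] at hw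
        obtain ⟨u, rfl⟩ := hw
        exact ⟨u, rfl⟩
      · rw [h6 0, LinearMap.ker_codRestrict]

theorem hasProj_qgr (P : (σ →₀ ℕ) → Prop) (hP : ∀ α β, P α → P (α + β)) :
    HasProj (K := K) (σ := σ) (qgr (MI K P hP)) := by
  have hI : ∀ n p, p ∈ MI K P hP → homogeneousComponent n p ∈ MI K P hP := by
    intro n p hp α hα
    classical
    rw [coeff_homogeneousComponent] at hα
    split_ifs at hα with h
    · exact hp α hα
    · exact absurd rfl hα
  refine ⟨fun n => QuotientAddGroup.map (MI K P hP).toAddSubgroup (MI K P hP).toAddSubgroup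
    (homogeneousComponent n).toAddMonoidHom (hI n), ?_, ?_⟩
  · rintro n m ⟨p, hp, rfl⟩
    show Ideal.Quotient.mk _ (homogeneousComponent n p) = Ideal.Quotient.mk _ p
    rw [homogeneousComponent_eq_self hp]
  · rintro j m ⟨q, hq, rfl⟩ n p
    show Ideal.Quotient.mk _ (homogeneousComponent n (p * q)) = _
    rw [homComp_mul p q j n hq]
    split_ifs
    · rfl
    · exact map_zero _

theorem RB_of_regBound (P : (σ →₀ ℕ) → Prop) (hP : ∀ α β, P α → P (α + β)) {r : ℕ}
    (h : regBound K (MI K P hP) r) : ∃ L, RB K σ L r _ (qgr (MI K P hP)) := by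
  obtain ⟨L, k, d, φ, ε, h1, h2, h3, h4, h5, h6, h7⟩ := h
  exact ⟨L, RB_of_seq L r _ _ (isGr_qgr _) (hasProj_qgr P hP) k d φ ε h1 h2 h3 h4 h5 h6 h7⟩

end PartThree


section Koszul
universe u
variable {K : Type u} [Field K] {m : ℕ}

/-- Koszul differential on cochains -/
noncomputable def kd {M : Type u} [AddCommGroup M] [Module (MvPolynomial (Fin m) K) M]
    (f : Finset (Fin m) → M) (A : Finset (Fin m)) : M :=
  ∑ v ∈ A, ((-1 : MvPolynomial (Fin m) K) ^ (A.filter (· < v)).card * MvPolynomial.X v) •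
    f (A.erase v)

variable {M : Type u} [AddCommGroup M] [Module (MvPolynomial (Fin m) K) M]

theorem kd_congr {f g : Finset (Fin m) → M} {A : Finset (Fin m)}
    (h : ∀ v ∈ A, f (A.erase v) = g (A.erase v)) : kd (K := K) f A = kd (K := K) g A :=
  Finset.sum_congr rfl fun v hv => by rw [h v hv]

theorem kd_add (f g : Finset (Fin m) → M) (A : Finset (Fin m)) :
    kd (K := K) (fun B => f B + g B) A = kd (K := K) f A + kd (K := K) g A := by
  simp [kd, Finset.sum_add_distrib]

theorem kd_sub (f g : Finset (Fin m) → M) (A : Finset (Fin m)) :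
    kd (K := K) (fun B => f B - g B) A = kd (K := K) f A - kd (K := K) g A := by
  simp [kd, smul_sub, Finset.sum_sub_distrib]

theorem kd_smul (p : MvPolynomial (Fin m) K) (f : Finset (Fin m) → M) (A : Finset (Fin m)) :
    kd (K := K) (fun B => p • f B) A = p • kd (K := K) f A := by
  simp only [kd, Finset.smul_sum]
  refine Finset.sum_congr rfl fun v _ => ?_
  rw [smul_comm]

theorem kd_map {N : Type u} [AddCommGroup N] [Module (MvPolynomial (Fin m) K) N]
    (ψ : M →ₗ[MvPolynomial (Fin m) K] N) (f : Finset (Fin m) → M) (A : Finset (Fin m)) :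
    ψ (kd (K := K) f A) = kd (K := K) (fun B => ψ (f B)) A := by
  simp [kd, map_sum]

theorem kd_insert (f : Finset (Fin m) → M) (B : Finset (Fin m)) (v : Fin m)
    (hv : ∀ w ∈ B, w < v) :
    kd (K := K) f (insert v B) = kd (K := K) (fun A => f (insert v A)) B +
      ((-1 : MvPolynomial (Fin m) K) ^ B.card * MvPolynomial.X v) • f B := by
  have hvB : v ∉ B := fun h => lt_irrefl _ (hv v h)
  rw [kd, Finset.sum_insert hvB, add_comm, kd]
  congr 1
  · refine Finset.sum_congr rfl fun w hw => ?_
    have hwv : w ≠ v := (hv w hw).ne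
    rw [Finset.erase_insert_of_ne hwv.symm, Finset.filter_insert,
      if_neg (not_lt.2 (hv w hw).le)]
  · rw [Finset.erase_insert hvB, Finset.filter_insert, if_neg (lt_irrefl _),
      Finset.filter_true_of_mem hv]

theorem kd_kd (A : Finset (Fin m)) : ∀ f : Finset (Fin m) → M,
    kd (K := K) (kd (K := K) f) A = 0 := by
  induction A using Finset.induction_on_max with
  | empty => intro f; simp [kd]
  | insert v B hv ih =>
    intro f
    rw [kd_insert _ B v hv]
    have h1 : kd (K := K) (fun A => kd (K := K) f (insert v A)) B =
        kd (K := K) (fun A => kd (K := K) (fun A' => f (insert v A')) A +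
          ((-1 : MvPolynomial (Fin m) K) ^ (B.card - 1) * MvPolynomial.X v) • f A) B := by
      refine kd_congr fun w hw => ?_
      rw [kd_insert _ _ v (fun x hx => hv x (Finset.mem_of_mem_erase hx)),
        Finset.card_erase_of_mem hw]
    rw [h1, kd_add, ih, zero_add, kd_smul, ← add_smul]
    rcases B.eq_empty_or_nonempty with rfl | hB
    · simp [kd]
    · obtain ⟨n, hn⟩ := Nat.exists_eq_succ_of_ne_zero (Finset.card_pos.2 hB).ne'
      rw [hn, Nat.succ_sub_one, pow_succ]
      simp

/-- the ideal of a set of variables -/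
noncomputable def vI (K : Type u) [Field K] (B : Finset (Fin m)) : Ideal (MvPolynomial (Fin m) K) :=
  Ideal.span (MvPolynomial.X '' (B : Set (Fin m)))

theorem kd_mem_vI (f : Finset (Fin m) → MvPolynomial (Fin m) K) (B : Finset (Fin m)) :
    kd (K := K) f B ∈ vI K B := by
  refine Ideal.sum_mem _ fun v hv => ?_
  rw [smul_eq_mul]
  refine Ideal.mul_mem_right _ _ (Ideal.mul_mem_left _ _ (Ideal.subset_span ⟨v, hv, rfl⟩))

theorem vI_regular (B : Finset (Fin m)) (v : Fin m) (hv : v ∉ B)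
    (p : MvPolynomial (Fin m) K) (h : MvPolynomial.X v * p ∈ vI K B) : p ∈ vI K B := by
  rw [vI, mem_ideal_span_X_image] at h ⊢
  intro α hα
  obtain ⟨i, hi, hne⟩ := h (α + Finsupp.single v 1) (by
    rw [mem_support_iff, coeff_X_mul_add]; exact mem_support_iff.1 hα)
  refine ⟨i, hi, ?_⟩
  rwa [Finsupp.add_apply, Finsupp.single_eq_of_ne, add_zero] at hne
  rintro rfl; exact hv hi

theorem koszul_acyclic (B : Finset (Fin m)) : ∀ (q : ℕ)
    (f : Finset (Fin m) → MvPolynomial (Fin m) K)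
    (_ : ∀ A ⊆ B, A.card = q + 1 → kd (K := K) f A = 0)
    (_ : q < B.card ∨ (q = B.card ∧ f B ∈ vI K B)),
    ∃ g : Finset (Fin m) → MvPolynomial (Fin m) K, ∀ A ⊆ B, A.card = q →
      f A = kd (K := K) g A := by
  induction B using Finset.induction_on_max with
  | empty =>
    rintro q f _ (h | ⟨rfl, h⟩)
    · simp at h
    · refine ⟨0, fun A hA _ => ?_⟩
      rw [Finset.subset_empty] at hA
      subst hA
      simpa [vI, kd] using h
  | insert v B hv ih =>
    intro q f hf hq
    have hvB : v ∉ B := fun h => lt_irrefl _ (hv v h)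
    -- it suffices to find the two halves
    suffices H : ∃ g0 g1 : Finset (Fin m) → MvPolynomial (Fin m) K,
        (∀ A ⊆ B, A.card = q → f A = kd (K := K) g0 A) ∧
        (∀ A ⊆ B, A.card + 1 = q → f (insert v A) = kd (K := K) g1 A +
          ((-1 : MvPolynomial (Fin m) K) ^ A.card * MvPolynomial.X v) • g0 A) by
      obtain ⟨g0, g1, H0, H1⟩ := H
      refine ⟨fun A => if v ∈ A then g1 (A.erase v) else g0 A, fun A hA hc => ?_⟩
      by_cases hvA : v ∈ A
      · have hAB : A.erase v ⊆ B := by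
          intro x hx
          rcases Finset.mem_insert.1 (hA (Finset.mem_of_mem_erase hx)) with h | h
          · exact absurd h (Finset.ne_of_mem_erase hx)
          · exact h
        have hA' : A = insert v (A.erase v) := (Finset.insert_erase hvA).symm
        have hnot : v ∉ A.erase v := Finset.notMem_erase v A
        have hcard : (A.erase v).card + 1 = q := by
          rw [← hc, Finset.card_erase_add_one hvA]
        generalize A.erase v = A' at *
        subst hA'
        rw [kd_insert _ _ v (fun w hw => hv w (hAB hw)), H1 A' hAB hcard, if_neg hnot]
        congr 1
        refine kd_congr fun w hw => ?_
        rw [if_pos (Finset.mem_insert_self _ _), Finset.erase_insert]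
        exact fun h => hnot (Finset.mem_of_mem_erase h)
      · have hAB : A ⊆ B := fun x hx => by
          rcases Finset.mem_insert.1 (hA hx) with h | h
          · subst h; exact absurd hx hvA
          · exact h
        rw [H0 A hAB hc]
        refine kd_congr fun w hw => ?_
        rw [if_neg (fun h => hvA (Finset.mem_of_mem_erase h))]
    have hcardB : (insert v B).card = B.card + 1 := Finset.card_insert_of_notMem hvB
    rw [hcardB] at hq
    rcases hq with hq | ⟨hq, hfm⟩
    · -- q ≤ |B|
      obtain ⟨g0, hg0⟩ := ih q f
        (fun A hA hc => hf A (hA.trans (Finset.subset_insert _ _)) hc) (by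
          rcases Nat.lt_or_ge q B.card with h | h
          · exact Or.inl h
          · have hqB : q = B.card := by omega
            refine Or.inr ⟨hqB, ?_⟩
            have := hf (insert v B) subset_rfl (by omega)
            rw [kd_insert _ _ v hv] at this
            have h2 := neg_eq_of_add_eq_zero_right this
            apply vI_regular B v hvB
            have h3 : MvPolynomial.X v * f B = (-1) ^ B.card *
                (((-1 : MvPolynomial (Fin m) K) ^ B.card * MvPolynomial.X v) • f B) := by
              rw [smul_eq_mul, ← mul_assoc, ← mul_assoc, ← mul_pow]; simp
            rw [h3, ← h2]
            exact Ideal.mul_mem_left _ _ (Ideal.neg_mem_iff _ |>.2 (kd_mem_vI _ B)))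
      rcases Nat.eq_zero_or_pos q with h0 | h0
      · exact ⟨g0, 0, hg0, fun A _ h => by omega⟩
      · obtain ⟨p, rfl⟩ : ∃ p, q = p + 1 := ⟨q - 1, by omega⟩
        obtain ⟨g1, hg1⟩ := ih p (fun A => f (insert v A) -
          ((-1 : MvPolynomial (Fin m) K) ^ p * MvPolynomial.X v) • g0 A) (by
            intro A hA hc
            rw [kd_sub, kd_smul, ← hg0 A hA hc]
            have := hf (insert v A) (Finset.insert_subset_insert _ hA)
              (by rw [Finset.card_insert_of_notMem (fun h => hvB (hA h)), hc])
            rw [kd_insert _ _ v (fun w hw => hv w (hA hw)), hc, pow_succ] at this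
            rw [← this]
            simp [sub_eq_add_neg]) (Or.inl (by omega))
        refine ⟨g0, g1, hg0, fun A hA hc => ?_⟩
        have hc' : A.card = p := by omega
        rw [hc', ← hg1 A hA hc', sub_add_cancel]
    · -- top degree
      have : ∃ a b, b ∈ vI K B ∧ f (insert v B) = b + MvPolynomial.X v * a := by
        rw [vI, Finset.coe_insert, Set.image_insert_eq, Ideal.mem_span_insert] at hfm
        obtain ⟨a, z, hz, h⟩ := hfm
        exact ⟨a, z, hz, by rw [h]; ring⟩
      obtain ⟨a, b, hb, hab⟩ := this
      obtain ⟨g1, hg1⟩ := ih B.card (fun _ => b) (fun A hA hc => by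
        have := Finset.card_le_card hA; omega) (Or.inr ⟨rfl, hb⟩)
      refine ⟨fun _ => (-1) ^ B.card * a, g1, fun A hA hc => ?_, fun A hA hc => ?_⟩
      · have := Finset.card_le_card hA; omega
      · have hAB : A = B := Finset.eq_of_subset_of_card_le hA (by omega)
        subst hAB
        rw [hab, ← hg1 A subset_rfl rfl, smul_eq_mul]
        congr 1
        have : ((-1 : MvPolynomial (Fin m) K) ^ A.card) * (-1) ^ A.card = 1 := by
          rw [← mul_pow]; simp
        calc MvPolynomial.X v * a = (((-1 : MvPolynomial (Fin m) K) ^ A.card) * (-1) ^ A.card) *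
              (MvPolynomial.X v * a) := by rw [this, one_mul]
          _ = _ := by ring

theorem koszul_acyclic_free {ι : Type} [Finite ι] (q : ℕ)
    (f : Finset (Fin m) → (ι →₀ MvPolynomial (Fin m) K))
    (hf : ∀ A, A.card = q + 1 → kd (K := K) f A = 0)
    (hq : q < m ∨ (q = m ∧ ∀ a, f Finset.univ a ∈ vI K Finset.univ)) :
    ∃ g : Finset (Fin m) → (ι →₀ MvPolynomial (Fin m) K), ∀ A, A.card = q →
      f A = kd (K := K) g A := by
  have hap : ∀ (g : Finset (Fin m) → (ι →₀ MvPolynomial (Fin m) K)) a A,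
      (kd (K := K) g A) a = kd (K := K) (fun A => g A a) A := by
    intro g a A
    exact kd_map (Finsupp.lapply a) g A
  have := fun a => koszul_acyclic (K := K) (Finset.univ : Finset (Fin m)) q (fun A => f A a)
    (fun A _ hc => by rw [← hap, hf A hc]; rfl) (by
      rcases hq with h | ⟨h, h'⟩
      · left; simpa using h
      · right; exact ⟨by simpa using h, h' a⟩)
  choose g hg using this
  refine ⟨fun A => Finsupp.equivFunOnFinite.symm (fun a => g a A), fun A hA => ?_⟩
  ext1 a
  rw [hap, hg a A (Finset.subset_univ _) hA]
  rfl

/-- Koszul vanishing on the strand -/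
def KV (K : Type u) [Field K] {m : ℕ} {M : Type u} [AddCommGroup M] [Module (MvPolynomial (Fin m) K) M]
    (gr : ℕ → AddSubgroup M) (q : ℕ) : Prop :=
  ∀ f : Finset (Fin m) → M, (∀ A, A.card = q → f A ∈ gr q) →
    (∀ A, A.card = q + 1 → kd (K := K) f A = 0) →
    ∃ g : Finset (Fin m) → M, ∀ A, A.card = q → f A = kd (K := K) g A

theorem kd_mem_Fgr {ι : Type} (d : ι → ℕ) (q : ℕ)
    (f : Finset (Fin m) → (ι →₀ MvPolynomial (Fin m) K))
    (hf : ∀ A, A.card = q → f A ∈ Fgr K (Fin m) d q) (A : Finset (Fin m)) (hA : A.card = q + 1) :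
    kd (K := K) f A ∈ Fgr K (Fin m) d (q + 1) := by
  refine AddSubgroup.sum_mem _ fun v hv => ?_
  rw [add_comm]
  refine smul_mem_Fgr d 1 q _ _ ?_ (hf _ (by rw [Finset.card_erase_of_mem hv]; omega))
  rw [show (-1 : MvPolynomial (Fin m) K) ^ (A.filter (· < v)).card =
    MvPolynomial.C ((-1) ^ (A.filter (· < v)).card) by simp]
  exact (isHomogeneous_X K v).C_mul _

theorem KV_of_RB (L : ℕ) : ∀ (ρ : ℕ) (M : Type u) [AddCommGroup M]
    [Module (MvPolynomial (Fin m) K) M] (gr : ℕ → AddSubgroup M)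
    (_ : RB K (Fin m) L ρ M gr) (q : ℕ) (_ : ρ < q), KV K (m := m) gr q := by
  induction L with
  | zero =>
    intro ρ M _ _ gr h q _ f _ _
    have : Subsingleton M := h
    exact ⟨0, fun A _ => Subsingleton.elim _ _⟩
  | succ L ih =>
    rintro ρ M _ _ gr ⟨ι, hι, d, ψ, h1, h2, h3, h4, h5⟩ q hq f hf hc
    choose! u hu hψ using h4
    rcases lt_trichotomy q m with hqm | hqm | hqm
    · let F : Finset (Fin m) → (ι →₀ MvPolynomial (Fin m) K) := fun A => u q (f A)
      have hF : ∀ A, A.card = q → ψ (F A) = f A := fun A hA => hψ q _ (hf A hA)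
      have hk : ∀ A, A.card = q + 1 → kd (K := K) F A ∈ LinearMap.ker ψ := by
        intro A hA
        rw [LinearMap.mem_ker, kd_map, ← hc A hA]
        refine kd_congr fun v hv => hF _ (by rw [Finset.card_erase_of_mem hv]; omega)
      classical
      let D : Finset (Fin m) → LinearMap.ker ψ := fun A =>
        if h : A.card = q + 1 then ⟨kd (K := K) F A, hk A h⟩ else 0
      have hD : ∀ A, A.card = q + 1 → (D A : ι →₀ MvPolynomial (Fin m) K) = kd (K := K) F A := by
        intro A hA; simp only [D, dif_pos hA]
      obtain ⟨g, hg⟩ := ih (ρ + 1) _ _ h5 (q + 1) (by omega) D (by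
        intro A hA
        rw [mem_Kgr, hD A hA]
        exact kd_mem_Fgr d q F (fun A hA => hu q _ (hf A hA)) A hA) (by
        intro A hA
        apply Subtype.ext
        have := kd_map (K := K) (LinearMap.ker ψ).subtype D A
        refine this.trans ?_
        rw [kd_congr (g := kd (K := K) F), kd_kd]
        · rfl
        · intro v hv; exact hD _ (by rw [Finset.card_erase_of_mem hv]; omega))
      obtain ⟨G, hG⟩ := koszul_acyclic_free (K := K) q (fun A => F A - (g A).1) (by
        intro A hA
        rw [kd_sub, ← hD A hA, hg A hA]
        have := kd_map (K := K) (LinearMap.ker ψ).subtype g A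
        rw [sub_eq_zero]
        exact this) (Or.inl hqm)
      refine ⟨fun A => ψ (G A), fun A hA => ?_⟩
      rw [← kd_map, ← hG A hA, map_sub, hF A hA, LinearMap.mem_ker.1 (g A).2, sub_zero]
    · subst hqm
      obtain ⟨G, hG⟩ := koszul_acyclic_free (K := K) q (fun A => u q (f A)) (by
        intro A hA
        have := Finset.card_le_univ A
        rw [Fintype.card_fin] at this
        omega) (Or.inr ⟨rfl, by
          intro a
          have hua := (hu q _ (hf Finset.univ (by simp)) a).1
          rw [vI, mem_ideal_span_X_image]
          intro α hα
          by_contra hcon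
          push Not at hcon
          have h0 : α = 0 := by ext i; simpa using hcon i (by simp)
          have := (mem_homogeneousSubmodule _ _).1 hua (mem_support_iff.1 hα)
          have h1a := h1 a
          subst h0
          simp at this
          omega⟩)
      refine ⟨fun A => ψ (G A), fun A hA => ?_⟩
      rw [← kd_map, ← hG A hA, hψ q _ (hf A hA)]
    · refine ⟨0, fun A hA => ?_⟩
      have := Finset.card_le_univ A
      rw [Fintype.card_fin] at this
      omega

end Koszul


/-- tuples of basis vectors -/
noncomputable def es (K : Type*) [Field K] {V : Type*} {n : ℕ} (t : Fin n → V) : Fin n → (V →₀ K) :=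
  fun i => Finsupp.single (t i) 1

/-- independent tuples -/
def IndT {V : Type*} (G : SimpleGraph V) {n : ℕ} (t : Fin n → V) : Prop :=
  ∀ i j, ¬ G.Adj (t i) (t j)

/-- a nontrivial reduced cohomology class of the independence complex -/
def Cert (K : Type*) [Field K] {V : Type*} (G : SimpleGraph V) (k : ℕ) : Prop :=
  ∃ ζ : (V →₀ K) [⋀^Fin (k + 1)]→ₗ[K] K,
    (∀ t : Fin (k + 2) → V, IndT G t →
      ∑ i : Fin (k + 2), (-1 : K) ^ (i : ℕ) * ζ (es K (t ∘ i.succAbove)) = 0) ∧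
    ¬ ∃ c : (Fin k → V) → K, ∀ t : Fin (k + 1) → V, Function.Injective t → IndT G t →
      ζ (es K t) = ∑ i : Fin (k + 1), (-1 : K) ^ (i : ℕ) * c (t ∘ i.succAbove)

section CertUse
universe u
variable {K : Type u} [Field K] {m : ℕ}

theorem sum_enum {R : Type*} [CommRing R] {N : ℕ} (A : Finset (Fin m)) (hA : A.card = N + 1)
    (φ : Fin m → R) :
    ∑ v ∈ A, (-1 : R) ^ (A.filter (· < v)).card * φ v =
      ∑ i : Fin (N + 1), (-1 : R) ^ (i : ℕ) * φ (A.orderEmbOfFin hA i) := by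
  conv_lhs => rw [← Finset.map_orderEmbOfFin_univ A hA]
  rw [Finset.sum_map]
  refine Finset.sum_congr rfl fun i _ => ?_
  congr 2
  rw [Finset.filter_map, Finset.card_map]
  have : (Finset.univ.filter ((fun x => x < (A.orderEmbOfFin hA).toEmbedding i) ∘
      (A.orderEmbOfFin hA).toEmbedding)) = Finset.Iio i := by
    ext j
    simp
  rw [this, Fin.card_Iio]

theorem enum_erase {N : ℕ} (A : Finset (Fin m)) (hA : A.card = N + 1) (i : Fin (N + 1))
    (h : (A.erase (A.orderEmbOfFin hA i)).card = N) :
    (A.erase (A.orderEmbOfFin hA i)).orderEmbOfFin h = A.orderEmbOfFin hA ∘ i.succAbove := by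
  symm
  apply Finset.orderEmbOfFin_unique
  · intro x
    rw [Finset.mem_erase]
    refine ⟨?_, Finset.orderEmbOfFin_mem _ _ _⟩
    simp only [Function.comp, ne_eq, EmbeddingLike.apply_eq_iff_eq]
    exact Fin.succAbove_ne _ _
  · exact (A.orderEmbOfFin hA).strictMono.comp (Fin.strictMono_succAbove i)

theorem alt_sum_apply {ι M κ : Type*} [AddCommGroup M] [Module K M] (S : Finset κ)
    (f : κ → M [⋀^ι]→ₗ[K] K) (v : ι → M) : (∑ i ∈ S, f i) v = ∑ i ∈ S, f i v :=
  map_sum (⟨⟨fun g : M [⋀^ι]→ₗ[K] K => g v, rfl⟩, fun _ _ => rfl⟩ : (M [⋀^ι]→ₗ[K] K) →+ K) f S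

/-- alternating extension of a function on subsets -/
noncomputable def altExt (k : ℕ) (c : Finset (Fin m) → K) : (Fin m →₀ K) [⋀^Fin k]→ₗ[K] K :=
  ∑ U : Finset (Fin m), if h : U.card = k then
    c U • (Matrix.detRowAlternating (R := K) (n := Fin k)).compLinearMap
      (LinearMap.pi fun j => Finsupp.lapply (U.orderEmbOfFin h j)) else 0

theorem altExt_apply (k : ℕ) (c : Finset (Fin m) → K) (A : Finset (Fin m)) (hA : A.card = k) :
    altExt k c (es K (A.orderEmbOfFin hA)) = c A := by
  classical
  rw [altExt, alt_sum_apply, Finset.sum_eq_single A]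
  · rw [dif_pos hA, AlternatingMap.smul_apply, AlternatingMap.compLinearMap_apply]
    have : (fun i => (LinearMap.pi fun j => Finsupp.lapply (A.orderEmbOfFin hA j) :
        (Fin m →₀ K) →ₗ[K] (Fin k → K)) (es K (A.orderEmbOfFin hA) i)) = (1 : Matrix (Fin k) (Fin k) K) := by
      funext i j
      simp only [LinearMap.pi_apply, Finsupp.lapply_apply, es, Finsupp.single_apply,
        EmbeddingLike.apply_eq_iff_eq, Matrix.one_apply]
    have h2 : Matrix.detRowAlternating (R := K) (1 : Matrix (Fin k) (Fin k) K) = 1 := Matrix.det_one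
    rw [this, h2, smul_eq_mul, mul_one]
  · intro U _ hU
    split_ifs with h
    · rw [AlternatingMap.smul_apply, AlternatingMap.compLinearMap_apply]
      obtain ⟨x, hxA, hxU⟩ : ∃ x ∈ A, x ∉ U := by
        by_contra hcon
        push Not at hcon
        exact hU (Finset.eq_of_subset_of_card_le hcon (by omega)).symm
      rw [← Finset.mem_coe, ← Finset.range_orderEmbOfFin A hA] at hxA
      obtain ⟨i, rfl⟩ := hxA
      rw [AlternatingMap.map_coord_zero _ i, smul_zero]
      funext j
      simp only [LinearMap.pi_apply, Finsupp.lapply_apply, es, Finsupp.single_apply,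
        Pi.zero_apply]
      rw [if_neg]
      intro h'
      rw [h'] at hxU
      exact hxU (Finset.orderEmbOfFin_mem _ _ _)
    · rfl
  · intro h; exact absurd (Finset.mem_univ _) h

/-- coboundary of an alternating map as an alternating map -/
noncomputable def altD {V : Type*} {k : ℕ} (c : (V →₀ K) [⋀^Fin k]→ₗ[K] K) :
    (V →₀ K) [⋀^Fin (k + 1)]→ₗ[K] K :=
  AlternatingMap.alternatizeUncurryFin
    ((Finsupp.linearCombination K (fun _ : V => (1 : K))).smulRight c)

theorem altD_apply {V : Type*} {k : ℕ} (c : (V →₀ K) [⋀^Fin k]→ₗ[K] K) (t : Fin (k + 1) → V) :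
    altD c (es K t) = ∑ i : Fin (k + 1), (-1 : K) ^ (i : ℕ) * c (es K (t ∘ i.succAbove)) := by
  rw [altD, AlternatingMap.alternatizeUncurryFin_apply]
  refine Finset.sum_congr rfl fun i _ => ?_
  have : i.removeNth (es K t) = es K (t ∘ i.succAbove) := rfl
  rw [this]
  simp [es]

theorem alt_eq_of_mono {k : ℕ} (ζ ξ : (Fin m →₀ K) [⋀^Fin k]→ₗ[K] K) (Q : Finset (Fin m) → Prop)
    (h : ∀ A : Finset (Fin m), ∀ hA : A.card = k, Q A →
      ζ (es K (A.orderEmbOfFin hA)) = ξ (es K (A.orderEmbOfFin hA)))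
    (t : Fin k → Fin m) (ht : Function.Injective t) (hQ : Q (Finset.univ.image t)) :
    ζ (es K t) = ξ (es K t) := by
  have hA : (Finset.univ.image t).card = k := by
    rw [Finset.card_image_of_injective _ ht, Finset.card_univ, Fintype.card_fin]
  set A := Finset.univ.image t
  have hex : ∀ i, ∃ j, A.orderEmbOfFin hA j = t i := by
    intro i
    have : t i ∈ (A : Set (Fin m)) := Finset.mem_coe.2 (Finset.mem_image_of_mem _ (Finset.mem_univ _))
    rw [← Finset.range_orderEmbOfFin A hA] at this
    exact this
  choose π hπ using hex
  have hinj : Function.Injective π := by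
    intro i j hij
    apply ht
    rw [← hπ, ← hπ, hij]
  let e : Equiv.Perm (Fin k) := Equiv.ofBijective π ((Finite.injective_iff_bijective).1 hinj)
  have : es K t = es K (A.orderEmbOfFin hA) ∘ e := by
    funext i
    show Finsupp.single (t i) 1 = Finsupp.single (A.orderEmbOfFin hA (π i)) 1
    rw [hπ]
  rw [this, AlternatingMap.map_perm, AlternatingMap.map_perm, h A hA hQ]

theorem monA_mul (A : Finset (Fin m)) (v : Fin m) (hv : v ∈ A) :
    (MvPolynomial.X v * ∏ w ∈ A.erase v, MvPolynomial.X w : MvPolynomial (Fin m) K) =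
      ∏ w ∈ A, MvPolynomial.X w := Finset.mul_prod_erase A _ hv

theorem monA_eq (A : Finset (Fin m)) : (∏ w ∈ A, MvPolynomial.X w : MvPolynomial (Fin m) K) =
    MvPolynomial.monomial (∑ w ∈ A, Finsupp.single w 1) 1 := by
  rw [MvPolynomial.monomial_sum_one]; rfl

theorem indA_apply (A : Finset (Fin m)) (v : Fin m) :
    (∑ w ∈ A, Finsupp.single w 1 : Fin m →₀ ℕ) v = if v ∈ A then 1 else 0 := by
  rw [Finsupp.finsetSum_apply]
  simp [Finsupp.single_apply]

theorem cert_lower (G : SimpleGraph (Fin m)) (k r : ℕ) (hc : Cert K G k)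
    (hr : regBound K (edgeIdeal K G) r) : k + 1 ≤ r := by
  by_contra hlt
  rw [edgeIdeal_eq] at hr
  obtain ⟨L, hL⟩ := RB_of_regBound _ _ hr
  have hKV := KV_of_RB L r _ _ hL (k + 1) (by omega)
  obtain ⟨ζ, hcoc, hnc⟩ := hc
  apply hnc
  set I := MI K (PU G Set.univ) (PU_up G Set.univ) with hI
  let z : Finset (Fin m) → K := fun A =>
    if h : A.card = k + 1 then ζ (es K (A.orderEmbOfFin h)) else 0
  let mon : Finset (Fin m) → MvPolynomial (Fin m) K := fun A => ∏ w ∈ A, MvPolynomial.X w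
  -- the cochain
  let f : Finset (Fin m) → MvPolynomial (Fin m) K ⧸ I := fun A =>
    Ideal.Quotient.mk I (MvPolynomial.C (z A) * mon A)
  have hlin : ∀ (g : Finset (Fin m) → MvPolynomial (Fin m) K) (A : Finset (Fin m)),
      kd (K := K) (fun B => Ideal.Quotient.mk I (g B)) A = Ideal.Quotient.mk I (kd (K := K) g A) :=
    fun g A => (kd_map (K := K) (Submodule.mkQ I) g A).symm
  have hkdf : ∀ A : Finset (Fin m), kd (K := K) f A = Ideal.Quotient.mk I
      (MvPolynomial.C (∑ v ∈ A, (-1 : K) ^ (A.filter (· < v)).card * z (A.erase v)) * mon A) := by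
    intro A
    rw [hlin]
    congr 1
    rw [kd, map_sum, Finset.sum_mul]
    refine Finset.sum_congr rfl fun v hv => ?_
    have := monA_mul (K := K) A v hv
    simp only [mon, smul_eq_mul]
    rw [← this, map_mul, map_pow, map_neg, map_one]
    ring
  have hPU : ∀ A : Finset (Fin m), PU G Set.univ (∑ w ∈ A, Finsupp.single w 1) ↔
      ∃ i ∈ A, ∃ j ∈ A, G.Adj i j := by
    intro A
    simp only [PU, indA_apply, Set.mem_univ, not_true, false_and, exists_false, false_or]
    constructor
    · rintro ⟨i, j, hij, hi, hj⟩
      exact ⟨i, by simpa using hi, j, by simpa using hj, hij⟩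
    · rintro ⟨i, hi, j, hj, hij⟩
      exact ⟨i, j, hij, by simp [hi], by simp [hj]⟩
  obtain ⟨g, hg⟩ := hKV f (by
    intro A hA
    refine ⟨_, ?_, rfl⟩
    have : (mon A).IsHomogeneous (k + 1) := by
      have h1 := IsHomogeneous.prod A (fun w => (MvPolynomial.X w : MvPolynomial (Fin m) K))
        (fun _ => 1) (fun w _ => isHomogeneous_X K w)
      simpa [hA] using h1
    exact this.C_mul _) (by
    intro A hA
    rw [hkdf]
    by_cases hind : ∃ i ∈ A, ∃ j ∈ A, G.Adj i j
    · rw [Ideal.Quotient.eq_zero_iff_mem]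
      apply Ideal.mul_mem_left
      rw [hI, mem_MI]
      intro α hα
      classical
      simp only [mon] at hα
      rw [monA_eq, MvPolynomial.coeff_monomial] at hα
      split_ifs at hα with h
      · rw [← h]; exact (hPU A).2 hind
      · exact absurd rfl hα
    · push Not at hind
      rw [sum_enum A hA (fun v => z (A.erase v))]
      have := hcoc (A.orderEmbOfFin hA) (fun i j => hind _ (Finset.orderEmbOfFin_mem _ _ _) _
        (Finset.orderEmbOfFin_mem _ _ _))
      have h2 : ∑ i : Fin (k + 2), (-1 : K) ^ (i : ℕ) * z (A.erase (A.orderEmbOfFin hA i)) = 0 := by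
        rw [← this]
        refine Finset.sum_congr rfl fun i _ => ?_
        have hcard : (A.erase (A.orderEmbOfFin hA i)).card = k + 1 := by
          rw [Finset.card_erase_of_mem (Finset.orderEmbOfFin_mem _ _ _)]; omega
        simp only [z, dif_pos hcard, enum_erase A hA i hcard]
      rw [h2, map_zero, zero_mul, map_zero])
  choose G' hG' using fun A => Ideal.Quotient.mk_surjective (g A)
  let c : Finset (Fin m) → K := fun U =>
    MvPolynomial.coeff (∑ w ∈ U, Finsupp.single w 1) (G' U)
  have key : ∀ A : Finset (Fin m), A.card = k + 1 → (¬ ∃ i ∈ A, ∃ j ∈ A, G.Adj i j) →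
      z A = ∑ v ∈ A, (-1 : K) ^ (A.filter (· < v)).card * c (A.erase v) := by
    intro A hA hind
    have h1 := hg A hA
    have h2 : kd (K := K) g A = Ideal.Quotient.mk I (kd (K := K) G' A) := by
      rw [← hlin]
      exact kd_congr fun v _ => (hG' _).symm
    rw [h2, Ideal.Quotient.eq, hI, mem_MI] at h1
    have h3 := mt (h1 (∑ w ∈ A, Finsupp.single w 1)) (fun h => hind ((hPU A).1 h))
    rw [not_not, coeff_sub, sub_eq_zero, MvPolynomial.coeff_C_mul] at h3
    have h4 : MvPolynomial.coeff (∑ w ∈ A, Finsupp.single w 1) (mon A) = 1 := by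
      simp only [mon]
      rw [monA_eq, MvPolynomial.coeff_monomial, if_pos rfl]
    rw [h4, mul_one] at h3
    rw [h3, kd, coeff_sum]
    refine Finset.sum_congr rfl fun v hv => ?_
    rw [smul_eq_mul, show ((-1 : MvPolynomial (Fin m) K) ^ (A.filter (· < v)).card) =
      MvPolynomial.C ((-1) ^ (A.filter (· < v)).card) by simp, mul_assoc, MvPolynomial.coeff_C_mul]
    congr 1
    have : (∑ w ∈ A, Finsupp.single w 1 : Fin m →₀ ℕ) =
        (∑ w ∈ A.erase v, Finsupp.single w 1) + Finsupp.single v 1 :=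
      (Finset.sum_erase_add A _ hv).symm
    rw [this, coeff_X_mul_add]
  refine ⟨fun s => altExt k c (es K s), fun t ht hind => ?_⟩
  rw [← altD_apply]
  refine alt_eq_of_mono ζ (altD (altExt k c)) (fun A => ¬ ∃ i ∈ A, ∃ j ∈ A, G.Adj i j) ?_ t ht ?_
  · intro A hA hindA
    have := key A hA hindA
    rw [sum_enum A hA (fun v => c (A.erase v))] at this
    simp only [z, dif_pos hA] at this
    rw [this, altD_apply]
    refine Finset.sum_congr rfl fun i _ => ?_
    have hcard : (A.erase (A.orderEmbOfFin hA i)).card = k := by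
      rw [Finset.card_erase_of_mem (Finset.orderEmbOfFin_mem _ _ _)]; omega
    rw [← enum_erase A hA i hcard, altExt_apply]
  · rintro ⟨i, hi, j, hj, hij⟩
    rw [Finset.mem_image] at hi hj
    obtain ⟨i', _, rfl⟩ := hi
    obtain ⟨j', _, rfl⟩ := hj
    exact hind i' j' hij

end CertUse


section Hilb
universe u
variable {K : Type u} [Field K]

open Classical in
/-- the family of independent sets -/
noncomputable def indepF {V : Type*} [Fintype V] (G : SimpleGraph V) : Finset (Finset V) :=
  Finset.univ.filter fun F => ∀ x ∈ F, ∀ y ∈ F, ¬ G.Adj x y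

theorem mem_indepF {V : Type*} [Fintype V] (G : SimpleGraph V) (F : Finset V) :
    F ∈ indepF G ↔ ∀ x ∈ F, ∀ y ∈ F, ¬ G.Adj x y := by simp [indepF]

/-- independence polynomial shifted -/
noncomputable def QP {V : Type*} [Fintype V] (G : SimpleGraph V) : Polynomial ℤ :=
  ∑ F ∈ indepF G, (Polynomial.X - 1) ^ F.card

open Classical in
noncomputable def TT {m : ℕ} (G : SimpleGraph (Fin m)) (n : ℕ) : Finset (Fin m →₀ ℕ) :=
  (Finset.finsuppAntidiag Finset.univ n).filter fun α => α.support ∈ indepF G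

theorem hilbFun_eq {m : ℕ} (G : SimpleGraph (Fin m)) (n : ℕ) :
    hilbFun K (edgeIdeal K G) n = (TT G n).card := by
  classical
  rw [edgeIdeal_eq]
  set I := MI K (PU G Set.univ) (PU_up G Set.univ) with hI
  have hPU : ∀ α : Fin m →₀ ℕ, PU G Set.univ α ↔ α.support ∉ indepF G := by
    intro α
    simp only [PU, Set.mem_univ, not_true, false_and, exists_false, false_or, mem_indepF]
    push Not
    constructor
    · rintro ⟨i, j, hij, hi, hj⟩
      exact ⟨i, by simpa using hi, j, by simpa using hj, hij⟩
    · rintro ⟨i, hi, j, hj, hij⟩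
      exact ⟨i, j, hij, by simpa using hi, by simpa using hj⟩
  let v : TT G n → (MvPolynomial (Fin m) K ⧸ I) := fun α =>
    Ideal.Quotient.mkₐ K I (MvPolynomial.monomial α.1 1)
  have hv : LinearIndependent K v := by
    rw [Fintype.linearIndependent_iff]
    intro g hg β
    have h1 : Ideal.Quotient.mkₐ K I (∑ α : TT G n, g α • MvPolynomial.monomial α.1 1) = 0 := by
      rw [map_sum, ← hg]
      refine Finset.sum_congr rfl fun α _ => ?_
      rw [map_smul]
    rw [Ideal.Quotient.mkₐ_eq_mk, Ideal.Quotient.eq_zero_iff_mem, hI, mem_MI] at h1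
    have h2 := mt (h1 β.1) (fun h => (hPU _).1 h (Finset.mem_filter.1 β.2).2)
    rw [not_not, MvPolynomial.coeff_sum] at h2
    simp only [MvPolynomial.coeff_smul, MvPolynomial.coeff_monomial] at h2
    rw [Finset.sum_eq_single β] at h2
    · simpa using h2
    · intro γ _ hγ
      rw [if_neg (fun h => hγ (Subtype.ext h)), smul_zero]
    · simp
  have hspan : Submodule.span K (Set.range v) =
      (homogeneousSubmodule (Fin m) K n).map (Ideal.Quotient.mkₐ K I).toLinearMap := by
    apply le_antisymm
    · rw [Submodule.span_le]
      rintro _ ⟨α, rfl⟩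
      refine ⟨MvPolynomial.monomial α.1 1, ?_, rfl⟩
      have := (Finset.mem_filter.1 α.2).1
      rw [Finset.mem_finsuppAntidiag] at this
      apply MvPolynomial.isHomogeneous_monomial
      exact (Finsupp.degree_eq_sum _).trans this.1
    · rintro _ ⟨p, hp, rfl⟩
      rw [SetLike.mem_coe, MvPolynomial.mem_homogeneousSubmodule] at hp
      rw [p.as_sum, map_sum]
      refine Submodule.sum_mem _ fun α hα => ?_
      by_cases hi : α.support ∈ indepF G
      · have hT : α ∈ TT G n := by
          rw [TT, Finset.mem_filter, Finset.mem_finsuppAntidiag]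
          refine ⟨⟨?_, Finset.subset_univ _⟩, hi⟩
          have := hp (MvPolynomial.mem_support_iff.1 hα)
          rw [← Finsupp.degree_eq_sum, Finsupp.degree_eq_weight_one (R := ℕ)]; exact this
        have : (Ideal.Quotient.mkₐ K I).toLinearMap (MvPolynomial.monomial α (MvPolynomial.coeff α p))
            = MvPolynomial.coeff α p • v ⟨α, hT⟩ := by
          simp only [v]
          rw [← map_smul, MvPolynomial.smul_monomial, smul_eq_mul, mul_one]; rfl
        rw [this]
        exact Submodule.smul_mem _ _ (Submodule.subset_span ⟨_, rfl⟩)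
      · have : (Ideal.Quotient.mkₐ K I).toLinearMap (MvPolynomial.monomial α (MvPolynomial.coeff α p))
            = 0 := by
          rw [AlgHom.toLinearMap_apply, Ideal.Quotient.mkₐ_eq_mk, Ideal.Quotient.eq_zero_iff_mem,
            hI, mem_MI]
          intro β hβ
          rw [MvPolynomial.coeff_monomial] at hβ
          split_ifs at hβ with h
          · rw [← h, hPU]; exact hi
          · exact absurd rfl hβ
        rw [this]; exact Submodule.zero_mem _
  rw [hilbFun, ← hspan, finrank_span_eq_card hv, Fintype.card_coe]

theorem coeff_Xmk (F : ℕ) : PowerSeries.coeff F (PowerSeries.X * PowerSeries.mk 1 : PowerSeries ℚ) =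
    if F = 0 then 0 else 1 := by
  cases F with
  | zero => simp
  | succ k => rw [PowerSeries.coeff_succ_X_mul]; simp

theorem hilbSeries_eq {m : ℕ} (G : SimpleGraph (Fin m)) :
    hilbSeries K (edgeIdeal K G) =
      ∑ F ∈ indepF G, (PowerSeries.X * PowerSeries.mk 1 : PowerSeries ℚ) ^ F.card := by
  classical
  ext n
  rw [hilbSeries, PowerSeries.coeff_mk, hilbFun_eq, map_sum]
  have hfib := Finset.card_eq_sum_card_fiberwise (s := TT G n) (f := fun α => α.support)
    (t := indepF G) (fun α hα => (Finset.mem_filter.1 hα).2)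
  rw [hfib, Nat.cast_sum]
  refine Finset.sum_congr rfl fun F hF => ?_
  rw [← Finset.prod_const, PowerSeries.coeff_prod]
  simp only [coeff_Xmk]
  have : ∀ l ∈ F.finsuppAntidiag n, (∏ i ∈ F, (if l i = 0 then (0 : ℚ) else 1)) =
      if l.support = F then 1 else 0 := by
    intro l hl
    rw [Finset.mem_finsuppAntidiag] at hl
    split_ifs with h
    · apply Finset.prod_eq_one
      intro i hi
      rw [← h, Finsupp.mem_support_iff] at hi
      rw [if_neg hi]
    · obtain ⟨x, hx, hx'⟩ := Finset.exists_of_ssubset (Finset.ssubset_iff_subset_ne.2 ⟨hl.2, h⟩)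
      apply Finset.prod_eq_zero hx
      rw [Finsupp.notMem_support_iff] at hx'
      rw [if_pos hx']
  rw [Finset.sum_congr rfl this, Finset.sum_boole]
  congr 2
  ext α
  simp only [TT, Finset.mem_filter, Finset.mem_finsuppAntidiag]
  constructor
  · rintro ⟨⟨⟨h1, -⟩, h2⟩, h3⟩
    refine ⟨⟨?_, h3.le⟩, h3⟩
    rw [← h1]
    apply Finset.sum_subset (Finset.subset_univ _)
    intro x _ hx
    rw [← h3] at hx
    simpa using hx
  · rintro ⟨⟨h1, -⟩, h3⟩
    refine ⟨⟨⟨?_, Finset.subset_univ _⟩, h3 ▸ hF⟩, h3⟩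
    rw [← h1]
    symm
    apply Finset.sum_subset (Finset.subset_univ _)
    intro x _ hx
    rw [← h3] at hx
    simpa using hx

theorem QP_eval_one {V : Type*} [Fintype V] (G : SimpleGraph V) : (QP G).eval 1 = 1 := by
  classical
  rw [QP, Polynomial.eval_finsetSum, Finset.sum_eq_single ∅]
  · simp
  · intro F _ hF
    simp [hF]
  · intro h
    exact absurd ((mem_indepF G ∅).2 (by simp)) h

theorem HilbEq_of {m : ℕ} (G : SimpleGraph (Fin m)) : ∃ (d : ℕ) (h : Polynomial ℤ),
    HilbEq K (edgeIdeal K G) d h ∧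
      h.natDegree = (QP G).natDegree - (QP G).natTrailingDegree := by
  have hQ : QP G ≠ 0 := by
    intro h
    have := QP_eval_one G
    rw [h] at this
    simp at this
  have hd : (1 - Polynomial.X : Polynomial ℤ).natDegree = 1 := by
    rw [← Polynomial.natDegree_neg, neg_sub]
    exact Polynomial.natDegree_X_sub_C (1 : ℤ)
  refine ⟨(QP G).natDegree, (QP G).reverse.comp (1 - Polynomial.X), ⟨?_, ?_⟩, ?_⟩
  · set Y : PowerSeries ℚ := PowerSeries.mk 1 with hY
    have hY1 : Y * (1 - PowerSeries.X) = 1 := PowerSeries.mk_one_mul_one_sub_eq_one ℚ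
    letI : Invertible Y := ⟨1 - PowerSeries.X, by rw [mul_comm]; exact hY1, hY1⟩
    have hs : hilbSeries K (edgeIdeal K G) =
        Polynomial.eval₂ (Int.castRingHom (PowerSeries ℚ)) Y (QP G) := by
      rw [hilbSeries_eq, QP, Polynomial.eval₂_finset_sum]
      refine Finset.sum_congr rfl fun F _ => ?_
      rw [Polynomial.eval₂_pow, Polynomial.eval₂_sub, Polynomial.eval₂_X, Polynomial.eval₂_one]
      congr 1
      linear_combination -hY1
    have h2 := Polynomial.eval₂_reverse_mul_pow (Int.castRingHom (PowerSeries ℚ)) Y (QP G)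
    have h3 : (⅟Y) = 1 - PowerSeries.X := rfl
    rw [hs, ← h2, h3, mul_assoc, ← mul_pow, hY1, one_pow, mul_one]
    let φ : Polynomial ℤ →+* PowerSeries ℚ :=
      (Polynomial.coeToPowerSeries.ringHom).comp (Polynomial.mapRingHom (Int.castRingHom ℚ))
    have h4 : ((((QP G).reverse.comp (1 - Polynomial.X)).map (Int.castRingHom ℚ) : Polynomial ℚ) :
        PowerSeries ℚ) = φ ((QP G).reverse.comp (1 - Polynomial.X)) := rfl
    rw [h4, Polynomial.comp, Polynomial.hom_eval₂]
    congr 1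
    · exact RingHom.ext_int _ _
    · simp [φ]
  · rw [Polynomial.eval_comp]
    simp only [Polynomial.eval_sub, Polynomial.eval_one, Polynomial.eval_X, sub_self]
    rw [← Polynomial.coeff_zero_eq_eval_zero, Polynomial.coeff_zero_reverse]
    exact Polynomial.leadingCoeff_ne_zero.2 hQ
  · rw [Polynomial.natDegree_comp, hd, mul_one, Polynomial.reverse_natDegree]

end Hilb


section Comb

/-- gluing of two graphs -/
def glue {V W : Type} (G : SimpleGraph V) (S : Set V) (H : SimpleGraph W) : SimpleGraph (V ⊕ W) where
  Adj x y := match x, y with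
    | Sum.inl a, Sum.inl b => G.Adj a b
    | Sum.inr a, Sum.inr b => H.Adj a b
    | Sum.inl a, Sum.inr _ => a ∉ S
    | Sum.inr _, Sum.inl a => a ∉ S
  symm := ⟨by
    rintro (a | a) (b | b) h
    · exact SimpleGraph.Adj.symm (G := G) h
    · exact h
    · exact h
    · exact SimpleGraph.Adj.symm (G := H) h⟩
  loopless := ⟨by
    rintro (a | a) h
    · exact G.irrefl h
    · exact H.irrefl h⟩

/-- induced matchings in indexed form -/
def IMd {V : Type} (G : SimpleGraph V) {k : ℕ} (u v : Fin k → V) : Prop :=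
  (∀ i, G.Adj (u i) (v i)) ∧ ∀ i j, i ≠ j →
    ¬ G.Adj (u i) (u j) ∧ ¬ G.Adj (u i) (v j) ∧ ¬ G.Adj (v i) (v j)

def IMB {V : Type} (G : SimpleGraph V) (a : ℕ) : Prop :=
  ∀ (k : ℕ) (u v : Fin k → V), IMd G u v → k ≤ a

theorem IMB_mono {V : Type} {G : SimpleGraph V} {a b : ℕ} (h : IMB G a) (hab : a ≤ b) : IMB G b :=
  fun k u v hk => (h k u v hk).trans hab

theorem IMB_one_of {V : Type} {G : SimpleGraph V}
    (h : ∀ u v x y, G.Adj u v → G.Adj x y → ¬ G.Adj u x → ¬ G.Adj u y → ¬ G.Adj v x →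
      ¬ G.Adj v y → False) : IMB G 1 := by
  intro k u v hk
  by_contra hlt
  push Not at hlt
  have h01 : (⟨0, by omega⟩ : Fin k) ≠ ⟨1, by omega⟩ := by simp
  have h1 := hk.2 _ _ h01
  have h2 := hk.2 _ _ h01.symm
  exact h _ _ _ _ (hk.1 ⟨0, by omega⟩) (hk.1 ⟨1, by omega⟩) h1.1 h1.2.1
    (fun h => h2.2.1 h.symm) h1.2.2

theorem glue_pair {V W : Type} {G : SimpleGraph V} {S : Set V} {H : SimpleGraph W}
    (hS : ∀ x ∈ S, ∀ y ∈ S, ¬ G.Adj x y) (u v x y : V ⊕ W)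
    (h1 : (glue G S H).Adj u v) (h2 : (glue G S H).Adj x y)
    (a1 : ¬ (glue G S H).Adj u x) (a2 : ¬ (glue G S H).Adj u y) (a3 : ¬ (glue G S H).Adj v x)
    (a4 : ¬ (glue G S H).Adj v y) :
    (∃ u' v' x' y', u = Sum.inl u' ∧ v = Sum.inl v' ∧ x = Sum.inl x' ∧ y = Sum.inl y') ∨
    (∃ u' v' x' y', u = Sum.inr u' ∧ v = Sum.inr v' ∧ x = Sum.inr x' ∧ y = Sum.inr y') := by
  rcases u with u | u <;> rcases v with v | v <;> rcases x with x | x <;> rcases y with y | y <;>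
    simp only [glue, not_not] at h1 h2 a1 a2 a3 a4 <;>
    first
      | exact Or.inl ⟨_, _, _, _, rfl, rfl, rfl, rfl⟩
      | exact Or.inr ⟨_, _, _, _, rfl, rfl, rfl, rfl⟩
      | (exfalso; first
          | exact hS _ a1 _ a2 h2
          | exact hS _ a3 _ a4 h2
          | exact hS _ a1 _ a3 h1
          | exact hS _ a2 _ a4 h1
          | contradiction)

theorem glue_IMB {V W : Type} {G : SimpleGraph V} {S : Set V} {H : SimpleGraph W}
    (hS : ∀ x ∈ S, ∀ y ∈ S, ¬ G.Adj x y) {a : ℕ} (ha : 1 ≤ a) (hG : IMB G a) (hH : IMB H a) :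
    IMB (glue G S H) a := by
  intro k u v hk
  by_contra hlt
  push Not at hlt
  have hp : ∀ i j, i ≠ j → _ := fun i j hij =>
    glue_pair hS (u i) (v i) (u j) (v j) (hk.1 i) (hk.1 j) (hk.2 i j hij).1 (hk.2 i j hij).2.1
      (fun h => (hk.2 j i hij.symm).2.1 h.symm) (hk.2 i j hij).2.2
  let i0 : Fin k := ⟨0, by omega⟩
  let i1 : Fin k := ⟨1, by omega⟩
  have h01 : i0 ≠ i1 := by simp [i0, i1]
  rcases hp i0 i1 h01 with ⟨p, q, p', q', e1, e2, e3, e4⟩ | ⟨p, q, p', q', e1, e2, e3, e4⟩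
  · have hall : ∀ i, ∃ z : V × V, u i = Sum.inl z.1 ∧ v i = Sum.inl z.2 := by
      intro i
      by_cases hi : i = i0
      · rw [hi]; exact ⟨(p, q), e1, e2⟩
      · rcases hp i0 i (Ne.symm hi) with ⟨a, b, c, d, h1, h2, h3, h4⟩ | ⟨a, b, c, d, h1, h2, h3, h4⟩
        · exact ⟨(c, d), h3, h4⟩
        · rw [e1] at h1; simp at h1
    choose z hz1 hz2 using hall
    have : k ≤ a := hG k (fun i => (z i).1) (fun i => (z i).2) (by
      obtain ⟨h1, h2⟩ := hk
      simp only [hz1, hz2] at h1 h2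
      exact ⟨h1, h2⟩)
    omega
  · have hall : ∀ i, ∃ z : W × W, u i = Sum.inr z.1 ∧ v i = Sum.inr z.2 := by
      intro i
      by_cases hi : i = i0
      · rw [hi]; exact ⟨(p, q), e1, e2⟩
      · rcases hp i0 i (Ne.symm hi) with ⟨a, b, c, d, h1, h2, h3, h4⟩ | ⟨a, b, c, d, h1, h2, h3, h4⟩
        · rw [e1] at h1; simp at h1
        · exact ⟨(c, d), h3, h4⟩
    choose z hz1 hz2 using hall
    have : k ≤ a := hH k (fun i => (z i).1) (fun i => (z i).2) (by
      obtain ⟨h1, h2⟩ := hk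
      simp only [hz1, hz2] at h1 h2
      exact ⟨h1, h2⟩)
    omega

theorem IMd_map {V W : Type} {G : SimpleGraph V} {H : SimpleGraph W} (f : V → W)
    (hf : ∀ a b, H.Adj (f a) (f b) ↔ G.Adj a b) {k : ℕ} {u v : Fin k → V} (h : IMd G u v) :
    IMd H (f ∘ u) (f ∘ v) := by
  simpa only [IMd, Function.comp, hf] using h

theorem indMatchNum_eq {V : Type} {G : SimpleGraph V} {a : ℕ} (hB : IMB G a)
    (u v : Fin a → V) (hI : IMd G u v) : indMatchNum G = a := by
  classical
  have hub : ∀ k ∈ {k | ∃ M : Finset (Sym2 V), IsInducedMatchingSet G M ∧ M.card = k}, k ≤ a := by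
    rintro k ⟨M, ⟨⟨hM1, hM2⟩, hM3⟩, rfl⟩
    let e := M.equivFin.symm
    have hx : ∀ i, ∃ z : V × V, (e i : Sym2 V) = s(z.1, z.2) := by
      intro i
      induction h : (e i : Sym2 V) using Sym2.ind with
      | _ x y => exact ⟨(x, y), rfl⟩
    choose z hz using hx
    have hne : ∀ i j, i ≠ j → (e i : Sym2 V) ≠ e j := fun i j hij h =>
      hij (e.injective (Subtype.ext h))
    have hno : ∀ i j, i ≠ j → ∀ p q, p ∈ (e i : Sym2 V) → q ∈ (e j : Sym2 V) → ¬ G.Adj p q := by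
      intro i j hij p q hp hq hpq
      exact hM3 s(p, q) hpq _ (e i).2 _ (e j).2 (hne i j hij) ⟨⟨p, by simp, hp⟩, ⟨q, by simp, hq⟩⟩
    refine hB M.card (fun i => (z i).1) (fun i => (z i).2) ⟨fun i => ?_, fun i j hij => ?_⟩
    · have := hM1 (e i).2
      rw [hz] at this
      exact this
    · refine ⟨hno i j hij _ _ ?_ ?_, hno i j hij _ _ ?_ ?_, hno i j hij _ _ ?_ ?_⟩ <;>
        rw [hz] <;> simp
  have hmem : a ∈ {k | ∃ M : Finset (Sym2 V), IsInducedMatchingSet G M ∧ M.card = k} := by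
    have hno : ∀ i j, i ≠ j → ∀ p q, p ∈ s(u i, v i) → q ∈ s(u j, v j) → ¬ G.Adj p q := by
      intro i j hij p q hp hq
      rw [Sym2.mem_iff] at hp hq
      rcases hp with rfl | rfl <;> rcases hq with rfl | rfl
      · exact (hI.2 i j hij).1
      · exact (hI.2 i j hij).2.1
      · exact fun h => (hI.2 j i hij.symm).2.1 h.symm
      · exact (hI.2 i j hij).2.2
    have hdisj : ∀ i j, i ≠ j → ∀ p, p ∈ s(u i, v i) → p ∉ s(u j, v j) := by
      intro i j hij p hp hq
      rw [Sym2.mem_iff] at hp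
      rcases hp with rfl | rfl
      · exact hno i j hij (v i) (u i) (by simp) hq (hI.1 i).symm
      · exact hno i j hij (u i) (v i) (by simp) hq (hI.1 i)
    refine ⟨Finset.univ.image fun i => s(u i, v i), ⟨⟨?_, ?_⟩, ?_⟩, ?_⟩
    · intro e he
      simp only [Finset.coe_image, Finset.coe_univ, Set.image_univ, Set.mem_range] at he
      obtain ⟨i, rfl⟩ := he
      exact hI.1 i
    · intro e he f hf hef w hw
      simp only [Finset.mem_image, Finset.mem_univ, true_and] at he hf
      obtain ⟨i, rfl⟩ := he
      obtain ⟨j, rfl⟩ := hf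
      exact hdisj i j (fun h => hef (by rw [h])) w hw
    · rintro e he f hf g hg hfg ⟨⟨p, hpe, hp⟩, ⟨q, hqe, hq⟩⟩
      simp only [Finset.mem_image, Finset.mem_univ, true_and] at hf hg
      obtain ⟨i, rfl⟩ := hf
      obtain ⟨j, rfl⟩ := hg
      have hij : i ≠ j := fun h => hfg (by rw [h])
      have hpq : p ≠ q := by
        rintro rfl
        exact hdisj i j hij p hp hq
      have : e = s(p, q) := (Sym2.mem_and_mem_iff hpq).1 ⟨hpe, hqe⟩
      rw [this] at he
      exact hno i j hij p q hp hq he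
    · rw [Finset.card_image_of_injective, Finset.card_univ, Fintype.card_fin]
      intro i j hij
      by_contra hne
      refine hdisj i j hne (u i) (by simp) ?_
      have : s(u i, v i) = s(u j, v j) := hij
      rw [← this]; simp
  exact le_antisymm (csSup_le ⟨a, hmem⟩ hub) (le_csSup ⟨a, hub⟩ hmem)

/-! RR lemmas -/

theorem RR_mono {V : Type} {G : SimpleGraph V} {U : Set V} {b : ℕ} (h : RR G U b) :
    RR G U (b + 1) := by
  induction h with
  | base U b h => exact RR.base _ _ h
  | step U b x hx h1 h2 ih1 ih2 => exact RR.step _ _ x hx ih1 ih2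

theorem RR_mono' {V : Type} {G : SimpleGraph V} {U : Set V} {b c : ℕ} (h : RR G U b) (hbc : b ≤ c) :
    RR G U c := by
  induction hbc with
  | refl => exact h
  | step _ ih => exact RR_mono ih

theorem RR_family {V W : Type} [Finite W] {G : SimpleGraph V} {H : SimpleGraph W} {U : Set V} {b : ℕ}
    (h : RR G U b) (s : W → Set V) : ∀ (U' : Set W), (∀ v ∈ U', s v ⊆ U) →
    (∀ v ∈ U', ∀ w ∈ U', H.Adj v w ↔ ∃ p ∈ s v, ∃ q ∈ s w, G.Adj p q) → RR H U' b := by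
  induction h with
  | base U b h =>
    intro U' h1 h2
    refine RR.base _ _ fun v hv w hw hvw => ?_
    obtain ⟨p, hp, q, hq, hpq⟩ := (h2 v hv w hw).1 hvw
    exact h p (h1 v hv hp) q (h1 w hw hq) hpq
  | step U b x hx h1 h2 ih1 ih2 =>
    intro U'
    induction hn : {v ∈ U' | x ∈ s v}.ncard using Nat.strong_induction_on generalizing U' with
    | _ n ih =>
      intro hs hadj
      by_cases hex : ∃ v ∈ U', x ∈ s v
      · obtain ⟨v, hv, hxv⟩ := hex
        refine RR.step _ _ v hv ?_ ?_
        · refine ih {w ∈ U' \ {v} | x ∈ s w}.ncard ?_ (U' \ {v}) rfl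
            (fun w hw => hs w hw.1) (fun w hw z hz => hadj w hw.1 z hz.1)
          rw [← hn]
          apply Set.ncard_lt_ncard _ (Set.toFinite _)
          refine ⟨fun w hw => ⟨hw.1.1, hw.2⟩, fun hsub => ?_⟩
          exact (hsub (⟨hv, hxv⟩ : v ∈ {v ∈ U' | x ∈ s v})).1.2 rfl
        · refine ih2 _ (fun w hw p hp => ⟨hs w hw.1 hp, fun hxp => ?_⟩)
            (fun w hw z hz => hadj w hw.1 z hz.1)
          exact hw.2 ((hadj v hv w hw.1).2 ⟨x, hxv, p, hp, hxp⟩)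
      · push Not at hex
        exact ih1 U' (fun v hv p hp => ⟨hs v hv hp, fun hpx => hex v hv (by
          rw [Set.mem_singleton_iff] at hpx; rwa [hpx] at hp)⟩) hadj

theorem RR_glue {V W : Type} [Finite V] [Finite W] {G : SimpleGraph V} {S : Set V}
    {H : SimpleGraph W} (hS : ∀ x ∈ S, ∀ y ∈ S, ¬ G.Adj x y) {b : ℕ} (hb : 1 ≤ b)
    (hG : RR G Set.univ b) (hH : RR H Set.univ b) : RR (glue G S H) Set.univ b := by
  have hA : RR (glue G S H) (Set.range Sum.inl) b := by
    refine RR_family hG (fun v => {p | v = Sum.inl p}) _ (fun _ _ => Set.subset_univ _) ?_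
    rintro _ ⟨v, rfl⟩ _ ⟨w, rfl⟩
    simp [glue]
  have hB : ∀ (U : Set W) c, RR H U c → RR (glue G S H) (Sum.inl '' S ∪ Sum.inr '' U) c := by
    intro U c h
    refine RR_family h (fun v => {p | v = Sum.inr p}) _ ?_ ?_
    · rintro _ (⟨v, hv, rfl⟩ | ⟨v, hv, rfl⟩) p hp
      · simp at hp
      · rw [Set.mem_setOf_eq, Sum.inr.injEq] at hp; rwa [hp] at hv
    · rintro _ (⟨v, hv, rfl⟩ | ⟨v, hv, rfl⟩) _ (⟨w, hw, rfl⟩ | ⟨w, hw, rfl⟩)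
      · simpa [glue] using hS v hv w hw
      · simpa [glue] using hv
      · simpa [glue] using hw
      · simp [glue]
  have hnon : ∀ (U : Set W) x, {y ∈ Set.range Sum.inl ∪ Sum.inr '' U | ¬ (glue G S H).Adj (Sum.inr x) y}
      = Sum.inl '' S ∪ Sum.inr '' {y ∈ U | ¬ H.Adj x y} := by
    intro U x
    ext (v | v) <;> simp [glue]
  have hdel : ∀ (U : Set W) x, (Set.range Sum.inl ∪ Sum.inr '' U) \ {Sum.inr x}
      = (Set.range Sum.inl ∪ Sum.inr '' (U \ {x}) : Set (V ⊕ W)) := by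
    intro U x
    ext (v | v) <;> simp
  have hC : ∀ (U : Set W) c, RR H U c → c = b →
      RR (glue G S H) (Set.range Sum.inl ∪ Sum.inr '' U) c := by
    intro U c h
    induction h with
    | base U c h =>
      rintro rfl
      obtain ⟨c, rfl⟩ : ∃ c', c = c' + 1 := ⟨c - 1, by omega⟩
      induction hn : U.ncard using Nat.strong_induction_on generalizing U with
      | _ n ih =>
        by_cases hU : U = ∅
        · rw [hU, Set.image_empty, Set.union_empty]; exact hA
        · obtain ⟨x, hx⟩ := Set.nonempty_iff_ne_empty.2 hU
          refine RR.step _ _ (Sum.inr x) (Or.inr ⟨x, hx, rfl⟩) ?_ ?_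
          · rw [hdel]
            refine ih _ ?_ _ (fun a ha b hb => h a ha.1 b hb.1) rfl
            rw [← hn]
            exact Set.ncard_diff_singleton_lt_of_mem hx (Set.toFinite _)
          · rw [hnon]
            exact hB _ _ (RR.base _ _ fun a ha b hb => h a ha.1 b hb.1)
    | step U c x hx h1 h2 ih1 ih2 =>
      intro hc
      refine RR.step _ _ (Sum.inr x) (Or.inr ⟨x, hx, rfl⟩) ?_ ?_
      · rw [hdel]; exact ih1 hc
      · rw [hnon]; exact hB _ _ h2
  have := hC _ _ hH rfl
  rwa [Set.image_univ, Set.range_inl_union_range_inr] at this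

theorem RR_alpha {V : Type} [Finite V] {G : SimpleGraph V} : ∀ (n : ℕ) (U Z : Set V) (b : ℕ),
    U.ncard = n → (∀ x ∈ U, ∀ y ∈ U, G.Adj x y → x ∈ Z) →
    (∀ F : Finset V, (∀ x ∈ F, x ∈ Z) → (∀ x ∈ F, ∀ y ∈ F, ¬ G.Adj x y) → F.card ≤ b) →
    RR G U b := by
  classical
  intro n
  induction n using Nat.strong_induction_on with
  | _ n ih =>
    intro U Z b hn hZ hF
    by_cases hE : ∃ x ∈ U, ∃ y ∈ U, G.Adj x y
    · obtain ⟨x, hx, y, hy, hxy⟩ := hE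
      have hxZ := hZ x hx y hy hxy
      have hb : 1 ≤ b := by
        have := hF {x} (by simpa using hxZ) (by simp)
        simpa using this
      obtain ⟨b, rfl⟩ : ∃ c', b = c' + 1 := ⟨b - 1, by omega⟩
      refine RR.step _ _ x hx ?_ ?_
      · refine ih _ ?_ _ Z _ rfl (fun p hp q hq => hZ p hp.1 q hq.1) hF
        rw [← hn]
        exact Set.ncard_diff_singleton_lt_of_mem hx (Set.toFinite _)
      · refine ih _ ?_ _ {z ∈ Z | ¬ G.Adj x z ∧ z ≠ x} _ rfl ?_ ?_
        · rw [← hn]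
          apply Set.ncard_lt_ncard _ (Set.toFinite _)
          exact ⟨fun w hw => hw.1, fun hsub => (hsub hy).2 hxy⟩
        · intro p hp q hq hpq
          refine ⟨hZ p hp.1 q hq.1 hpq, hp.2, ?_⟩
          rintro rfl
          exact hq.2 hpq
        · intro F hFZ hFi
          have hxF : x ∉ F := fun h => (hFZ x h).2.2 rfl
          have := hF (insert x F) (by
            intro z hz
            rw [Finset.mem_insert] at hz
            rcases hz with rfl | hz
            · exact hxZ
            · exact (hFZ z hz).1) (by
            intro p hp q hq
            rw [Finset.mem_insert] at hp hq
            rcases hp with rfl | hp <;> rcases hq with rfl | hq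
            · exact G.irrefl
            · exact (hFZ q hq).2.1
            · exact fun h => (hFZ p hp).2.1 h.symm
            · exact hFi p hp q hq)
          rw [Finset.card_insert_of_notMem hxF] at this
          omega
    · push Not at hE
      exact RR.base _ _ hE

theorem glue_connected {V W : Type} [Nonempty V] [Nonempty W] (G : SimpleGraph V)
    (H : SimpleGraph W) : (glue G ∅ H).Connected := by
  have hcr : ∀ (a : V) (b : W), (glue G ∅ H).Adj (Sum.inl a) (Sum.inr b) := by
    intro a b; simp [glue]
  have hne : Nonempty (V ⊕ W) := ⟨Sum.inl (Classical.arbitrary V)⟩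
  refine { preconnected := ?_, nonempty := hne }
  rintro (a | a) (b | b)
  · exact (hcr a (Classical.arbitrary W)).reachable.trans (hcr b (Classical.arbitrary W)).reachable.symm
  · exact (hcr a b).reachable
  · exact (hcr b a).reachable.symm
  · exact (hcr (Classical.arbitrary V) a).reachable.symm.trans (hcr (Classical.arbitrary V) b).reachable

theorem Cert_ind {K : Type*} [Field K] {V W : Type} {G : SimpleGraph V} {H : SimpleGraph W} (f : W → V)
    (hf : Function.Injective f) (hadj : ∀ a b, G.Adj (f a) (f b) ↔ H.Adj a b)
    (hdom : ∀ v, v ∉ Set.range f → ∀ w, G.Adj v (f w)) {k : ℕ} (hc : Cert K H k) : Cert K G k := by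
  classical
  obtain ⟨ζ, h1, h2⟩ := hc
  let Φ : (V →₀ K) →ₗ[K] (W →₀ K) := Finsupp.lcomapDomain f hf
  have hΦ1 : ∀ w, Φ (Finsupp.single (f w) 1) = Finsupp.single w 1 := by
    intro w
    ext z
    simp [Φ, Finsupp.lcomapDomain, Finsupp.comapDomain_apply, Finsupp.single_apply, hf.eq_iff]
  have hΦ2 : ∀ v, v ∉ Set.range f → Φ (Finsupp.single v 1) = 0 := by
    intro v hv
    ext z
    simp only [Φ, Finsupp.lcomapDomain, LinearMap.coe_mk, AddHom.coe_mk, Finsupp.comapDomain_apply,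
      Finsupp.coe_zero, Pi.zero_apply]
    rw [Finsupp.single_apply, if_neg]
    rintro rfl; exact hv ⟨z, rfl⟩
  have hz : ∀ {n : ℕ} (t : Fin n → W), (fun i => Φ (es K (f ∘ t) i)) = es K t := by
    intro n t
    funext i
    exact hΦ1 (t i)
  refine ⟨ζ.compLinearMap Φ, ?_, ?_⟩
  · intro t ht
    by_cases hr : ∃ i, t i ∉ Set.range f
    · obtain ⟨i, hi⟩ := hr
      have hall : ∀ j, t j ∉ Set.range f := by
        rintro j ⟨w, hw⟩
        apply ht i j
        rw [← hw]
        exact hdom _ hi w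
      apply Finset.sum_eq_zero
      intro j _
      rw [AlternatingMap.compLinearMap_apply, AlternatingMap.map_coord_zero _ 0, mul_zero]
      exact hΦ2 _ (hall _)
    · push Not at hr
      choose s hs using hr
      have : t = f ∘ s := (funext hs).symm
      subst this
      rw [← h1 s (fun i j h => ht i j ((hadj _ _).2 h))]
      refine Finset.sum_congr rfl fun i _ => ?_
      rw [AlternatingMap.compLinearMap_apply]
      congr 2
      exact hz (s ∘ i.succAbove)
  · rintro ⟨c, hc⟩
    apply h2
    refine ⟨fun s => c (f ∘ s), fun t ht hi => ?_⟩
    have := hc (f ∘ t) (hf.comp ht) (fun i j h => hi i j ((hadj _ _).1 h))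
    rw [AlternatingMap.compLinearMap_apply, hz] at this
    exact this

theorem Cert_glue {K : Type*} [Field K] {V W : Type} {G : SimpleGraph V} {H : SimpleGraph W}
    {k : ℕ} (hc : Cert K H k) : Cert K (glue G ∅ H) k := by
  refine Cert_ind Sum.inr Sum.inr_injective (fun a b => Iff.rfl) ?_ hc
  rintro (v | v) hv w
  · simp [glue]
  · exact absurd ⟨v, rfl⟩ hv

open Classical in
theorem QP_iso {V W : Type} [Fintype V] [Fintype W] {G : SimpleGraph V} {H : SimpleGraph W}
    (e : G ≃g H) : QP G = QP H := by
  rw [QP, QP]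
  refine Finset.sum_equiv e.toEquiv.finsetCongr ?_ ?_
  · intro F
    simp only [mem_indepF, Equiv.finsetCongr_apply, Finset.mem_map, forall_exists_index, and_imp,
      forall_apply_eq_imp_iff₂]
    have : ∀ a b, H.Adj (e a) (e b) ↔ G.Adj a b := fun a b => e.map_adj_iff
    simp [this]
  · intro F _
    simp

theorem QP_glue {V W : Type} [Fintype V] [Fintype W] {G : SimpleGraph V} {S : Finset V}
    {H : SimpleGraph W} (hS : ∀ x ∈ S, ∀ y ∈ S, ¬ G.Adj x y) :
    QP (glue G (S : Set V) H) = QP G + Polynomial.X ^ S.card * (QP H - 1) := by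
  classical
  have h1 : QP H - 1 = ∑ B ∈ (indepF H).erase ∅, (Polynomial.X - 1) ^ B.card := by
    have : (∅ : Finset W) ∈ indepF H := (mem_indepF H ∅).2 (by simp)
    rw [QP, ← Finset.add_sum_erase _ _ this]
    simp
  have h2 : (Polynomial.X : Polynomial ℤ) ^ S.card = ∑ A ∈ S.powerset, (Polynomial.X - 1) ^ A.card := by
    have := Finset.sum_pow_mul_eq_add_pow (Polynomial.X - 1 : Polynomial ℤ) 1 S
    simp only [one_pow, mul_one, sub_add_cancel] at this
    exact this.symm
  rw [h1, h2, Finset.sum_mul_sum, ← Finset.sum_product', QP, QP,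
    ← Finset.sum_filter_add_sum_filter_not _ (fun F => F.toRight = ∅)]
  congr 1
  · refine Finset.sum_nbij' (fun F => F.toLeft) (fun A => A.disjSum ∅) ?_ ?_ ?_ ?_ ?_
    · intro F hF
      rw [Finset.mem_filter, mem_indepF] at hF
      rw [mem_indepF]
      intro x hx y hy
      exact hF.1 _ (Finset.mem_toLeft.1 hx) _ (Finset.mem_toLeft.1 hy)
    · intro A hA
      rw [mem_indepF] at hA
      rw [Finset.mem_filter, mem_indepF]
      refine ⟨?_, Finset.toRight_disjSum⟩
      rintro (x | x) hx (y | y) hy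
      · exact hA x (by simpa using hx) y (by simpa using hy)
      all_goals simp at hx hy
    · intro F hF
      rw [Finset.mem_filter] at hF
      rw [← hF.2, Finset.toLeft_disjSum_toRight]
    · intro A _; exact Finset.toLeft_disjSum
    · intro F hF
      rw [Finset.mem_filter] at hF
      have := Finset.card_toLeft_add_card_toRight (u := F)
      rw [hF.2, Finset.card_empty, add_zero] at this
      rw [this]
  · refine Finset.sum_nbij' (fun F => (F.toLeft, F.toRight)) (fun A => A.1.disjSum A.2) ?_ ?_ ?_ ?_ ?_
    · intro F hF
      rw [Finset.mem_filter, mem_indepF] at hF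
      rw [Finset.mem_product, Finset.mem_powerset, Finset.mem_erase, mem_indepF]
      refine ⟨fun x hx => ?_, hF.2, fun x hx y hy =>
        hF.1 _ (Finset.mem_toRight.1 hx) _ (Finset.mem_toRight.1 hy)⟩
      obtain ⟨w, hw⟩ := Finset.nonempty_iff_ne_empty.2 hF.2
      have := hF.1 _ (Finset.mem_toLeft.1 hx) _ (Finset.mem_toRight.1 hw)
      simpa [glue] using this
    · rintro ⟨A, B⟩ hA
      rw [Finset.mem_product, Finset.mem_powerset, Finset.mem_erase, mem_indepF] at hA
      rw [Finset.mem_filter, mem_indepF]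
      refine ⟨?_, by simpa using hA.2.1⟩
      rintro (x | x) hx (y | y) hy <;> simp only [Finset.inl_mem_disjSum, Finset.inr_mem_disjSum] at hx hy
      · exact hS x (hA.1 hx) y (hA.1 hy)
      · have := hA.1 hx; simpa [glue] using this
      · have := hA.1 hy; simpa [glue] using this
      · exact hA.2.2 x hx y hy
    · intro F _; exact Finset.toLeft_disjSum_toRight
    · rintro ⟨A, B⟩ _; simp
    · intro F _
      rw [← pow_add, Finset.card_toLeft_add_card_toRight]

end Comb


section XG
variable {Y : Type} [LinearOrder Y]

/-- the group -/
abbrev NN (Y : Type) : Type := (Y × Y → Equiv.Perm (Fin 3)) × (Y → ℤˣ)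

def Ind (G : SimpleGraph Y) (σ : Finset Y) : Prop := ∀ x ∈ σ, ∀ y ∈ σ, ¬ G.Adj x y

open Classical in
/-- the elements g(σ) -/
noncomputable def gg (G : SimpleGraph Y) (σ : Finset Y) : NN Y :=
  (fun pq => if G.Adj pq.1 pq.2 then (if pq.1 ∈ σ then Equiv.swap 0 1 else
    if pq.2 ∈ σ then Equiv.swap 1 2 else 1) else 1, fun y => if y ∈ σ then -1 else 1)

variable {G : SimpleGraph Y}

theorem gg_fst (σ : Finset Y) {p q : Y} (h : G.Adj p q) : (gg G σ).1 (p, q) =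
    if p ∈ σ then Equiv.swap 0 1 else if q ∈ σ then Equiv.swap 1 2 else 1 := by
  simp [gg, h]

theorem gg_snd (σ : Finset Y) (y : Y) : (gg G σ).2 y = if y ∈ σ then -1 else 1 := rfl

theorem Ind_mono {σ τ : Finset Y} (h : Ind G τ) (hst : σ ⊆ τ) : Ind G σ :=
  fun x hx y hy => h x (hst hx) y (hst hy)

theorem gg_empty : gg G ∅ = 1 := by
  ext <;> simp [gg]

theorem gg_mul {σ τ : Finset Y} (h : Ind G (σ ∪ τ)) : gg G σ * gg G τ = gg G (symmDiff σ τ) := by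
  refine Prod.ext (funext fun ⟨p, q⟩ => ?_) (funext fun y => ?_)
  · show (gg G σ).1 (p, q) * (gg G τ).1 (p, q) = _
    by_cases hpq : G.Adj p q
    · rw [gg_fst _ hpq, gg_fst _ hpq, gg_fst _ hpq]
      have := fun hp hq => h p hp q hq hpq
      simp only [Finset.mem_union] at this
      simp only [Finset.mem_symmDiff]
      by_cases h1 : p ∈ σ <;> by_cases h2 : p ∈ τ <;> by_cases h3 : q ∈ σ <;> by_cases h4 : q ∈ τ <;>
        simp [h1, h2, h3, h4] at this ⊢
    · simp [gg, hpq]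
  · show (gg G σ).2 y * (gg G τ).2 y = _
    simp only [gg_snd, Finset.mem_symmDiff]
    by_cases h1 : y ∈ σ <;> by_cases h2 : y ∈ τ <;> simp [h1, h2]

theorem gg_sq {σ : Finset Y} (h : Ind G σ) : gg G σ * gg G σ = 1 := by
  rw [gg_mul (by rwa [Finset.union_self]), symmDiff_self]
  exact gg_empty

theorem gg_inj {σ τ : Finset Y} (h : gg G σ = gg G τ) : σ = τ := by
  ext y
  have := congrFun (congrArg Prod.snd h) y
  rw [gg_snd, gg_snd] at this
  by_cases h1 : y ∈ σ <;> by_cases h2 : y ∈ τ <;> simp [h1, h2] at this ⊢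

def Compat (G : SimpleGraph Y) (ν μ : NN Y) : Prop := ∃ σ, Ind G σ ∧ μ = ν * gg G σ

theorem Compat_symm {ν μ : NN Y} (h : Compat G ν μ) : Compat G μ ν := by
  obtain ⟨σ, hσ, rfl⟩ := h
  exact ⟨σ, hσ, by rw [mul_assoc, gg_sq hσ, mul_one]⟩

theorem Compat_mul {ν μ ρ : NN Y} : Compat G (ρ * ν) (ρ * μ) ↔ Compat G ν μ := by
  simp only [Compat, mul_assoc, mul_right_inj]

theorem Compat_gg {σ τ : Finset Y} (hσ : Ind G σ) (hτ : Ind G τ) :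
    Compat G (gg G σ) (gg G τ) ↔ ∀ p ∈ σ, ∀ q ∈ τ, ¬ G.Adj p q := by
  constructor
  · rintro ⟨ρ, hρ, h⟩ p hp q hq hpq
    have h1 := congrFun (congrArg Prod.fst h) (p, q)
    have h2 : (gg G τ).1 (p, q) = (gg G σ).1 (p, q) * (gg G ρ).1 (p, q) := h1
    have hpτ : p ∉ τ := fun h => hτ p h q hq hpq
    rw [gg_fst _ hpq, gg_fst _ hpq, gg_fst _ hpq, if_neg hpτ, if_pos hq, if_pos hp] at h2
    split_ifs at h2 <;> revert h2 <;> decide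
  · intro h
    have hU : Ind G (σ ∪ τ) := by
      intro x hx y hy
      rw [Finset.mem_union] at hx hy
      rcases hx with hx | hx <;> rcases hy with hy | hy
      · exact hσ x hx y hy
      · exact h x hx y hy
      · exact fun h' => h y hy x hx h'.symm
      · exact hτ x hx y hy
    refine ⟨symmDiff σ τ, Ind_mono hU ?_, ?_⟩
    · intro x hx
      rw [Finset.mem_symmDiff] at hx
      rw [Finset.mem_union]
      tauto
    · rw [← gg_mul hU, ← mul_assoc, gg_sq hσ, one_mul]

/-- the next graph -/
def XG (G : SimpleGraph Y) : SimpleGraph (NN Y) where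
  Adj ν μ := ¬ Compat G ν μ
  symm := ⟨fun _ _ h h' => h (Compat_symm h')⟩
  loopless := ⟨fun ν h => h ⟨∅, by simp [Ind], by rw [gg_empty, mul_one]⟩⟩

def NoTwo {V : Type} (G : SimpleGraph V) : Prop :=
  ∀ u v x y, G.Adj u v → G.Adj x y → ¬ G.Adj u x → ¬ G.Adj u y → ¬ G.Adj v x →
      ¬ G.Adj v y → False

theorem S3_fact (x2 x3 : Equiv.Perm (Fin 3))
    (h2 : x2 = Equiv.swap 0 1 ∨ x2 = Equiv.swap 1 2 ∨ x2 = 1)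
    (h3 : x3 = Equiv.swap 0 1 ∨ x3 = Equiv.swap 1 2 ∨ x3 = 1)
    (h : Equiv.swap 0 1 * Equiv.swap 1 2 * x2 * x3 = 1) :
    x2 = Equiv.swap 1 2 ∧ x3 = Equiv.swap 0 1 := by
  rcases h2 with rfl | rfl | rfl <;> rcases h3 with rfl | rfl | rfl <;> revert h <;> decide

theorem gg_fst_cases (σ : Finset Y) {p q : Y} (h : G.Adj p q) :
    (gg G σ).1 (p, q) = Equiv.swap 0 1 ∨ (gg G σ).1 (p, q) = Equiv.swap 1 2 ∨
      (gg G σ).1 (p, q) = 1 := by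
  rw [gg_fst _ h]
  split_ifs <;> simp

theorem gg_word {σ0 σ1 σ2 σ3 : Finset Y} (h0 : Ind G σ0) (h1 : Ind G σ1)
    (hw : gg G σ0 * gg G σ1 * gg G σ2 * gg G σ3 = 1)
    {p q : Y} (hpq : G.Adj p q) (hp : p ∈ σ0) (hq : q ∈ σ1) : q ∈ σ2 ∧ p ∈ σ3 := by
  have h := congrFun (congrArg Prod.fst hw) (p, q)
  have h' : (gg G σ0).1 (p, q) * (gg G σ1).1 (p, q) * (gg G σ2).1 (p, q) * (gg G σ3).1 (p, q) = 1 := h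
  have hp1 : p ∉ σ1 := fun h => h1 p h q hq hpq
  rw [gg_fst σ0 hpq, gg_fst σ1 hpq, if_pos hp, if_neg hp1, if_pos hq] at h'
  have := S3_fact _ _ (gg_fst_cases σ2 hpq) (gg_fst_cases σ3 hpq) h'
  rw [gg_fst _ hpq, gg_fst _ hpq] at this
  obtain ⟨e2, e3⟩ := this
  constructor
  · split_ifs at e2 with a b
    · exfalso; revert e2; decide
    · exact b
    · exfalso; revert e2; decide
  · split_ifs at e3 with a b
    · exact a
    · exfalso; revert e3; decide
    · exfalso; revert e3; decide

theorem XG_adj_ex {ν : NN Y} {σ τ : Finset Y} (hσ : Ind G σ) (hτ : Ind G τ) :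
    (XG G).Adj (ν * gg G σ) (ν * gg G τ) ↔ ∃ p ∈ σ, ∃ q ∈ τ, G.Adj p q := by
  show ¬ Compat _ _ _ ↔ _
  rw [Compat_mul, Compat_gg hσ hτ]
  push Not
  rfl

theorem NoTwo_XG (h : NoTwo G) : NoTwo (XG G) := by
  intro a b c d hab hcd hac had hbc hbd
  obtain ⟨σ0, h0, e0⟩ := not_not.1 hac
  obtain ⟨σ1, h1, e1⟩ := Compat_symm (not_not.1 hbc)
  obtain ⟨σ2, h2, e2⟩ := not_not.1 hbd
  obtain ⟨σ3, h3, e3⟩ := Compat_symm (not_not.1 had)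
  have hw : gg G σ0 * gg G σ1 * gg G σ2 * gg G σ3 = 1 := by
    have : a * (gg G σ0 * gg G σ1 * gg G σ2 * gg G σ3) = a * 1 := by
      rw [mul_one]
      conv_rhs => rw [e3, e2, e1, e0]
      simp only [mul_assoc]
    exact mul_left_cancel this
  have ea : a = c * gg G σ0 := by rw [e0, mul_assoc, gg_sq h0, mul_one]
  have ec : c = b * gg G σ1 := by rw [e1, mul_assoc, gg_sq h1, mul_one]
  have hab' := hab
  rw [ea, e1, XG_adj_ex h0 h1] at hab'
  have hcd' := hcd
  rw [ec, e2, XG_adj_ex h1 h2] at hcd'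
  obtain ⟨p, hp, q, hq, hpq⟩ := hab'
  obtain ⟨u, hu, v, hv, huv⟩ := hcd'
  obtain ⟨hq2, hp3⟩ := gg_word h0 h1 hw hpq hp hq
  have hw' : gg G σ1 * gg G σ2 * gg G σ3 * gg G σ0 = 1 := by
    have := mul_eq_one_iff_eq_inv'.1 (show gg G σ0 * (gg G σ1 * gg G σ2 * gg G σ3) = 1 by
      simpa only [mul_assoc] using hw)
    rw [this]; simp
  obtain ⟨hv3, hu0⟩ := gg_word h1 h2 hw' huv hu hv
  exact h p q u v hpq huv (h0 p hp u hu0) (h3 p hp3 v hv3) (h1 q hq u hu) (h2 q hq2 v hv)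

theorem RR_XG [Finite Y] {b : ℕ} (h : RR G Set.univ b) : RR (XG G) Set.univ (b + 1) := by
  suffices H : ∀ (n : ℕ) (U : Set (NN Y)), U.ncard = n → RR (XG G) U (b + 1) from H _ _ rfl
  intro n
  induction n using Nat.strong_induction_on with
  | _ n ih =>
    intro U hn
    by_cases hU : U = ∅
    · subst hU; exact RR.base _ _ (by simp)
    · obtain ⟨ν, hν⟩ := Set.nonempty_iff_ne_empty.2 hU
      refine RR.step _ _ ν hν ?_ ?_
      · refine ih _ ?_ _ rfl
        rw [← hn]
        exact Set.ncard_diff_singleton_lt_of_mem hν (Set.toFinite _)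
      · refine RR_family h (fun μ => {y | (ν⁻¹ * μ).2 y = -1}) _ (fun _ _ => Set.subset_univ _) ?_
        intro μ hμ ρ hρ
        obtain ⟨σ, hσ, rfl⟩ := not_not.1 hμ.2
        obtain ⟨τ, hτ, rfl⟩ := not_not.1 hρ.2
        rw [XG_adj_ex hσ hτ]
        have : ∀ σ' : Finset Y, ∀ y, (ν⁻¹ * (ν * gg G σ')).2 y = -1 ↔ y ∈ σ' := by
          intro σ' y
          rw [inv_mul_cancel_left, gg_snd]
          by_cases h : y ∈ σ' <;> simp [h]
        simp only [Set.mem_setOf_eq, this]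

end XG


section LL
universe u
variable {K : Type u} [Field K] {N : Type} [Group N]

/-- signed sum over maximal chains of a cube -/
def Lf : (n : ℕ) → ((Fin (n + 1) → N) → K) → N → (Fin n → N) → K
  | 0, c, ν, _ => c (fun _ => ν)
  | n + 1, c, ν, x => ∑ i : Fin (n + 1), (-1 : K) ^ (i : ℕ) *
      Lf n (fun s => c (Fin.cons ν s)) (ν * x i) (x ∘ i.succAbove)

def dl {V : Type} {n : ℕ} (c : (Fin n → V) → K) : (Fin (n + 1) → V) → K :=
  fun T => ∑ i : Fin (n + 1), (-1 : K) ^ (i : ℕ) * c (T ∘ i.succAbove)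

theorem Lf_sub (n : ℕ) (c1 c2 : (Fin (n + 1) → N) → K) (ν : N) (x : Fin n → N) :
    Lf n (fun T => c1 T - c2 T) ν x = Lf n c1 ν x - Lf n c2 ν x := by
  induction n generalizing ν with
  | zero => rfl
  | succ n ih =>
    simp only [Lf]
    rw [← Finset.sum_sub_distrib]
    refine Finset.sum_congr rfl fun i _ => ?_
    rw [← mul_sub, ← ih]

theorem dl_cons {V : Type} {n : ℕ} (c : (Fin (n + 1) → V) → K) (ν : V) (s : Fin (n + 1) → V) :
    dl c (Fin.cons ν s : Fin (n + 2) → V) = c s - dl (fun s' : Fin n → V => c (Fin.cons ν s')) s := by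
  rw [dl, Fin.sum_univ_succ, dl]
  have h0 : (Fin.cons ν s : Fin (n + 2) → V) ∘ (0 : Fin (n + 2)).succAbove = s := by
    funext i; simp
  rw [h0]
  simp only [Fin.val_zero, pow_zero, one_mul, Fin.val_succ, pow_succ, mul_neg, mul_one, neg_mul,
    Finset.sum_neg_distrib, sub_eq_add_neg]
  congr 2
  refine Finset.sum_congr rfl fun i _ => ?_
  congr 2
  funext j
  refine Fin.cases ?_ (fun j => ?_) j
  · simp
  · simp

theorem swap_sum {n : ℕ} (F : Fin (n + 2) → Fin (n + 1) → K) :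
    ∑ i : Fin (n + 2), ∑ j : Fin (n + 1), (-1 : K) ^ ((i : ℕ) + (j : ℕ)) * F i j =
      - ∑ i : Fin (n + 2), ∑ j : Fin (n + 1),
        (-1 : K) ^ ((i : ℕ) + (j : ℕ)) * F (i.succAbove j) (j.predAbove i) := by
  rw [← Finset.sum_neg_distrib]
  simp_rw [← Finset.sum_neg_distrib]
  rw [← Finset.sum_product', ← Finset.sum_product']
  have inv : ∀ a : Fin (n + 2) × Fin (n + 1),
      (((a.1.succAbove a.2).succAbove (a.2.predAbove a.1)),
        ((a.2.predAbove a.1).predAbove (a.1.succAbove a.2))) = a := by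
    intro a
    rw [Fin.succAbove_succAbove_predAbove, Fin.predAbove_predAbove_succAbove]
  refine Finset.sum_bij' (fun a _ => (a.1.succAbove a.2, a.2.predAbove a.1))
    (fun a _ => (a.1.succAbove a.2, a.2.predAbove a.1)) (by simp) (by simp)
    (fun a _ => inv a) (fun a _ => inv a) ?_
  intro a _
  simp only
  have := inv a
  rw [Prod.ext_iff] at this
  simp only at this
  rw [this.1, this.2, Fin.neg_one_pow_succAbove_add_predAbove]
  ring

theorem swap_zero {n : ℕ} (F : Fin (n + 2) → Fin (n + 1) → K)
    (hF : ∀ i j, F (i.succAbove j) (j.predAbove i) = F i j) :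
    ∑ i : Fin (n + 2), ∑ j : Fin (n + 1), (-1 : K) ^ ((i : ℕ) + (j : ℕ)) * F i j = 0 := by
  rw [← Finset.sum_product']
  refine Finset.sum_involution (fun a _ => (a.1.succAbove a.2, a.2.predAbove a.1)) ?_ ?_ ?_ ?_
  · intro a _
    simp only
    rw [hF, Fin.neg_one_pow_succAbove_add_predAbove]
    ring
  · intro a _ _ h
    exact Fin.succAbove_ne a.1 a.2 (congrArg Prod.fst h)
  · simp
  · intro a _
    simp only
    rw [Fin.succAbove_succAbove_predAbove, Fin.predAbove_predAbove_succAbove]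

theorem remove2 {V : Type} {n : ℕ} (x : Fin (n + 2) → V) (i : Fin (n + 2)) (j : Fin (n + 1)) :
    (x ∘ (i.succAbove j).succAbove) ∘ (j.predAbove i).succAbove = (x ∘ i.succAbove) ∘ j.succAbove :=
  (Fin.removeNth_removeNth_eq_swap x j i).symm

theorem Lf_dl (n : ℕ) (c : (Fin (n + 1) → N) → K) (ν : N) (x : Fin (n + 1) → N)
    (hx : ∀ i j, x i * x j = x j * x i) :
    Lf (n + 1) (dl c) ν x = ∑ i : Fin (n + 1), (-1 : K) ^ (i : ℕ) *
      (Lf n c (ν * x i) (x ∘ i.succAbove) - Lf n c ν (x ∘ i.succAbove)) := by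
  induction n generalizing ν with
  | zero =>
    simp [Lf, dl, Fin.sum_univ_succ]
    rw [sub_eq_add_neg]
    congr 2
    congr 1; funext i; fin_cases i; rfl
  | succ n ih =>
    have h1 : Lf (n + 2) (dl c) ν x = ∑ i : Fin (n + 2), (-1 : K) ^ (i : ℕ) *
        (Lf (n + 1) c (ν * x i) (x ∘ i.succAbove) -
          Lf (n + 1) (dl fun s' => c (Fin.cons ν s')) (ν * x i) (x ∘ i.succAbove)) := by
      rw [Lf]
      refine Finset.sum_congr rfl fun i _ => ?_
      rw [← Lf_sub]
      simp only [dl_cons]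
    rw [h1]
    simp only [mul_sub, Finset.sum_sub_distrib]
    congr 1
    set c' := fun s' => c (Fin.cons ν s') with hc'
    have h2 : ∀ i : Fin (n + 2), Lf (n + 1) (dl c') (ν * x i) (x ∘ i.succAbove) =
        ∑ j : Fin (n + 1), (-1 : K) ^ (j : ℕ) *
          (Lf n c' (ν * x i * x (i.succAbove j)) ((x ∘ i.succAbove) ∘ j.succAbove)
          - Lf n c' (ν * x i) ((x ∘ i.succAbove) ∘ j.succAbove)) := by
      intro i
      exact ih c' (ν * x i) (x ∘ i.succAbove) (fun a b => hx _ _)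
    have h3 : ∀ i : Fin (n + 2), Lf (n + 1) c ν (x ∘ i.succAbove) =
        ∑ j : Fin (n + 1), (-1 : K) ^ (j : ℕ) *
          Lf n c' (ν * x (i.succAbove j)) ((x ∘ i.succAbove) ∘ j.succAbove) := fun i => rfl
    simp only [h2, h3, mul_sub, Finset.mul_sum, Finset.sum_sub_distrib, ← mul_assoc, ← pow_add]
    have e1 := swap_sum (fun (i : Fin (n + 2)) (j : Fin (n + 1)) =>
      Lf n c' (ν * x (i.succAbove j)) ((x ∘ i.succAbove) ∘ j.succAbove))
    simp only [Fin.succAbove_succAbove_predAbove, remove2] at e1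
    have e3 : ∀ (i : Fin (n + 2)) (j : Fin (n + 1)),
      ν * x i * x (i.succAbove j) = ν * x (i.succAbove j) * x i := by
      intro i j
      rw [mul_assoc, hx, mul_assoc]
    have e4 : ∑ i : Fin (n + 2), ∑ j : Fin (n + 1), (-1 : K) ^ ((i : ℕ) + (j : ℕ)) *
        Lf n c' (ν * x i * x (i.succAbove j)) ((x ∘ i.succAbove) ∘ j.succAbove) = 0 := by
      apply swap_zero
      intro i j
      rw [remove2, Fin.succAbove_succAbove_predAbove, e3]
    rw [e4, e1]
    ring

end LL


section CertStep
universe u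
variable {K : Type u} [Field K] {Y : Type} [LinearOrder Y] [Fintype Y] {G : SimpleGraph Y}

theorem gg_insert {σ : Finset Y} {a : Y} (ha : a ∉ σ) (h : Ind G (insert a σ)) :
    gg G {a} * gg G σ = gg G (insert a σ) := by
  rw [gg_mul (by rwa [← Finset.insert_eq]), Finset.insert_eq]
  congr 1
  exact (Finset.disjoint_singleton_left.2 ha).symmDiff_eq_sup

theorem gg_insert' {σ : Finset Y} {a : Y} (ha : a ∉ σ) (h : Ind G (insert a σ)) :
    gg G σ * gg G {a} = gg G (insert a σ) := by
  rw [gg_mul (by rwa [Finset.union_comm, ← Finset.insert_eq]), Finset.insert_eq, symmDiff_comm]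
  congr 1
  exact (Finset.disjoint_singleton_left.2 ha).symmDiff_eq_sup

theorem IndT_image {n : ℕ} {t : Fin n → Y} (h : IndT G t) : Ind G (Finset.univ.image t) := by
  intro x hx y hy
  rw [Finset.mem_image] at hx hy
  obtain ⟨i, _, rfl⟩ := hx
  obtain ⟨j, _, rfl⟩ := hy
  exact h i j

theorem Lcongr (n : ℕ) (c1 c2 : (Fin (n + 1) → NN Y) → K) (ν : NN Y) (t : Fin n → Y)
    (ht : Function.Injective t) (hi : IndT G t)
    (h : ∀ σ : Fin (n + 1) → Finset Y, Function.Injective σ → σ 0 = ∅ →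
      (∀ i, σ i ⊆ Finset.univ.image t) →
      c1 (fun i => ν * gg G (σ i)) = c2 (fun i => ν * gg G (σ i))) :
    Lf n c1 ν (fun i => gg G {t i}) = Lf n c2 ν (fun i => gg G {t i}) := by
  induction n generalizing ν with
  | zero =>
    have := h (fun _ => ∅) (fun a b _ => Subsingleton.elim (α := Fin 1) a b) rfl (by simp)
    simpa [Lf, gg_empty] using this
  | succ n ih =>
    rw [Lf, Lf]
    refine Finset.sum_congr rfl fun i _ => ?_
    congr 1
    refine ih (fun s => c1 (Fin.cons ν s)) (fun s => c2 (Fin.cons ν s)) (ν * gg G {t i})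
      (t ∘ i.succAbove) (ht.comp Fin.succAbove_right_injective) (fun a b => hi _ _) ?_
    intro σ hσ hσ0 hsub
    have hmem : ∀ j, t i ∉ σ j := by
      intro j hj
      have := hsub j hj
      simp only [Finset.mem_image, Finset.mem_univ, true_and, Function.comp] at this
      obtain ⟨a, ha⟩ := this
      exact Fin.succAbove_ne i a (ht ha)
    have hsub' : ∀ j, insert (t i) (σ j) ⊆ Finset.univ.image t := by
      intro j y hy
      rw [Finset.mem_insert] at hy
      rcases hy with rfl | hy
      · exact Finset.mem_image_of_mem _ (Finset.mem_univ _)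
      · have := hsub j hy
        simp only [Finset.mem_image, Finset.mem_univ, true_and, Function.comp] at this ⊢
        obtain ⟨a, ha⟩ := this
        exact ⟨_, ha⟩
    have heq : (Fin.cons ν (fun j => ν * gg G {t i} * gg G (σ j)) : Fin (n + 2) → NN Y) =
        fun j => ν * gg G ((Fin.cons ∅ (fun j => insert (t i) (σ j)) : Fin (n + 2) → Finset Y) j) := by
      funext j
      refine Fin.cases ?_ (fun j => ?_) j
      · simp [gg_empty]
      · simp only [Fin.cons_succ]
        rw [mul_assoc, gg_insert (hmem j) (Ind_mono (IndT_image hi) (hsub' j))]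
    show c1 (Fin.cons ν (fun j => ν * gg G {t i} * gg G (σ j))) = c2 (Fin.cons ν (fun j => ν * gg G {t i} * gg G (σ j)))
    rw [heq]
    apply h
    · rw [Fin.cons_injective_iff]
      constructor
      · rintro ⟨j, hj⟩
        exact Finset.insert_ne_empty _ _ hj
      · intro a b hab
        apply hσ
        have := congrArg (fun s => s.erase (t i)) hab
        simpa [Finset.erase_insert (hmem a), Finset.erase_insert (hmem b)] using this
    · rfl
    · intro j
      refine Fin.cases ?_ (fun j => ?_) j
      · simp
      · exact hsub' j

def sg (μ : NN Y) : Finset Y := Finset.univ.filter fun y => μ.2 y = -1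

theorem sg_gg (σ : Finset Y) : sg (gg G σ) = σ := by
  ext y
  by_cases h : y ∈ σ <;> simp [sg, gg_snd, h]

variable (K G) in
open Classical in
noncomputable def phi (μ : NN Y) : Y →₀ K :=
  if h : (sg μ).Nonempty ∧ μ = gg G (sg μ) then Finsupp.single ((sg μ).min' h.1) 1 else 0

theorem phi_gg {σ : Finset Y} (h : σ.Nonempty) : phi K G (gg G σ) = Finsupp.single (σ.min' h) 1 := by
  have h' : (sg (gg G σ)).Nonempty ∧ gg G σ = gg G (sg (gg G σ)) := by
    rw [sg_gg]; exact ⟨h, rfl⟩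
  rw [phi, dif_pos h']
  congr 2
  exact sg_gg σ

variable (G) in
noncomputable def al {k : ℕ} (ζ : (Y →₀ K) [⋀^Fin (k + 1)]→ₗ[K] K) :
    (NN Y →₀ K) [⋀^Fin (k + 2)]→ₗ[K] K :=
  AlternatingMap.alternatizeUncurryFin
    ((Finsupp.lapply (1 : NN Y) : (NN Y →₀ K) →ₗ[K] K).smulRight
      (ζ.compLinearMap (Finsupp.linearCombination K (phi K G))))

theorem al_apply {k : ℕ} (ζ : (Y →₀ K) [⋀^Fin (k + 1)]→ₗ[K] K) (T : Fin (k + 2) → NN Y) :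
    al G ζ (es K T) = ∑ i : Fin (k + 2), (-1 : K) ^ (i : ℕ) * ((if T i = 1 then 1 else 0) *
      ζ (fun j => phi K G (T (i.succAbove j)))) := by
  rw [al, AlternatingMap.alternatizeUncurryFin_apply]
  refine Finset.sum_congr rfl fun i _ => ?_
  have : i.removeNth (es K T) = es K (T ∘ i.succAbove) := rfl
  rw [this]
  by_cases h : T i = 1
  · simp [es, h]
  · simp [es, Finsupp.single_apply, h]

theorem al_no {k : ℕ} (ζ : (Y →₀ K) [⋀^Fin (k + 1)]→ₗ[K] K) (T : Fin (k + 2) → NN Y)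
    (h : ∀ i, T i ≠ 1) : al G ζ (es K T) = 0 := by
  rw [al_apply]
  apply Finset.sum_eq_zero
  intro i _
  rw [if_neg (h i), zero_mul, mul_zero]

theorem al_cons {k : ℕ} (ζ : (Y →₀ K) [⋀^Fin (k + 1)]→ₗ[K] K) (T : Fin (k + 2) → NN Y)
    (h0 : T 0 = 1) (h : ∀ j : Fin (k + 1), T j.succ ≠ 1) :
    al G ζ (es K T) = ζ (fun j => phi K G (T j.succ)) := by
  rw [al_apply, Fin.sum_univ_succ, Finset.sum_eq_zero]
  · simp [h0]
  · intro i _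
    rw [if_neg (h i), zero_mul, mul_zero]

theorem al_cocycle {k : ℕ} (ζ : (Y →₀ K) [⋀^Fin (k + 1)]→ₗ[K] K)
    (hζ : ∀ t : Fin (k + 2) → Y, IndT G t →
      ∑ i : Fin (k + 2), (-1 : K) ^ (i : ℕ) * ζ (es K (t ∘ i.succAbove)) = 0)
    (T : Fin (k + 3) → NN Y) (hT : IndT (XG G) T) :
    ∑ i : Fin (k + 3), (-1 : K) ^ (i : ℕ) * al G ζ (es K (T ∘ i.succAbove)) = 0 := by
  by_cases hex : ∃ i, T i = 1
  · obtain ⟨i, hi⟩ := hex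
    rw [← altD_apply]
    set s := T ∘ i.succAbove with hs
    have hT' : es K T = i.insertNth (Finsupp.single 1 1) (es K s) := by
      have := Fin.insertNth_self_removeNth i (es K T)
      rw [← this]
      congr 1
      simp [es, hi]
    rw [hT', AlternatingMap.map_insertNth]
    have hcons : Matrix.vecCons (Finsupp.single (1 : NN Y) (1 : K)) (es K s) =
        es K (Fin.cons 1 s : Fin (k + 3) → NN Y) := by
      funext j
      refine Fin.cases ?_ (fun j => ?_) j <;> simp [es]
    rw [hcons]
    by_cases hs1 : ∃ j, s j = 1
    · obtain ⟨j, hj⟩ := hs1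
      rw [AlternatingMap.map_eq_zero_of_eq _ _ (i := 0) (j := j.succ) _ (Fin.succ_ne_zero _).symm,
        smul_zero]
      simp [es, hj]
    · push Not at hs1
      have hd := dl_cons (fun T => al G ζ (es K T)) 1 s
      rw [altD_apply]
      have hd' : ∑ i : Fin (k + 3), (-1 : K) ^ (i : ℕ) *
        al G ζ (es K ((Fin.cons 1 s : Fin (k + 3) → NN Y) ∘ i.succAbove)) = _ := hd
      rw [hd', al_no ζ s hs1, zero_sub]
      have hσ : ∀ j, ∃ σ, Ind G σ ∧ s j = gg G σ := by
        intro j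
        obtain ⟨σ, h1, h2⟩ := not_not.1 (hT i (i.succAbove j))
        rw [hi, one_mul] at h2
        exact ⟨σ, h1, h2⟩
      choose σ hσ1 hσ2 using hσ
      have hne : ∀ j, (σ j).Nonempty := by
        intro j
        rw [Finset.nonempty_iff_ne_empty]
        intro h
        apply hs1 j
        rw [hσ2, h, gg_empty]
      have hind : IndT G (fun j => (σ j).min' (hne j)) := by
        intro a b
        have h1 := not_not.1 (hT (i.succAbove a) (i.succAbove b))
        have h2 : Compat G (s a) (s b) := h1
        rw [hσ2, hσ2, Compat_gg (hσ1 a) (hσ1 b)] at h2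
        exact h2 _ (Finset.min'_mem _ _) _ (Finset.min'_mem _ _)
      have := hζ _ hind
      have h3 : dl (fun s' : Fin (k + 1) → NN Y => al G ζ (es K (Fin.cons 1 s' : Fin (k + 2) → NN Y))) s
          = 0 := by
        rw [← this, dl]
        refine Finset.sum_congr rfl fun j _ => ?_
        rw [al_cons ζ _ rfl (fun a => by simpa using hs1 _)]
        congr 2
        funext a
        simp only [Fin.cons_succ, Function.comp]
        rw [hσ2, phi_gg (hne _)]
        rfl
      rw [h3]; simp
  · push Not at hex
    apply Finset.sum_eq_zero
    intro i _
    rw [al_no ζ (T ∘ i.succAbove) (fun j => hex _), mul_zero]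

theorem argmax {n : ℕ} (η : (Y →₀ K) [⋀^Fin (n + 1)]→ₗ[K] K) (t : Fin (n + 1) → Y)
    (ht : Function.Injective t) :
    ∑ i : Fin (n + 1), (-1 : K) ^ (i : ℕ) * (if ∀ j, t (i.succAbove j) < t i then
      η (Matrix.vecCons (Finsupp.single (t i) 1) (es K (t ∘ i.succAbove))) else 0) = η (es K t) := by
  obtain ⟨i0, h0⟩ := Finite.exists_max t
  rw [Finset.sum_eq_single i0]
  · rw [if_pos]
    · have h1 : es K t = i0.insertNth (Finsupp.single (t i0) 1) (es K (t ∘ i0.succAbove)) :=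
        (Fin.insertNth_self_removeNth i0 (es K t)).symm
      rw [h1, AlternatingMap.map_insertNth]
      simp
    · intro j
      exact lt_of_le_of_ne (h0 _) (fun h => Fin.succAbove_ne i0 j (ht h))
  · intro i _ hne
    rw [if_neg, mul_zero]
    intro h
    obtain ⟨j, hj⟩ := Fin.exists_succAbove_eq (Ne.symm hne)
    have := h j
    rw [hj] at this
    exact absurd (h0 i) (not_le.2 this)
  · simp

theorem Lphi (n : ℕ) (η : (Y →₀ K) [⋀^Fin (n + 1)]→ₗ[K] K) (σ : Finset Y) (hσ : σ.Nonempty)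
    (t : Fin n → Y) (ht : Function.Injective t) (hd : ∀ i, t i ∉ σ)
    (hI : Ind G (σ ∪ Finset.univ.image t)) :
    Lf n (fun s => η (fun j => phi K G (s j))) (gg G σ) (fun i => gg G {t i}) =
      if ∀ i, t i < σ.min' hσ then η (Matrix.vecCons (Finsupp.single (σ.min' hσ) 1) (es K t))
      else 0 := by
  induction n generalizing σ with
  | zero =>
    rw [if_pos (fun i => i.elim0), Lf]
    congr 1
    funext j
    fin_cases j
    exact phi_gg hσ
  | succ n ih =>
    set m := σ.min' hσ with hm
    have hins : ∀ i, Ind G (insert (t i) σ) := by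
      intro i
      refine Ind_mono hI ?_
      intro y hy
      rw [Finset.mem_insert] at hy
      rw [Finset.mem_union]
      rcases hy with rfl | hy
      · exact Or.inr (Finset.mem_image_of_mem _ (Finset.mem_univ _))
      · exact Or.inl hy
    have hterm : ∀ i : Fin (n + 1), Lf n (fun s => η (fun j => phi K G
        ((Fin.cons (gg G σ) s : Fin (n + 2) → NN Y) j)))
        (gg G σ * gg G {t i}) (fun j => gg G {t (i.succAbove j)}) =
        if t i < m then (if ∀ j, t (i.succAbove j) < t i then
          (η.curryLeft (Finsupp.single m 1))
            (Matrix.vecCons (Finsupp.single (t i) 1) (es K (t ∘ i.succAbove))) else 0) else 0 := by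
      intro i
      have h1 : (fun s : Fin (n + 1) → NN Y => η (fun j => phi K G
          ((Fin.cons (gg G σ) s : Fin (n + 2) → NN Y) j))) =
          fun s => (η.curryLeft (Finsupp.single m 1)) (fun j => phi K G (s j)) := by
        funext s
        rw [AlternatingMap.curryLeft_apply_apply]
        congr 1
        funext j
        refine Fin.cases ?_ (fun j => ?_) j
        · simp [phi_gg hσ, hm]
        · simp
      rw [h1, gg_insert' (hd i) (hins i)]
      have h2 := ih (η.curryLeft (Finsupp.single m 1)) (insert (t i) σ) (Finset.insert_nonempty _ _)
        (t ∘ i.succAbove) (ht.comp Fin.succAbove_right_injective) (by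
          intro j hj
          rw [Finset.mem_insert] at hj
          rcases hj with hj | hj
          · exact Fin.succAbove_ne i j (ht hj)
          · exact hd _ hj) (by
          refine Ind_mono hI ?_
          intro y hy
          simp only [Finset.mem_union, Finset.mem_insert, Finset.mem_image, Finset.mem_univ,
            true_and, Function.comp] at hy ⊢
          rcases hy with (rfl | hy) | ⟨a, rfl⟩
          · exact Or.inr ⟨_, rfl⟩
          · exact Or.inl hy
          · exact Or.inr ⟨_, rfl⟩)
      refine Eq.trans h2 ?_
      simp only [Finset.min'_insert _ _ hσ, ← hm, Function.comp]
      have hne : t i ≠ m := fun h => hd i (h ▸ Finset.min'_mem _ _)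
      by_cases hlt : t i < m
      · rw [if_pos hlt, min_eq_left hlt.le]
      · rw [if_neg hlt, min_eq_right (not_lt.1 hlt)]
        split_ifs
        · rw [AlternatingMap.curryLeft_apply_apply]
          exact AlternatingMap.map_eq_zero_of_eq _ _ (i := 0) (j := 1) rfl (by simp)
        · rfl
    have h3 : Lf (n + 1) (fun s => η (fun j => phi K G (s j))) (gg G σ) (fun i => gg G {t i}) =
        ∑ i : Fin (n + 1), (-1 : K) ^ (i : ℕ) * Lf n (fun s => η (fun j => phi K G
        ((Fin.cons (gg G σ) s : Fin (n + 2) → NN Y) j)))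
        (gg G σ * gg G {t i}) (fun j => gg G {t (i.succAbove j)}) := rfl
    rw [h3]
    simp only [hterm]
    split_ifs with hall
    · simp only [hall, if_true]
      rw [argmax _ t ht, AlternatingMap.curryLeft_apply_apply]
    · apply Finset.sum_eq_zero
      intro i _
      split_ifs with a b
      · exfalso
        apply hall
        intro j
        by_cases hj : j = i
        · rw [hj]; exact a
        · obtain ⟨j', rfl⟩ := Fin.exists_succAbove_eq hj
          exact (b j').trans a
      · rw [mul_zero]
      · rw [mul_zero]

variable (K) in
def chi (ν : NN Y) : K := (((∏ y, ν.2 y : ℤˣ) : ℤ) : K)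

theorem chi_mul (ν : NN Y) (y : Y) : chi K (ν * gg G {y}) = - chi K ν := by
  have : ∏ z, (ν * gg G {y}).2 z = - ∏ z, ν.2 z := by
    have h1 : ∀ z, (ν * gg G {y}).2 z = ν.2 z * (if z = y then -1 else 1) := by
      intro z
      rw [Prod.snd_mul, Pi.mul_apply, gg_snd]
      simp
    simp only [h1, Finset.prod_mul_distrib]
    simp
  rw [chi, this, chi]
  push_cast
  ring

def BB {n : ℕ} (t : Fin n → Y) : Finset (NN Y) := Finset.univ.filter fun ν => ∀ i, ν.2 (t i) = 1

variable (G) in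
noncomputable def EE (n : ℕ) (c : (Fin (n + 1) → NN Y) → K) (t : Fin n → Y) : K :=
  ∑ ν ∈ BB t, chi K ν * Lf n c ν (fun i => gg G {t i})

theorem EE_dl (n : ℕ) (c : (Fin (n + 1) → NN Y) → K) (t : Fin (n + 1) → Y)
    (ht : Function.Injective t) (hI : IndT G t) :
    EE G (n + 1) (dl c) t = - ∑ i : Fin (n + 1), (-1 : K) ^ (i : ℕ) * EE G n c (t ∘ i.succAbove) := by
  have hcomm : ∀ i j, gg G {t i} * gg G {t j} = gg G {t j} * gg G {t i} := by
    intro i j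
    have hU : ∀ i j, Ind G ({t i} ∪ {t j}) := by
      intro i j
      refine Ind_mono (IndT_image hI) ?_
      intro y hy
      simp only [Finset.mem_union, Finset.mem_singleton] at hy
      rcases hy with rfl | rfl <;> exact Finset.mem_image_of_mem _ (Finset.mem_univ _)
    rw [gg_mul (hU i j), gg_mul (hU j i), symmDiff_comm]
  have hE : ∀ i : Fin (n + 1), EE G n c (t ∘ i.succAbove) = ∑ ν ∈ BB t,
      (chi K ν * Lf n c ν (fun j => gg G {t (i.succAbove j)}) -
        chi K ν * Lf n c (ν * gg G {t i}) (fun j => gg G {t (i.succAbove j)})) := by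
    intro i
    rw [EE, ← Finset.sum_filter_add_sum_filter_not _ (fun ν => ν.2 (t i) = 1),
      Finset.sum_sub_distrib, sub_eq_add_neg]
    congr 1
    · apply Finset.sum_congr _ (fun _ _ => rfl)
      ext ν
      simp only [BB, Finset.mem_filter, Finset.mem_univ, true_and, Function.comp]
      constructor
      · rintro ⟨h1, h2⟩ j
        by_cases hj : j = i
        · rw [hj]; exact h2
        · obtain ⟨j', rfl⟩ := Fin.exists_succAbove_eq hj
          exact h1 j'
      · intro h
        exact ⟨fun j => h _, h i⟩
    · rw [← Finset.sum_neg_distrib]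
      have hsq : ∀ ν : NN Y, ν * gg G {t i} * gg G {t i} = ν := by
        intro ν
        rw [mul_assoc, gg_sq, mul_one]
        intro x hx y hy
        rw [Finset.mem_singleton] at hx hy
        rw [hx, hy]
        exact G.irrefl
      have hbit1 : ∀ ν : NN Y, (ν * gg G {t i}).2 (t i) = - ν.2 (t i) := by
        intro ν
        rw [Prod.snd_mul, Pi.mul_apply, gg_snd]
        simp
      have hbit2 : ∀ (ν : NN Y) j, (ν * gg G {t i}).2 (t (i.succAbove j)) = ν.2 (t (i.succAbove j)) := by
        intro ν j
        rw [Prod.snd_mul, Pi.mul_apply, gg_snd, if_neg, mul_one]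
        rw [Finset.mem_singleton]
        exact fun h => Fin.succAbove_ne i j (ht h)
      refine Finset.sum_nbij' (fun ν => ν * gg G {t i}) (fun ν => ν * gg G {t i}) ?_ ?_ ?_ ?_ ?_
      · intro ν hν
        simp only [BB, Finset.mem_filter, Finset.mem_univ, true_and, Function.comp] at hν ⊢
        intro j
        by_cases hj : j = i
        · rw [hj, hbit1]
          rcases Int.units_eq_one_or (ν.2 (t i)) with h | h
          · exact absurd h hν.2
          · rw [h]; simp
        · obtain ⟨j', rfl⟩ := Fin.exists_succAbove_eq hj
          rw [hbit2]; exact hν.1 j'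
      · intro ν hν
        simp only [BB, Finset.mem_filter, Finset.mem_univ, true_and, Function.comp] at hν ⊢
        refine ⟨fun j => ?_, ?_⟩
        · rw [hbit2]; exact hν _
        · rw [hbit1, hν]; decide
      · intro ν _; exact hsq ν
      · intro ν _; exact hsq ν
      · intro ν _
        rw [chi_mul, hsq]
        simp only [Function.comp]
        ring
  simp only [hE]
  rw [EE]
  have : ∀ ν, Lf (n + 1) (dl c) ν (fun i => gg G {t i}) = ∑ i : Fin (n + 1), (-1 : K) ^ (i : ℕ) *
      (Lf n c (ν * gg G {t i}) (fun j => gg G {t (i.succAbove j)}) -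
        Lf n c ν (fun j => gg G {t (i.succAbove j)})) := fun ν => Lf_dl n c ν _ hcomm
  simp only [this, Finset.mul_sum]
  rw [Finset.sum_comm, ← Finset.sum_neg_distrib]
  refine Finset.sum_congr rfl fun i _ => ?_
  rw [← Finset.sum_neg_distrib]
  refine Finset.sum_congr rfl fun ν _ => ?_
  ring

theorem Lf_zero (n : ℕ) (ν : NN Y) (x : Fin n → NN Y) : Lf n (fun _ => (0 : K)) ν x = 0 := by
  have := Lf_sub n (fun _ => (0 : K)) (fun _ => 0) ν x
  simpa using this

theorem EE_al {k : ℕ} (ζ : (Y →₀ K) [⋀^Fin (k + 1)]→ₗ[K] K) (t : Fin (k + 1) → Y)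
    (ht : Function.Injective t) (hI : IndT G t) :
    EE G (k + 1) (fun T => al G ζ (es K T)) t = ζ (es K t) := by
  rw [EE, Finset.sum_eq_single 1]
  · have h1 : Lf (k + 1) (fun T => al G ζ (es K T)) 1 (fun i => gg G {t i}) =
        Lf (k + 1) (fun T => ζ (fun j => phi K G (T j.succ))) 1 (fun i => gg G {t i}) := by
      refine Lcongr _ _ _ _ _ ht hI ?_
      intro σ hσ hσ0 hsub
      apply al_cons
      · rw [hσ0, gg_empty, one_mul]
      · intro j h
        rw [one_mul, ← gg_empty (G := G)] at h
        have := gg_inj h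
        rw [← hσ0] at this
        exact Fin.succ_ne_zero j (hσ this)
    rw [h1, ← argmax ζ t ht, Lf]
    have hc1 : chi K (1 : NN Y) = 1 := by simp [chi]
    rw [hc1, one_mul]
    refine Finset.sum_congr rfl fun i _ => ?_
    congr 1
    have h2 := Lphi (G := G) k ζ {t i} (Finset.singleton_nonempty _) (t ∘ i.succAbove)
      (ht.comp Fin.succAbove_right_injective) (by
        intro j hj
        rw [Finset.mem_singleton] at hj
        exact Fin.succAbove_ne i j (ht hj)) (by
        refine Ind_mono (IndT_image hI) ?_
        intro y hy
        simp only [Finset.mem_union, Finset.mem_singleton, Finset.mem_image, Finset.mem_univ,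
          true_and, Function.comp] at hy ⊢
        rcases hy with rfl | ⟨a, rfl⟩
        · exact ⟨_, rfl⟩
        · exact ⟨_, rfl⟩)
    simp only [Finset.min'_singleton] at h2
    rw [one_mul]
    simp only [Fin.cons_succ]
    exact h2
  · intro ν hν hne
    have : Lf (k + 1) (fun T => al G ζ (es K T)) ν (fun i => gg G {t i}) =
        Lf (k + 1) (fun _ => (0 : K)) ν (fun i => gg G {t i}) := by
      refine Lcongr _ _ _ _ _ ht hI ?_
      intro σ hσ hσ0 hsub
      apply al_no
      intro i h
      simp only [BB, Finset.mem_filter, Finset.mem_univ, true_and] at hν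
      have hem : σ i = ∅ := by
        rw [Finset.eq_empty_iff_forall_notMem]
        intro y hy
        have hy' := hsub i hy
        simp only [Finset.mem_image, Finset.mem_univ, true_and] at hy'
        obtain ⟨j, rfl⟩ := hy'
        have h2 := congrFun (congrArg Prod.snd h) (t j)
        rw [Prod.snd_mul, Pi.mul_apply, gg_snd, hν j, if_pos hy] at h2
        revert h2
        simp
      rw [hem, gg_empty, mul_one] at h
      exact hne h
    rw [this, Lf_zero, mul_zero]
  · intro h
    exact absurd (by simp [BB]) h

theorem Cert_XG {k : ℕ} (hc : Cert K G k) : Cert K (XG G) (k + 1) := by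
  obtain ⟨ζ, h1, h2⟩ := hc
  refine ⟨al G ζ, fun T hT => al_cocycle ζ h1 T hT, ?_⟩
  rintro ⟨c', hc'⟩
  apply h2
  refine ⟨fun s => - EE G k c' s, fun t ht hI => ?_⟩
  rw [← EE_al ζ t ht hI]
  have h3 : EE G (k + 1) (fun T => al G ζ (es K T)) t = EE G (k + 1) (dl c') t := by
    rw [EE, EE]
    refine Finset.sum_congr rfl fun ν _ => ?_
    congr 1
    refine Lcongr _ _ _ _ _ ht hI ?_
    intro σ hσ hσ0 hsub
    refine hc' _ ?_ ?_
    · intro a b hab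
      exact hσ (gg_inj (mul_left_cancel hab))
    · intro a b hab
      apply hab
      have hi := IndT_image hI
      rw [Compat_mul, Compat_gg (Ind_mono hi (hsub a)) (Ind_mono hi (hsub b))]
      exact fun p hp q hq => hi p (hsub a hp) q (hsub b hq)
  rw [h3, EE_dl _ _ _ ht hI, ← Finset.sum_neg_distrib]
  refine Finset.sum_congr rfl fun i _ => ?_
  ring

end CertStep

theorem Cert_K2 (K : Type*) [Field K] : Cert K (⊤ : SimpleGraph Bool) 0 := by
  classical
  refine ⟨AlternatingMap.ofSubsingleton K (Bool →₀ K) K (0 : Fin 1) (Finsupp.lapply true), ?_, ?_⟩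
  · intro t ht
    have h := ht 0 1
    simp only [SimpleGraph.top_adj, ne_eq, not_not] at h
    simp [Fin.sum_univ_succ, es, h]
  · rintro ⟨c, hc⟩
    have h1 := hc (fun _ => true) (fun a b _ => Subsingleton.elim (α := Fin 1) a b) (fun i j => by simp)
    have h2 := hc (fun _ => false) (fun a b _ => Subsingleton.elim (α := Fin 1) a b) (fun i j => by simp)
    have he : ∀ (f g : Fin 0 → Bool), f = g := fun f g => Subsingleton.elim _ _
    have h3 : ∀ b : Bool, (∑ i : Fin 1, (-1 : K) ^ (i : ℕ) * c ((fun _ => b) ∘ i.succAbove)) = c (fun i => i.elim0) := by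
      intro b
      rw [Fin.sum_univ_one, he ((fun _ => b) ∘ Fin.succAbove 0) (fun i => i.elim0)]
      simp
    have h4 := h1.trans ((h3 true).trans ((h3 false).symm.trans h2.symm))
    simp [es] at h4

theorem RR_K2 : RR (⊤ : SimpleGraph Bool) Set.univ 1 := by
  refine RR.step _ _ true trivial (RR.base _ _ ?_) (RR.base _ _ ?_)
  · rintro (_ | _) hx (_ | _) hy <;> simp at hx hy ⊢
  · rintro (_ | _) hx (_ | _) hy <;> simp at hx hy ⊢

/-- all the graphs -/
theorem exists_X (K : Type*) [Field K] (r : ℕ) : ∃ (Y : Type) (_ : Fintype Y) (G : SimpleGraph Y),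
    NoTwo G ∧ RR G Set.univ (r + 1) ∧ Cert K G r := by
  classical
  induction r with
  | zero =>
    refine ⟨Bool, inferInstance, ⊤, ?_, ?_, ?_⟩
    · intro u v x y h1 h2 h3 h4 h5 h6
      simp only [SimpleGraph.top_adj, ne_eq, not_not] at *
      subst h3 h4; exact h2 rfl
    · exact RR_K2
    · exact Cert_K2 K
  | succ r ih =>
    obtain ⟨Y, _, G, h1, h2, h3⟩ := ih
    letI : LinearOrder Y := LinearOrder.lift' (Fintype.equivFin Y) (Fintype.equivFin Y).injective
    exact ⟨NN Y, inferInstance, XG G, NoTwo_XG h1, RR_XG h2, Cert_XG h3⟩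


theorem finish {K : Type*} [Field K] {V : Type} [Fintype V] (G : SimpleGraph V) (a r s : ℕ)
    (hcon : G.Connected) (hB : IMB G a) (u v : Fin a → V) (hI : IMd G u v)
    (hR : RR G Set.univ (r + 1)) (hC : Cert K G r)
    (hs : (QP G).natDegree - (QP G).natTrailingDegree = s) :
    ∃ (m : ℕ) (G : SimpleGraph (Fin m)), G.Connected ∧
      indMatchNum G = a ∧
      reg K (edgeIdeal K G) = r + 1 ∧
      ∃ (d : ℕ) (h : Polynomial ℤ),
        HilbEq K (edgeIdeal K G) d h ∧ h.natDegree = s := by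
  classical
  let e : V ≃ Fin (Fintype.card V) := Fintype.equivFin V
  let H : SimpleGraph (Fin (Fintype.card V)) := G.comap e.symm
  have hadj : ∀ x y, H.Adj (e x) (e y) ↔ G.Adj x y := by
    intro x y; simp [H]
  have hadj' : ∀ x y, G.Adj (e.symm x) (e.symm y) ↔ H.Adj x y := by
    intro x y; simp [H]
  let i : G ≃g H := ⟨e, fun {x y} => hadj x y⟩
  refine ⟨Fintype.card V, H, i.connected_iff.1 hcon, ?_, ?_, ?_⟩
  · refine indMatchNum_eq ?_ (e ∘ u) (e ∘ v) (IMd_map e hadj hI)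
    intro k u v h
    exact hB k _ _ (IMd_map e.symm hadj' h)
  · have h1 : RR H Set.univ (r + 1) := by
      refine RR_family hR (fun w => {e.symm w}) _ (fun _ _ => Set.subset_univ _) ?_
      intro v _ w _
      simp [hadj']
    have h2 : regBound K (edgeIdeal K H) (r + 1) := regBound_of_RR h1
    have h3 : Cert K H r := by
      refine Cert_ind e e.injective hadj ?_ hC
      intro v hv
      exact absurd (e.surjective v) hv
    apply le_antisymm
    · exact Nat.sInf_le h2
    · exact le_csInf ⟨_, h2⟩ (fun b hb => cert_lower H r b h3 hb)
  · obtain ⟨d, h, h1, h2⟩ := HilbEq_of (K := K) H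
    refine ⟨d, h, h1, ?_⟩
    rw [h2, ← QP_iso i, hs]

def aK2 (a : ℕ) : SimpleGraph (Fin a × Bool) where
  Adj x y := x.1 = y.1 ∧ x.2 ≠ y.2
  symm := ⟨fun _ _ h => ⟨h.1.symm, h.2.symm⟩⟩
  loopless := ⟨fun _ h => h.2 rfl⟩

theorem aK2_IMd (a : ℕ) : IMd (aK2 a) (fun i => (i, false)) (fun i => (i, true)) := by
  refine ⟨fun i => ⟨rfl, by simp⟩, fun i j hij => ⟨fun h => hij h.1, fun h => hij h.1, fun h => hij h.1⟩⟩

theorem aK2_IMB (a : ℕ) : IMB (aK2 a) a := by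
  intro k u v h
  have : Function.Injective (fun i => (u i).1) := by
    intro i j hij
    by_contra hne
    have h1 := h.2 i j hne
    have h2 := h.1 j
    have h3 : (u i).2 = (u j).2 := by
      by_contra h4
      exact h1.1 ⟨hij, h4⟩
    exact h1.2.1 ⟨hij.trans h2.1, by rw [h3]; exact h2.2⟩
  simpa using Fintype.card_le_of_injective _ this

theorem aK2_RR (a : ℕ) : RR (aK2 a) Set.univ a := by
  classical
  refine RR_alpha _ Set.univ Set.univ a rfl (fun _ _ _ _ _ => trivial) ?_
  intro F _ hF
  have : Set.InjOn Prod.fst (F : Set (Fin a × Bool)) := by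
    intro x hx y hy hxy
    by_contra hne
    exact hF x hx y hy ⟨hxy, fun h => hne (Prod.ext hxy h)⟩
  rw [← Finset.card_image_of_injOn this]
  simpa using Finset.card_le_univ (F.image Prod.fst)

theorem QP_bot (V : Type) [Fintype V] : QP (⊥ : SimpleGraph V) = Polynomial.X ^ Fintype.card V := by
  classical
  have h1 : indepF (⊥ : SimpleGraph V) = (Finset.univ : Finset V).powerset := by
    ext F
    rw [mem_indepF]
    simp
  rw [QP, h1]
  have := Finset.sum_pow_mul_eq_add_pow (Polynomial.X - 1 : Polynomial ℤ) 1 (Finset.univ : Finset V)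
  simp only [one_pow, mul_one, sub_add_cancel] at this
  rw [this, Finset.card_univ]

theorem RR_bot (V : Type) (b : ℕ) : RR (⊥ : SimpleGraph V) Set.univ b :=
  RR.base _ _ (by simp)

theorem IMB_bot (V : Type) (b : ℕ) : IMB (⊥ : SimpleGraph V) b := by
  intro k u v h
  by_contra hk
  push Not at hk
  exact h.1 ⟨0, by omega⟩

def thE : List (Fin 7 × Fin 7) :=
  [(0, 2), (2, 1), (0, 3), (3, 4), (4, 1), (0, 5), (5, 6), (6, 1)]

def thG : SimpleGraph (Fin 7) where
  Adj x y := x ≠ y ∧ (x, y) ∉ thE ∧ (y, x) ∉ thE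
  symm := ⟨fun _ _ h => ⟨h.1.symm, h.2.2, h.2.1⟩⟩
  loopless := ⟨fun _ h => h.1 rfl⟩

instance : DecidableRel thG.Adj := fun x y => by unfold thG; infer_instance

theorem thG_NoTwo : NoTwo thG := by
  have : ∀ u v x y : Fin 7, ¬ (thG.Adj u v ∧ thG.Adj x y ∧ ¬ thG.Adj u x ∧ ¬ thG.Adj u y ∧
      ¬ thG.Adj v x ∧ ¬ thG.Adj v y) := by
    decide +kernel
  intro u v x y h1 h2 h3 h4 h5 h6
  exact this u v x y ⟨h1, h2, h3, h4, h5, h6⟩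

theorem thG_al : ∀ x y z : Fin 7, x ≠ y → x ≠ z → y ≠ z → ¬ thG.Adj x y → ¬ thG.Adj x z →
    ¬ thG.Adj y z → False := by
  decide +kernel

theorem thG_card (F : Finset (Fin 7)) (hF : ∀ x ∈ F, ∀ y ∈ F, ¬ thG.Adj x y) : F.card ≤ 2 := by
  by_contra h
  push Not at h
  obtain ⟨x, y, z, hx, hy, hz, h1, h2, h3⟩ := Finset.two_lt_card_iff.1 h
  exact thG_al x y z h1 h2 h3 (hF _ hx _ hy) (hF _ hx _ hz) (hF _ hy _ hz)

theorem thG_RR : RR thG Set.univ 2 :=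
  RR_alpha _ Set.univ Set.univ 2 rfl (fun _ _ _ _ _ => trivial) (fun F _ hF => thG_card F hF)

theorem thG_deg : (QP thG).natDegree ≤ 2 := by
  rw [QP]
  refine Polynomial.natDegree_sum_le_of_forall_le _ _ ?_
  intro F hF
  refine (Polynomial.natDegree_pow_le_of_le (m := 1) _ ?_).trans ?_
  · exact Polynomial.natDegree_X_sub_C_le (1 : ℤ)
  · rw [mul_one]; exact thG_card F ((mem_indepF _ _).1 hF)

theorem thG_sum : ∑ F ∈ (Finset.univ : Finset (Fin 7)).powerset.filter
    (fun F => ∀ x ∈ F, ∀ y ∈ F, ¬ thG.Adj x y), (-1 : ℤ) ^ F.card = 2 := by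
  decide +kernel

theorem thG_zero : (QP thG).coeff 0 = 2 := by
  rw [QP, ← thG_sum, Polynomial.coeff_zero_eq_eval_zero, Polynomial.eval_finsetSum]
  refine Finset.sum_congr ?_ ?_
  · ext F; rw [mem_indepF]; simp
  · intro F _; simp


def Build (M : ℕ) (P : Polynomial ℤ) : Prop :=
  ∃ (V : Type) (_ : Fintype V) (G : SimpleGraph V) (B : Finset V), B.card = M ∧
    (∀ x ∈ B, ∀ y ∈ B, ¬ G.Adj x y) ∧ IMB G 1 ∧ RR G Set.univ 2 ∧ QP G = P

theorem Build_base (M : ℕ) : Build M (Polynomial.X ^ M) := by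
  refine ⟨Fin M, inferInstance, ⊥, Finset.univ, by simp, by simp, IMB_bot _ _, RR_bot _ _, ?_⟩
  rw [QP_bot, Fintype.card_fin]

theorem Build_glue {M : ℕ} {P : Polynomial ℤ} (h : Build M P) {j : ℕ} (hj : j ≤ M) {W : Type}
    [Fintype W] {H : SimpleGraph W} (h1 : IMB H 1) (h2 : RR H Set.univ 2) :
    Build M (P + Polynomial.X ^ j * (QP H - 1)) := by
  obtain ⟨V, _, G, B, hB, hi, hm, hr, rfl⟩ := h
  obtain ⟨S, hSB, hS⟩ := Finset.exists_subset_card_eq (hB.symm ▸ hj)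
  have hSi : ∀ x ∈ S, ∀ y ∈ S, ¬ G.Adj x y := fun x hx y hy => hi x (hSB hx) y (hSB hy)
  refine ⟨V ⊕ W, inferInstance, glue G (S : Set V) H, B.map ⟨Sum.inl, Sum.inl_injective⟩, ?_, ?_, ?_,
    ?_, ?_⟩
  · rw [Finset.card_map, hB]
  · intro x hx y hy
    rw [Finset.mem_map] at hx hy
    obtain ⟨x, hx, rfl⟩ := hx
    obtain ⟨y, hy, rfl⟩ := hy
    exact hi x hx y hy
  · exact glue_IMB (fun x hx y hy => hSi x hx y hy) le_rfl hm h1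
  · exact RR_glue (fun x hx y hy => hSi x hx y hy) (by norm_num) hr h2
  · rw [QP_glue hSi, hS]

theorem Build_many {M : ℕ} {P : Polynomial ℤ} (h : Build M P) {j : ℕ} (hj : j ≤ M) {W : Type}
    [Fintype W] {H : SimpleGraph W} (h1 : IMB H 1) (h2 : RR H Set.univ 2) (n : ℕ) :
    Build M (P + Polynomial.X ^ j * ((n : Polynomial ℤ) * (QP H - 1))) := by
  induction n with
  | zero => simpa using h
  | succ n ih =>
    have := Build_glue ih hj h1 h2
    convert this using 1
    push_cast
    ring

theorem Build_points {M : ℕ} {P : Polynomial ℤ} (h : Build M P) {j : ℕ} (hj : j ≤ M) (n : ℕ) :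
    Build M (P + Polynomial.X ^ j * ((n : Polynomial ℤ) * (Polynomial.X - 1))) := by
  have := Build_many h hj (IMB_bot Unit 1) (RR_bot Unit 2) n
  rw [QP_bot] at this
  simpa using this

theorem natDeg_X_sub_one : (Polynomial.X - 1 : Polynomial ℤ).natDegree ≤ 1 :=
  Polynomial.natDegree_X_sub_C_le (1 : ℤ)

theorem Build_add (c : ℤ) : ∃ D : Polynomial ℤ, D.natDegree ≤ 2 ∧ D.coeff 0 = c ∧ D.eval 1 = 0 ∧
    ∀ (M : ℕ) (P : Polynomial ℤ) (j : ℕ), j ≤ M → Build M P → Build M (P + Polynomial.X ^ j * D) := by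
  rcases le_total 0 c with hc | hc
  · obtain ⟨n, rfl⟩ := Int.eq_ofNat_of_zero_le hc
    refine ⟨(n : Polynomial ℤ) * (QP thG - 1), ?_, ?_, ?_, fun M P j hj h =>
      Build_many h hj (IMB_one_of thG_NoTwo) thG_RR n⟩
    · refine Polynomial.natDegree_mul_le.trans ?_
      rw [Polynomial.natDegree_natCast, zero_add]
      exact (Polynomial.natDegree_sub_le _ _).trans (max_le thG_deg (by simp))
    · rw [Polynomial.mul_coeff_zero, Polynomial.coeff_sub, thG_zero]
      simp
    · simp [QP_eval_one]
  · obtain ⟨n, hn⟩ := Int.eq_ofNat_of_zero_le (neg_nonneg.2 hc)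
    refine ⟨(n : Polynomial ℤ) * (Polynomial.X - 1), ?_, ?_, ?_, fun M P j hj h =>
      Build_points h hj n⟩
    · refine Polynomial.natDegree_mul_le.trans ?_
      rw [Polynomial.natDegree_natCast, zero_add]
      exact natDeg_X_sub_one.trans (by norm_num)
    · rw [Polynomial.mul_coeff_zero]
      simp
      omega
    · simp

theorem cascade (R : Polynomial ℤ) (n : ℕ) : ∃ D F : Polynomial ℤ, D.natDegree ≤ n + 1 ∧
    D.eval 1 = 0 ∧ R + D = Polynomial.X ^ n * F ∧
    ∀ (M : ℕ) (P : Polynomial ℤ), n ≤ M → Build M P → Build M (P + D) := by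
  induction n with
  | zero => exact ⟨0, R, by simp, by simp, by simp, fun M P _ h => by simpa using h⟩
  | succ n ih =>
    obtain ⟨D, F, h1, h2, h3, h4⟩ := ih
    obtain ⟨E, e1, e2, e3, e4⟩ := Build_add (- F.coeff 0)
    have hd : Polynomial.X ∣ F + E := by
      rw [Polynomial.X_dvd_iff]; simp [e2]
    obtain ⟨F', hF'⟩ := hd
    refine ⟨D + Polynomial.X ^ n * E, F', ?_, ?_, ?_, ?_⟩
    · refine (Polynomial.natDegree_add_le _ _).trans (max_le (by omega) ?_)
      refine Polynomial.natDegree_mul_le.trans ?_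
      rw [Polynomial.natDegree_X_pow]; omega
    · simp [h2, e3]
    · rw [← add_assoc, h3, ← mul_add, hF', pow_succ, mul_assoc]
    · intro M P hM hP
      rw [← add_assoc]
      exact e4 M _ n (by omega) (h4 M P (by omega) hP)

theorem degs (n s e : ℕ) (hs : 1 ≤ s) (he : 1 ≤ e) (Q : Polynomial ℤ)
    (hQ : Q = Polynomial.X ^ n * (Polynomial.X ^ s + (e : Polynomial ℤ) * (Polynomial.X - 1))) :
    Q.natDegree - Q.natTrailingDegree = s := by
  set p : Polynomial ℤ := Polynomial.X ^ s + (e : Polynomial ℤ) * (Polynomial.X - 1) with hp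
  have c0 : p.coeff 0 ≠ 0 := by
    rw [hp, Polynomial.coeff_add, Polynomial.mul_coeff_zero, Polynomial.coeff_X_pow]
    rw [if_neg (by omega)]
    simp
    omega
  have hp0 : p ≠ 0 := by rintro h; rw [h] at c0; simp at c0
  have ht : p.natTrailingDegree = 0 := Polynomial.natTrailingDegree_eq_zero.2 (Or.inr c0)
  have hec : (e : Polynomial ℤ) = Polynomial.C (e : ℤ) := by simp
  have hd : p.natDegree = s := by
    apply le_antisymm
    · refine (Polynomial.natDegree_add_le _ _).trans (max_le (by simp) ?_)
      refine Polynomial.natDegree_mul_le.trans ?_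
      rw [Polynomial.natDegree_natCast, zero_add]
      exact natDeg_X_sub_one.trans hs
    · apply Polynomial.le_natDegree_of_ne_zero
      rw [hp, Polynomial.coeff_add, hec, Polynomial.coeff_C_mul, Polynomial.coeff_X_pow_self,
        Polynomial.coeff_sub, Polynomial.coeff_X, Polynomial.coeff_one, if_neg (show ¬ s = 0 by omega)]
      split_ifs <;> simp <;> omega
  rw [hQ, Polynomial.natDegree_mul (by simp) hp0, Polynomial.natTrailingDegree_mul (by simp) hp0, ht, hd]
  simp

theorem lin_form (F : Polynomial ℤ) (hd : F.natDegree ≤ 1) (h1 : F.eval 1 = 0) :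
    F = Polynomial.C (F.coeff 1) * (Polynomial.X - 1) := by
  have h := Polynomial.eq_X_add_C_of_natDegree_le_one hd
  rw [h] at h1
  simp at h1
  conv_lhs => rw [h]
  have : F.coeff 0 = - F.coeff 1 := by omega
  rw [this]
  simp
  ring

theorem exists_G2 (R : Polynomial ℤ) (hR : R.eval 1 = 0) (s : ℕ) (hs : 1 ≤ s) :
    ∃ (M : ℕ) (P : Polynomial ℤ), 1 ≤ M ∧ Build M P ∧
      (P + R).natDegree - (P + R).natTrailingDegree = s := by
  set n := R.natDegree
  obtain ⟨D, F, h1, h2, h3, h4⟩ := cascade R n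
  have hF1 : F.eval 1 = 0 := by
    have := congrArg (Polynomial.eval 1) h3
    simpa [hR, h2] using this.symm
  have hFd : F.natDegree ≤ 1 := by
    by_cases hF0 : F = 0
    · simp [hF0]
    have h5 : (R + D).natDegree ≤ n + 1 :=
      (Polynomial.natDegree_add_le _ _).trans (max_le (by omega) h1)
    rw [h3, Polynomial.natDegree_mul (by simp) hF0, Polynomial.natDegree_X_pow] at h5
    omega
  have hF := lin_form F hFd hF1
  obtain ⟨k, e, hk, he⟩ : ∃ k e : ℕ, 1 ≤ e ∧ F.coeff 1 + k = e := by
    refine ⟨(F.coeff 1).natAbs + 1, (F.coeff 1 + ((F.coeff 1).natAbs + 1)).toNat, ?_, ?_⟩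
    · omega
    · omega
  refine ⟨n + s, _, by omega, Build_points (h4 (n + s) _ (by omega) (Build_base _)) (j := n) (by omega) k, ?_⟩
  apply degs n s e hs hk
  have he' : (e : Polynomial ℤ) = Polynomial.C (F.coeff 1) + (k : Polynomial ℤ) := by
    have := congrArg (Polynomial.C : ℤ → Polynomial ℤ) he
    simpa using this.symm
  have h3' : R = Polynomial.X ^ n * F - D := by rw [← h3]; ring
  rw [he']
  conv_lhs => rw [h3', hF]
  ring

theorem QP_join {V W : Type} [Fintype V] [Fintype W] {G : SimpleGraph V} {H : SimpleGraph W} :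
    QP (glue G ∅ H) = QP G + (QP H - 1) := by
  have := QP_glue (G := G) (S := ∅) (H := H) (by simp)
  rw [Finset.coe_empty] at this
  simpa using this

theorem IMd_inl {V W : Type} {G : SimpleGraph V} {S : Set V} {H : SimpleGraph W} {k : ℕ}
    {u v : Fin k → V} (h : IMd G u v) : IMd (glue G S H) (Sum.inl ∘ u) (Sum.inl ∘ v) :=
  IMd_map Sum.inl (fun _ _ => Iff.rfl) h

theorem IMd_inr {V W : Type} {G : SimpleGraph V} {S : Set V} {H : SimpleGraph W} {k : ℕ}
    {u v : Fin k → W} (h : IMd H u v) : IMd (glue G S H) (Sum.inr ∘ u) (Sum.inr ∘ v) :=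
  IMd_map Sum.inr (fun _ _ => Iff.rfl) h

theorem QP_K2 : QP (⊤ : SimpleGraph Bool) = 2 * Polynomial.X - 1 := by
  classical
  have : indepF (⊤ : SimpleGraph Bool) = {∅, {true}, {false}} := by
    ext F
    rw [mem_indepF]
    revert F
    decide
  rw [QP, this]
  rw [Finset.sum_insert (by decide), Finset.sum_insert (by decide)]
  simp
  ring

theorem stmt_19 (K : Type*) [Field K] (a r s : ℕ)
    (ha : 1 ≤ a) (har : a ≤ r) (hs : 1 ≤ s) :
    ∃ (m : ℕ) (G : SimpleGraph (Fin m)), G.Connected ∧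
      indMatchNum G = a ∧
      reg K (edgeIdeal K G) = r ∧
      ∃ (d : ℕ) (h : Polynomial ℤ),
        HilbEq K (edgeIdeal K G) d h ∧ h.natDegree = s := by
  obtain ⟨r, rfl⟩ : ∃ r', r = r' + 1 := ⟨r - 1, by omega⟩
  rcases Nat.eq_zero_or_pos r with rfl | hr
  · obtain rfl : a = 1 := by omega
    have hne : Nonempty (Fin s) := ⟨⟨0, by omega⟩⟩
    have hIB : IMB (⊤ : SimpleGraph Bool) 1 := by
      apply IMB_one_of
      intro u v x y h1 h2 h3 h4 h5 h6
      simp only [SimpleGraph.top_adj, ne_eq, not_not] at *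
      subst h3 h4; exact h2 rfl
    have hI : IMd (⊤ : SimpleGraph Bool) (k := 1) (fun _ => true) (fun _ => false) := by
      refine ⟨fun _ => by simp, fun i j hij => absurd (Subsingleton.elim i j) hij⟩
    refine finish (glue (⊥ : SimpleGraph (Fin s)) ∅ (⊤ : SimpleGraph Bool)) 1 0 s
      (glue_connected _ _) (glue_IMB (by simp) le_rfl (IMB_bot _ _) hIB) _ _ (IMd_inr hI)
      (RR_glue (by simp) le_rfl (RR_bot _ _) RR_K2) (Cert_glue (Cert_K2 K)) ?_
    refine degs 0 s 2 hs (by norm_num) _ ?_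
    rw [QP_join, QP_bot, QP_K2, Fintype.card_fin]
    push_cast
    ring
  · obtain ⟨Y, _, X, hX1, hX2, hX3⟩ := exists_X K r
    set Z := glue (aK2 a) ∅ X with hZ
    obtain ⟨M, P, hM, ⟨V, _, G, B, hB, _, hm, hr2, hP⟩, hdeg⟩ :=
      exists_G2 (QP Z - 1) (by simp [QP_eval_one]) s hs
    have hne : Nonempty V := by
      have : B.Nonempty := by rw [← Finset.card_pos]; omega
      exact ⟨this.choose⟩
    have hne2 : Nonempty ((Fin a × Bool) ⊕ Y) := ⟨Sum.inl (⟨0, by omega⟩, true)⟩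
    refine finish (glue G ∅ Z) a r s (glue_connected _ _)
      (glue_IMB (by simp) ha (IMB_mono hm ha)
        (glue_IMB (by simp) ha (aK2_IMB a) (IMB_mono (IMB_one_of hX1) ha))) _ _
      (IMd_inr (IMd_inl (aK2_IMd a)))
      (RR_glue (by simp) (by omega) (RR_mono' hr2 (by omega))
        (RR_glue (by simp) (by omega) (RR_mono' (aK2_RR a) har) hX2))
      (Cert_glue (Cert_glue hX3)) ?_
    rw [QP_join, hP]
    exact hdeg
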